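/- For every partition λ and every monomial m in the commuting variables x_i, α_i, β_i, the number of hook-valued tableaux H ∈ HVT(λ) with wt(H) = m, the number of triples (μ,P,E) with μ ⊇ λ a partition, P ∈ SSYT(μ), E ∈ EXQ(μ/λ) and wt(P)·wt(E) = m, and the number of triples (μ,P,Q) with μ ⊇ λ a partition, P ∈ SSYT(μ), Q ∈ BFT(μ/λ) and wt(P)·wt(Q) = m, are all equal (and finite). Equivalently, as generating functions, Σ_{H∈HVT(λ)} wt(H) = Σ_{μ⊇λ} s_μ(x) Σ_{E∈EXQ(μ/λ)} wt(E) = Σ_{μ⊇λ} s_μ(x) Σ_{Q∈BFT(μ/λ)} wt(Q), where s_μ(x) = Σ_{P∈SSYT(μ)} wt(P) is the Schur function. -/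

import Mathlib

/-!
Common definitions: mixed tableaux, tableau switching, shuffling, GG-jdt,
hook-valued tableaux and the uncrowding algorithms.
Conventions: French notation, cells `(i, j)` with `i` the row index (counted
from the bottom) and `j` the column index, both `≥ 1`.
-/

open scoped Classical

abbrev Cell : Type := ℕ × ℕ

/-- The cell directly above `c`. -/
def upCell (c : Cell) : Cell := (c.1 + 1, c.2)

/-- The cell directly to the right of `c`. -/
def rtCell (c : Cell) : Cell := (c.1, c.2 + 1)

/-- A (finite) partition shape: a finite lower-order ideal of cells in the
positive quadrant (1-indexed, French notation). -/
def IsPartitionShape (s : Set Cell) : Prop :=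
  s.Finite ∧ (∀ c ∈ s, 1 ≤ c.1 ∧ 1 ≤ c.2) ∧
    ∀ i j i' j' : ℕ, (i, j) ∈ s → 1 ≤ i' → i' ≤ i → 1 ≤ j' → j' ≤ j → (i', j') ∈ s

/-- Entries of mixed tableaux: `al k` represents `α_k`, `be k` represents `β_k`. -/
inductive MEntry : Type
  | al (k : ℤ)
  | be (k : ℤ)
  deriving DecidableEq

/-- The index of a mixed entry. -/
def MEntry.idx : MEntry → ℤ
  | .al k => k
  | .be k => k

def MEntry.isAlpha : MEntry → Prop
  | .al _ => True
  | .be _ => False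

def MEntry.isBeta : MEntry → Prop
  | .al _ => False
  | .be _ => True

/-- A mixed tableau: a partial filling of cells with mixed entries. -/
abbrev MixedTableau : Type := Cell → Option MEntry

/-- The set of cells filled in a mixed tableau. -/
def mshape (T : MixedTableau) : Set Cell := {c | T c ≠ none}

/-- A legal mixed tableau: finitely many cells, all in the positive quadrant,
and indices of `α` entries are positive. -/
def IsMixedTableau (T : MixedTableau) : Prop :=
  (mshape T).Finite ∧ (∀ c ∈ mshape T, 1 ≤ c.1 ∧ 1 ≤ c.2) ∧
    ∀ c k, T c = some (MEntry.al k) → 0 < k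

/-- `T` is a filling of the skew shape `mu / lam`. -/
def HasSkewShape (T : MixedTableau) (lam mu : Set Cell) : Prop :=
  IsPartitionShape lam ∧ IsPartitionShape mu ∧ lam ⊆ mu ∧ mshape T = mu \ lam

/-- `γ`-column-strictness for the entries selected by `p`:
indices weakly decrease to the northeast, and no two selected entries in the
same column have equal indices. -/
def ColumnStrictFor (p : MEntry → Prop) (T : MixedTableau) : Prop :=
  (∀ c c' e e', T c = some e → T c' = some e' → p e → p e' →
      c.1 ≤ c'.1 → c.2 ≤ c'.2 → MEntry.idx e' ≤ MEntry.idx e) ∧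
  (∀ c c' e e', T c = some e → T c' = some e' → p e → p e' →
      c.2 = c'.2 → c ≠ c' → MEntry.idx e ≠ MEntry.idx e')

/-- `γ`-row-strictness for the entries selected by `p`. -/
def RowStrictFor (p : MEntry → Prop) (T : MixedTableau) : Prop :=
  (∀ c c' e e', T c = some e → T c' = some e' → p e → p e' →
      c.1 ≤ c'.1 → c.2 ≤ c'.2 → MEntry.idx e' ≤ MEntry.idx e) ∧
  (∀ c c' e e', T c = some e → T c' = some e' → p e → p e' →
      c.1 = c'.1 → c ≠ c' → MEntry.idx e ≠ MEntry.idx e')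

def AlphaColumnStrict (T : MixedTableau) : Prop := ColumnStrictFor MEntry.isAlpha T
def AlphaRowStrict (T : MixedTableau) : Prop := RowStrictFor MEntry.isAlpha T
def BetaColumnStrict (T : MixedTableau) : Prop := ColumnStrictFor MEntry.isBeta T
def BetaRowStrict (T : MixedTableau) : Prop := RowStrictFor MEntry.isBeta T

def alphaCells (T : MixedTableau) : Set Cell := {c | ∃ k, T c = some (MEntry.al k)}
def betaCells (T : MixedTableau) : Set Cell := {c | ∃ k, T c = some (MEntry.be k)}

/-- `(α,β)`-sortedness relative to the skew shape `mu / lam`: the `α`-cells form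
`nu / lam` and the `β`-cells form `mu / nu` for some partition `nu`. -/
def ABSortedShape (T : MixedTableau) (lam mu : Set Cell) : Prop :=
  ∃ nu : Set Cell, IsPartitionShape nu ∧ lam ⊆ nu ∧ nu ⊆ mu ∧
    alphaCells T = nu \ lam ∧ betaCells T = mu \ nu

/-- `(α,β)`-sorted. -/
def ABSorted (T : MixedTableau) : Prop :=
  ∃ lam mu : Set Cell, HasSkewShape T lam mu ∧ ABSortedShape T lam mu

/-- `(β,α)`-sortedness relative to the skew shape `mu / lam`. -/
def BASortedShape (T : MixedTableau) (lam mu : Set Cell) : Prop :=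
  ∃ nu : Set Cell, IsPartitionShape nu ∧ lam ⊆ nu ∧ nu ⊆ mu ∧
    betaCells T = nu \ lam ∧ alphaCells T = mu \ nu

/-- `(β,α)`-sorted. -/
def BASorted (T : MixedTableau) : Prop :=
  ∃ lam mu : Set Cell, HasSkewShape T lam mu ∧ BASortedShape T lam mu

/-- Interchange the contents of two cells. -/
def swapCells (T : MixedTableau) (c c' : Cell) : MixedTableau :=
  Function.update (Function.update T c (T c')) c' (T c)

/-- A switch: interchange an `α_r` with a `β_s` directly to its right or
directly above it, provided both the source and the result are
`α`-column-strict and `β`-row-strict. -/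
def Switch (T T' : MixedTableau) : Prop :=
  AlphaColumnStrict T ∧ BetaRowStrict T ∧
  ∃ c c' : Cell, (c' = rtCell c ∨ c' = upCell c) ∧
    (∃ r, T c = some (MEntry.al r)) ∧ (∃ s, T c' = some (MEntry.be s)) ∧
    T' = swapCells T c c' ∧ AlphaColumnStrict T' ∧ BetaRowStrict T'

/-- Fully switched: no switch is possible. -/
def FullySwitched (T : MixedTableau) : Prop := ¬ ∃ T', Switch T T'

/-- The cell `c` contains a `β` entry. -/
def isBetaCell (T : MixedTableau) (c : Cell) : Prop := ∃ k, T c = some (MEntry.be k)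

/-- One step of the switching process of the shuffle: the `α` entry at `c`
moves to the cell `c'` (above or to the right), following the tie-breaking
rule of the jeu de taquin shuffle. -/
def ShuffMoveTo (Q : MixedTableau) (c c' : Cell) (Q' : MixedTableau) : Prop :=
  (∃ i, Q c = some (MEntry.al i)) ∧ Q' = swapCells Q c c' ∧
  ((isBetaCell Q (rtCell c) ∧ ¬ isBetaCell Q (upCell c) ∧ c' = rtCell c) ∨
   (isBetaCell Q (upCell c) ∧ ¬ isBetaCell Q (rtCell c) ∧ c' = upCell c) ∨
   (∃ k j, Q (upCell c) = some (MEntry.be k) ∧ Q (rtCell c) = some (MEntry.be j) ∧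
      ((j < k ∧ c' = upCell c) ∨ (k ≤ j ∧ c' = rtCell c))))

/-- The `α` entry at `c` is settled: the cells above and to the right of it
contain `α` entries or are empty. -/
def ShuffSettled (Q : MixedTableau) (c : Cell) : Prop :=
  ¬ isBetaCell Q (upCell c) ∧ ¬ isBetaCell Q (rtCell c)

/-- The full switching process of a single chosen `α` entry, starting at cell `c`,
until it is settled. -/
inductive ShuffTrack : MixedTableau → Cell → MixedTableau → Prop
  | done : ∀ Q c, ShuffSettled Q c → ShuffTrack Q c Q
  | step : ∀ Q c c' Q' R, ShuffMoveTo Q c c' Q' → ShuffTrack Q' c' R → ShuffTrack Q c R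

/-- The cell `c` holds an `α` entry having a `β` entry directly above or
directly to its right. -/
def ShuffPending (Q : MixedTableau) (c : Cell) : Prop :=
  (∃ i, Q c = some (MEntry.al i)) ∧ (isBetaCell Q (upCell c) ∨ isBetaCell Q (rtCell c))

/-- Among the pending `α` entries, the rightmost one with the smallest index. -/
def ShuffChosen (Q : MixedTableau) (c : Cell) : Prop :=
  ShuffPending Q c ∧ ∃ i, Q c = some (MEntry.al i) ∧
    (∀ c' i', ShuffPending Q c' → Q c' = some (MEntry.al i') → i ≤ i') ∧
    (∀ c', ShuffPending Q c' → Q c' = some (MEntry.al i) → c'.2 ≤ c.2)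

/-- `ShuffRel Q R` means `R = shuff(Q)`, the jeu de taquin shuffle of `Q`. -/
inductive ShuffRel : MixedTableau → MixedTableau → Prop
  | done : ∀ Q, (∀ c, ¬ ShuffPending Q c) → ShuffRel Q Q
  | step : ∀ Q c Q' R, ShuffChosen Q c → ShuffTrack Q c Q' → ShuffRel Q' R → ShuffRel Q R

/-- The entry `α_r` at `c` is out of order via its right neighbour. -/
def OutOfOrderH (T : MixedTableau) (c : Cell) : Prop :=
  ∃ r s : ℤ, T c = some (MEntry.al r) ∧ T (rtCell c) = some (MEntry.be s) ∧
    r < s + ((c.2 : ℤ) + 1) - (c.1 : ℤ)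

/-- The entry `α_r` at `c` is out of order via its upper neighbour. -/
def OutOfOrderV (T : MixedTableau) (c : Cell) : Prop :=
  ∃ r t : ℤ, T c = some (MEntry.al r) ∧ T (upCell c) = some (MEntry.be t) ∧
    r ≤ t + (c.2 : ℤ) - ((c.1 : ℤ) + 1)

def OutOfOrder (T : MixedTableau) (c : Cell) : Prop := OutOfOrderH T c ∨ OutOfOrderV T c

/-- The GG-jdt slide at the cell `c`. -/
def GGSlide (T : MixedTableau) (c : Cell) (T' : MixedTableau) : Prop :=
  (OutOfOrderH T c ∧ ¬ OutOfOrderV T c ∧ T' = swapCells T c (rtCell c)) ∨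
  (OutOfOrderV T c ∧ ¬ OutOfOrderH T c ∧ T' = swapCells T c (upCell c)) ∨
  (OutOfOrderH T c ∧ OutOfOrderV T c ∧
    ∃ s t : ℤ, T (rtCell c) = some (MEntry.be s) ∧ T (upCell c) = some (MEntry.be t) ∧
      ((t ≤ s ∧ T' = swapCells T c (rtCell c)) ∨ (s < t ∧ T' = swapCells T c (upCell c))))

/-- The cell chosen by the GG-jdt map: the rightmost cell containing an
out-of-order `α_r` with `r` smallest. -/
def GGChosen (T : MixedTableau) (c : Cell) : Prop :=
  ∃ r : ℤ, T c = some (MEntry.al r) ∧ OutOfOrder T c ∧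
    (∀ c' r', T c' = some (MEntry.al r') → OutOfOrder T c' → r ≤ r') ∧
    (∀ c', T c' = some (MEntry.al r) → OutOfOrder T c' → c'.2 ≤ c.2)

/-- One iteration of the GG-jdt map. -/
def GGStep (T T' : MixedTableau) : Prop := ∃ c, GGChosen T c ∧ GGSlide T c T'

/-- `GGRel T R` means `R = jdt_GG(T)`. -/
def GGRel (T R : MixedTableau) : Prop :=
  Relation.ReflTransGen GGStep T R ∧ ∀ c, ¬ OutOfOrder R c

/-- `c_β^+`: replace each `β_r` in a cell of content `c = j - i` by `β_{r+c}`. -/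
def cBetaPlus (T : MixedTableau) : MixedTableau := fun c =>
  match T c with
  | some (MEntry.be r) => some (MEntry.be (r + ((c.2 : ℤ) - (c.1 : ℤ))))
  | o => o

/-- Totally column-strict: indices strictly decrease up columns and weakly
decrease along rows. -/
def TotallyColumnStrict (T : MixedTableau) : Prop :=
  (∀ c e e', T c = some e → T (upCell c) = some e' → MEntry.idx e' < MEntry.idx e) ∧
  (∀ c e e', T c = some e → T (rtCell c) = some e' → MEntry.idx e' ≤ MEntry.idx e)

/-- Flagged-mixed tableau: `α_k` in column `j` forces `0 < k < j`, and
`β_k` in row `i` forces `0 < k < i`. -/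
def IsFMT (T : MixedTableau) : Prop :=
  (∀ c k, T c = some (MEntry.al k) → 0 < k ∧ k < (c.2 : ℤ)) ∧
  (∀ c k, T c = some (MEntry.be k) → 0 < k ∧ k < (c.1 : ℤ))

/-- Exquisite tableau of shape `mu / lam`. -/
def IsEXQ (lam mu : Set Cell) (E : MixedTableau) : Prop :=
  IsMixedTableau E ∧ HasSkewShape E lam mu ∧ IsFMT E ∧
    TotallyColumnStrict (cBetaPlus E)

/-- Biflagged tableau of shape `mu / lam`. -/
def IsBFT (lam mu : Set Cell) (Q : MixedTableau) : Prop :=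
  IsMixedTableau Q ∧ HasSkewShape Q lam mu ∧
  AlphaColumnStrict Q ∧ BetaRowStrict Q ∧ ABSortedShape Q lam mu ∧
  IsFMT Q ∧ (∃ R, ShuffRel Q R) ∧ (∀ R, ShuffRel Q R → IsFMT R)

/-- Number of occurrences of the entry `e` in the mixed tableau `Q`:
the exponent of the corresponding variable in `wt(Q)`. -/
noncomputable def mcount (Q : MixedTableau) (e : MEntry) : ℕ :=
  Set.ncard {c | Q c = some e}

/-! ### Hook-valued tableaux -/

/-- A hook: a hook entry, a list of leg entries and a list of arm entries. -/
structure Hook : Type where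
  hk : ℕ
  legs : List ℕ
  arms : List ℕ
  deriving DecidableEq

/-- Valid hook: positive entries, `hk < L₁ < ⋯ < L_ℓ` and `hk ≤ A₁ ≤ ⋯ ≤ A_k`. -/
def Hook.Valid (H : Hook) : Prop :=
  1 ≤ H.hk ∧ H.legs.Chain' (· < ·) ∧ (∀ x ∈ H.legs, H.hk < x) ∧
  H.arms.Chain' (· ≤ ·) ∧ ∀ x ∈ H.arms, H.hk ≤ x

/-- The multiset of all entries of a hook. -/
def Hook.entries (H : Hook) : Multiset ℕ :=
  H.hk ::ₘ ((H.legs : Multiset ℕ) + (H.arms : Multiset ℕ))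

/-- A hook-valued filling. -/
abbrev HVTab : Type := Cell → Option Hook

def hshape (T : HVTab) : Set Cell := {c | T c ≠ none}

noncomputable def hsize (T : HVTab) : ℕ := (hshape T).ncard

def hentriesAt (T : HVTab) (c : Cell) : Multiset ℕ :=
  match T c with
  | some H => H.entries
  | none => 0

def armsAt (T : HVTab) (c : Cell) : List ℕ :=
  match T c with
  | some H => H.arms
  | none => []

def legsAt (T : HVTab) (c : Cell) : List ℕ :=
  match T c with
  | some H => H.legs
  | none => []

/-- Hook-valued tableau: partition shape, valid hooks, rows weakly increasing
(entrywise) and columns strictly increasing (entrywise). -/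
def IsHVT (T : HVTab) : Prop :=
  IsPartitionShape (hshape T) ∧
  (∀ c H, T c = some H → H.Valid) ∧
  (∀ c, ∀ x ∈ hentriesAt T c, ∀ y ∈ hentriesAt T (rtCell c), x ≤ y) ∧
  (∀ c, ∀ x ∈ hentriesAt T c, ∀ y ∈ hentriesAt T (upCell c), x < y)

def NoArms (T : HVTab) : Prop := ∀ c, armsAt T c = []
def NoLegs (T : HVTab) : Prop := ∀ c, legsAt T c = []

/-- Insert into a sorted list. -/
def insSorted (x : ℕ) : List ℕ → List ℕ
  | [] => [x]
  | y :: ys => if x ≤ y then x :: y :: ys else y :: insSorted x ys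

def insSortedAll (xs : List ℕ) (l : List ℕ) : List ℕ :=
  xs.foldl (fun acc x => insSorted x acc) l

/-- In arm-uncrowding, the receiving cell's hook: replace its entry `k`
(the smallest entry `≥ a`) by `a` and insert `k` as an arm entry. -/
def Hook.receiveArm (H : Hook) (a k : ℕ) : Hook :=
  if H.hk = k then ⟨a, H.legs, insSorted k H.arms⟩
  else if k ∈ H.legs then ⟨H.hk, insSorted a (H.legs.erase k), insSorted k H.arms⟩
  else ⟨H.hk, H.legs, insSorted a H.arms⟩

/-- In leg-uncrowding, the receiving cell's hook: replace its entry `k`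
(the smallest entry `> l`) by `l` and insert `k` as a leg entry. -/
def Hook.receiveLeg (H : Hook) (l k : ℕ) : Hook :=
  if H.hk = k then ⟨l, insSorted k H.legs, H.arms⟩
  else if k ∈ H.legs then ⟨H.hk, insSorted l H.legs, H.arms⟩
  else ⟨H.hk, insSorted k H.legs, insSorted l (H.arms.erase k)⟩

/-- Add the arm entries `xs` to the cell `c` of `T`. -/
def addArmsAt (T : HVTab) (c : Cell) (xs : List ℕ) : HVTab :=
  if xs = [] then T
  else
    match T c with
    | some H => Function.update T c (some ⟨H.hk, H.legs, insSortedAll xs H.arms⟩)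
    | none => Function.update T c (some ⟨xs.headI, [], xs.tail⟩)

/-- The arm entry selected by arm-uncrowding: `a` is the largest arm entry in
the rightmost column `c` containing an arm entry, located in cell `(r, c)`. -/
def SelectedArm (T : HVTab) (r c a : ℕ) : Prop :=
  a ∈ armsAt T (r, c) ∧
  (∀ r' x, x ∈ armsAt T (r', c) → x ≤ a) ∧
  (∀ r' c', c < c' → armsAt T (r', c') = [])

/-- The leg entry selected by leg-uncrowding: `l` is the largest leg entry in
the topmost row `r` containing a leg entry, located in cell `(r, c)`. -/
def SelectedLeg (T : HVTab) (r c l : ℕ) : Prop :=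
  l ∈ legsAt T (r, c) ∧
  (∀ c' x, x ∈ legsAt T (r, c') → x ≤ l) ∧
  (∀ r' c', r < r' → legsAt T (r', c') = [])

/-- `k` is the smallest entry `≥ a` in column `col`, located in row `rr`. -/
def SmallestGE (T : HVTab) (col a k rr : ℕ) : Prop :=
  k ∈ hentriesAt T (rr, col) ∧ a ≤ k ∧
  ∀ r' y, y ∈ hentriesAt T (r', col) → a ≤ y → k ≤ y

/-- `k` is the smallest entry `> l` in row `row`, located in column `cc`. -/
def SmallestGT (T : HVTab) (row l k cc : ℕ) : Prop :=
  k ∈ hentriesAt T (row, cc) ∧ l < k ∧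
  ∀ c' y, y ∈ hentriesAt T (row, c') → l < y → k ≤ y

/-- The arm-uncrowding bumping `A_b`. -/
def ArmBumpRel (T T' : HVTab) : Prop :=
  (NoArms T ∧ T' = T) ∨
  (∃ r c a H, T (r, c) = some H ∧ SelectedArm T r c a ∧
    ((∃ k rr HT, SmallestGE T (c + 1) a k rr ∧ T (rr, c + 1) = some HT ∧
        ((rr ≠ r ∧
            T' = Function.update (Function.update T (r, c)
                (some ⟨H.hk, H.legs, H.arms.erase a⟩)) (rr, c + 1)
                (some (Hook.receiveArm HT a k))) ∨
         (rr = r ∧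
            T' = Function.update (Function.update T (r, c)
                (some ⟨H.hk, H.legs.filter (fun x => decide (x ≤ a)), H.arms.erase a⟩))
                (r, c + 1)
                (some ⟨(Hook.receiveArm HT a k).hk,
                       insSortedAll (H.legs.filter (fun x => decide (a < x)))
                         (Hook.receiveArm HT a k).legs,
                       (Hook.receiveArm HT a k).arms⟩)))) ∨
     ((∀ r' y, y ∈ hentriesAt T (r', c + 1) → y < a) ∧
        ∃ t, 1 ≤ t ∧ (∀ r', (r', c + 1) ∈ hshape T ↔ 1 ≤ r' ∧ r' < t) ∧
        ((t ≠ r ∧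
            T' = Function.update (Function.update T (r, c)
                (some ⟨H.hk, H.legs, H.arms.erase a⟩)) (t, c + 1)
                (some ⟨a, [], []⟩)) ∨
         (t = r ∧
            T' = Function.update (Function.update T (r, c)
                (some ⟨H.hk, H.legs.filter (fun x => decide (x ≤ a)), H.arms.erase a⟩))
                (r, c + 1)
                (some ⟨a, H.legs.filter (fun x => decide (a < x)), []⟩))))))

/-- The leg-uncrowding bumping `L_b`. -/
def LegBumpRel (T T' : HVTab) : Prop :=
  (NoLegs T ∧ T' = T) ∨
  (∃ r c l H, T (r, c) = some H ∧ SelectedLeg T r c l ∧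
    ((∃ k cc HT, SmallestGT T (r + 1) l k cc ∧ T (r + 1, cc) = some HT ∧
        ((cc ≠ c ∧
            T' = Function.update (Function.update T (r, c)
                (some ⟨H.hk, H.legs.erase l, H.arms⟩)) (r + 1, cc)
                (some (Hook.receiveLeg HT l k))) ∨
         (cc = c ∧
            T' = addArmsAt
              (Function.update (Function.update T (r, c)
                  (some ⟨H.hk, H.legs.erase l, H.arms.filter (fun x => decide (l < x))⟩))
                  (r + 1, c) (some (Hook.receiveLeg HT l k)))
              (r, c + 1) (H.arms.filter (fun x => decide (x ≤ l)))))) ∨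
     ((∀ c' y, y ∈ hentriesAt T (r + 1, c') → y ≤ l) ∧
        ∃ t, 1 ≤ t ∧ (∀ c', (r + 1, c') ∈ hshape T ↔ 1 ≤ c' ∧ c' < t) ∧
        ((t ≠ c ∧
            T' = Function.update (Function.update T (r, c)
                (some ⟨H.hk, H.legs.erase l, H.arms⟩)) (r + 1, t)
                (some ⟨l, [], []⟩)) ∨
         (t = c ∧
            T' = Function.update (Function.update T (r, c)
                (some ⟨H.hk, H.legs.erase l, H.arms.filter (fun x => decide (l < x))⟩))
                (r + 1, c)
                (some ⟨l, [], H.arms.filter (fun x => decide (x ≤ l))⟩))))))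

/-- `n`-fold composition of a relation. -/
def RelPow {α : Type*} (R : α → α → Prop) : ℕ → α → α → Prop
  | 0, a, b => a = b
  | n + 1, a, b => ∃ x, R a x ∧ RelPow R n x b

/-- The single-arm-uncrowding map `𝒜`. -/
def ArmRel (T T' : HVTab) : Prop :=
  (NoArms T ∧ T' = T) ∨
  (¬ NoArms T ∧ ∃ m : ℕ, RelPow ArmBumpRel m T T' ∧ hsize T' = hsize T + 1 ∧
    ∀ m' U, m' < m → RelPow ArmBumpRel m' T U → hsize U = hsize T)

/-- The single-leg-uncrowding map `ℒ`. -/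
def LegRel (T T' : HVTab) : Prop :=
  (NoLegs T ∧ T' = T) ∨
  (¬ NoLegs T ∧ ∃ m : ℕ, RelPow LegBumpRel m T T' ∧ hsize T' = hsize T + 1 ∧
    ∀ m' U, m' < m → RelPow LegBumpRel m' T U → hsize U = hsize T)

/-- The two kinds of uncrowding operators. -/
inductive Bump : Type
  | A
  | L
  deriving DecidableEq

def BumpRel : Bump → HVTab → HVTab → Prop
  | .A => ArmBumpRel
  | .L => LegBumpRel

/-- `T` has type `f_k^{(ε_k)} ⋯ f_1^{(ε_1)}`; the word is given as the list
`[(f_1, ε_1), …, (f_k, ε_k)]` in order of application. -/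
def HasType : HVTab → List (Bump × ℕ) → Prop
  | _, [] => True
  | T, (f, e) :: w => ∃ T', BumpRel f T T' ∧ hsize T' = hsize T + e ∧ HasType T' w

def StepRel : Bump → HVTab → HVTab → Prop
  | .A => ArmRel
  | .L => LegRel

def SelectedArmCol (T : HVTab) (c : ℕ) : Prop := ∃ r a, SelectedArm T r c a
def SelectedLegRow (T : HVTab) (r : ℕ) : Prop := ∃ c l, SelectedLeg T r c l

/-- The recorded entry of one uncrowding step applied to `T`. -/
def StepEntry : Bump → HVTab → MEntry → Prop
  | .A, T, e => ∃ c : ℕ, SelectedArmCol T c ∧ e = MEntry.al (c : ℤ)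
  | .L, T, e => ∃ r : ℕ, SelectedLegRow T r ∧ e = MEntry.be (r : ℤ)

/-- `UncrowdRec w T P Q` means `𝒰_w(T) = (P, Q)`, where `w` is the word listed
in order of application. -/
def UncrowdRec : List Bump → HVTab → HVTab → MixedTableau → Prop
  | [], T, P, Q => P = T ∧ ∀ c, Q c = none
  | f :: w, T, P, Q => ∃ T' Q', StepRel f T T' ∧ UncrowdRec w T' P Q' ∧
      (∀ cell, cell ∈ hshape T' → cell ∉ hshape T →
        ∃ e, StepEntry f T e ∧ Q cell = some e) ∧
      (∀ cell, ¬ (cell ∈ hshape T' ∧ cell ∉ hshape T) → Q cell = Q' cell)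

/-- `𝒰_{ℒ^∞𝒜^∞}(T) = (P, Q)`. -/
def UncrowdLAinf (T P : HVTab) (Q : MixedTableau) : Prop :=
  ∃ M N : ℕ, UncrowdRec (List.replicate M Bump.A ++ List.replicate N Bump.L) T P Q ∧
    NoArms P ∧ NoLegs P

/-- `𝒰_{𝒜^∞ℒ^∞}(T) = (P, Q)`. -/
def UncrowdALinf (T P : HVTab) (Q : MixedTableau) : Prop :=
  ∃ M N : ℕ, UncrowdRec (List.replicate N Bump.L ++ List.replicate M Bump.A) T P Q ∧
    NoArms P ∧ NoLegs P

/-- A semistandard Young tableau, seen as a hook-valued tableau all of whose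
hooks have no arm and no leg entries. -/
def IsSSYT (P : HVTab) : Prop := IsHVT P ∧ NoArms P ∧ NoLegs P

/-- Number of arm entries in column `j` of `T`: the exponent of `α_j` in `wt(T)`. -/
noncomputable def armCountCol (T : HVTab) (j : ℕ) : ℕ := ∑ᶠ i : ℕ, (armsAt T (i, j)).length

/-- Number of leg entries in row `i` of `T`: the exponent of `β_i` in `wt(T)`. -/
noncomputable def legCountRow (T : HVTab) (i : ℕ) : ℕ := ∑ᶠ j : ℕ, (legsAt T (i, j)).length

/-- Number of entries of `T` equal to `v`: the exponent of `x_v` in `wt(T)`. -/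
noncomputable def entryCount (T : HVTab) (v : ℕ) : ℕ := ∑ᶠ c : Cell, (hentriesAt T c).count v

noncomputable def armCountColZ (T : HVTab) (k : ℤ) : ℕ :=
  if 0 ≤ k then armCountCol T k.toNat else 0

noncomputable def legCountRowZ (T : HVTab) (k : ℤ) : ℕ :=
  if 0 ≤ k then legCountRow T k.toNat else 0

/-- `wt(T) = wt(P) · wt(Q)` for a hook-valued tableau `T`, a semistandard
Young tableau `P` (as a hook-valued tableau) and a mixed tableau `Q`. -/
def WtEq (T P : HVTab) (Q : MixedTableau) : Prop :=
  (∀ j : ℕ, armCountCol T j = mcount Q (MEntry.al (j : ℤ))) ∧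
  (∀ i : ℕ, legCountRow T i = mcount Q (MEntry.be (i : ℤ))) ∧
  (∀ k : ℤ, k ≤ 0 → mcount Q (MEntry.al k) = 0 ∧ mcount Q (MEntry.be k) = 0) ∧
  (∀ v : ℕ, entryCount T v = entryCount P v)

/-- Hook-valued tableaux of shape `lam` with weight given by the exponent
functions `a` (for the `α_k`), `b` (for the `β_k`) and `xv` (for the `x_v`). -/
def GrothHVT (lam : Set Cell) (a b : ℤ → ℕ) (xv : ℕ → ℕ) : Set HVTab :=
  {H | IsHVT H ∧ hshape H = lam ∧
    (∀ k : ℤ, armCountColZ H k = a k) ∧ (∀ k : ℤ, legCountRowZ H k = b k) ∧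
    (∀ v : ℕ, entryCount H v = xv v)}

/-- Triples `(mu, P, E)` with `mu ⊇ lam` a partition, `P ∈ SSYT(mu)`,
`E ∈ EXQ(mu/lam)` and `wt(P)·wt(E)` the given monomial. -/
def GrothEXQ (lam : Set Cell) (a b : ℤ → ℕ) (xv : ℕ → ℕ) :
    Set (Set Cell × HVTab × MixedTableau) :=
  {p | IsPartitionShape p.1 ∧ lam ⊆ p.1 ∧ IsSSYT p.2.1 ∧ hshape p.2.1 = p.1 ∧
    IsEXQ lam p.1 p.2.2 ∧ (∀ v : ℕ, entryCount p.2.1 v = xv v) ∧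
    (∀ k : ℤ, mcount p.2.2 (MEntry.al k) = a k) ∧
    (∀ k : ℤ, mcount p.2.2 (MEntry.be k) = b k)}

/-- Triples `(mu, P, Q)` with `mu ⊇ lam` a partition, `P ∈ SSYT(mu)`,
`Q ∈ BFT(mu/lam)` and `wt(P)·wt(Q)` the given monomial. -/
def GrothBFT (lam : Set Cell) (a b : ℤ → ℕ) (xv : ℕ → ℕ) :
    Set (Set Cell × HVTab × MixedTableau) :=
  {p | IsPartitionShape p.1 ∧ lam ⊆ p.1 ∧ IsSSYT p.2.1 ∧ hshape p.2.1 = p.1 ∧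
    IsBFT lam p.1 p.2.2 ∧ (∀ v : ℕ, entryCount p.2.1 v = xv v) ∧
    (∀ k : ℤ, mcount p.2.2 (MEntry.al k) = a k) ∧
    (∀ k : ℤ, mcount p.2.2 (MEntry.be k) = b k)}

namespace Groth

/-! ### Switching on mixed tableaux -/

/-- `α`-column-strict and `β`-row-strict, in coordinates. -/
structure Valid (T : MixedTableau) : Prop where
  al : ∀ {i j i' j' : ℕ} {r q : ℤ}, T (i, j) = some (.al r) → T (i', j') = some (.al q) →
    i ≤ i' → j ≤ j' → q ≤ r ∧ (j = j' → i < i' → q < r)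
  be : ∀ {i j i' j' : ℕ} {r q : ℤ}, T (i, j) = some (.be r) → T (i', j') = some (.be q) →
    i ≤ i' → j ≤ j' → q ≤ r ∧ (i = i' → j < j' → q < r)

theorem valid_of_strict {T : MixedTableau} (ha : AlphaColumnStrict T) (hb : BetaRowStrict T) :
    Valid T := by
  constructor
  · intro i j i' j' r q h h' hi hj
    have h1 : q ≤ r := ha.1 _ _ _ _ h h' trivial trivial hi hj
    refine ⟨h1, fun hjj hii => lt_of_le_of_ne h1 ?_⟩
    have h2 : r ≠ q := ha.2 _ _ _ _ h h' trivial trivial hjj (fun he => by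
      rw [Prod.mk.injEq] at he; omega)
    exact h2.symm
  · intro i j i' j' r q h h' hi hj
    have h1 : q ≤ r := hb.1 _ _ _ _ h h' trivial trivial hi hj
    refine ⟨h1, fun hii hjj => lt_of_le_of_ne h1 ?_⟩
    have h2 : r ≠ q := hb.2 _ _ _ _ h h' trivial trivial hii (fun he => by
      rw [Prod.mk.injEq] at he; omega)
    exact h2.symm

theorem Valid.alphaColumnStrict {T : MixedTableau} (h : Valid T) : AlphaColumnStrict T := by
  constructor
  · rintro ⟨i, j⟩ ⟨i', j'⟩ (r | r) (q | q) h1 h2 p1 p2 hi hj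
    · exact (h.al h1 h2 hi hj).1
    all_goals first | exact p1.elim | exact p2.elim
  · rintro ⟨i, j⟩ ⟨i', j'⟩ (r | r) (q | q) h1 h2 p1 p2 hj hne
    · dsimp only at hj
      subst hj
      have hii : i ≠ i' := fun h => hne (by rw [h])
      rcases lt_or_gt_of_ne hii with hlt | hlt
      · exact ((h.al h1 h2 hlt.le le_rfl).2 rfl hlt).ne'
      · exact ((h.al h2 h1 hlt.le le_rfl).2 rfl hlt).ne
    all_goals first | exact p1.elim | exact p2.elim

theorem Valid.betaRowStrict {T : MixedTableau} (h : Valid T) : BetaRowStrict T := by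
  constructor
  · rintro ⟨i, j⟩ ⟨i', j'⟩ (r | r) (q | q) h1 h2 p1 p2 hi hj
    on_goal 4 => exact (h.be h1 h2 hi hj).1
    all_goals first | exact p1.elim | exact p2.elim
  · rintro ⟨i, j⟩ ⟨i', j'⟩ (r | r) (q | q) h1 h2 p1 p2 hj hne
    on_goal 4 =>
      dsimp only at hj
      subst hj
      have hii : j ≠ j' := fun h => hne (by rw [h])
      rcases lt_or_gt_of_ne hii with hlt | hlt
      · exact ((h.be h1 h2 le_rfl hlt.le).2 rfl hlt).ne'
      · exact ((h.be h2 h1 le_rfl hlt.le).2 rfl hlt).ne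
    all_goals first | exact p1.elim | exact p2.elim

theorem swapCells_eq (T : MixedTableau) (c c' : Cell) :
    swapCells T c c' = fun x => T (Equiv.swap c c' x) := by
  funext x
  unfold swapCells
  by_cases h' : x = c'
  · subst h'; simp
  · by_cases h : x = c
    · subst h; simp [h']
    · simp [h, h', Equiv.swap_apply_of_ne_of_ne]

theorem swapCells_left (T : MixedTableau) (c c' : Cell) : swapCells T c c' c = T c' := by
  simp [swapCells_eq]

theorem swapCells_right (T : MixedTableau) (c c' : Cell) : swapCells T c c' c' = T c := by
  simp [swapCells_eq]

theorem swapCells_ne (T : MixedTableau) {c c' x : Cell} (h : x ≠ c) (h' : x ≠ c') :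
    swapCells T c c' x = T x := by
  simp [swapCells_eq, Equiv.swap_apply_of_ne_of_ne h h']

theorem swapCells_swapCells (T : MixedTableau) (c c' : Cell) :
    swapCells (swapCells T c c') c c' = T := by
  simp [swapCells_eq]

theorem swapCells_cases {T : MixedTableau} {c c' x : Cell} {o : Option MEntry}
    (h : swapCells T c c' x = o) :
    (x = c ∧ T c' = o) ∨ (x = c' ∧ T c = o) ∨ (x ≠ c ∧ x ≠ c' ∧ T x = o) := by
  by_cases h1 : x = c
  · subst h1; left; rw [swapCells_left] at h; exact ⟨rfl, h⟩
  · by_cases h2 : x = c'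
    · subst h2; right; left; rw [swapCells_right] at h; exact ⟨rfl, h⟩
    · right; right; rw [swapCells_ne _ h1 h2] at h; exact ⟨h1, h2, h⟩

/-- The (adjacent, upwards or rightwards) pairs of cells `(i, j)`, `(i', j')`. -/
def Adj (i j i' j' : ℕ) : Prop := (i' = i ∧ j' = j + 1) ∨ (i' = i + 1 ∧ j' = j)

/-- The condition for switching `α_r` at `(i, j)` with `β_s` at `(i', j')`: no condition when `b`
holds, being out of order otherwise. -/
def Cond (b : Prop) (i j i' j' : ℕ) (r s : ℤ) : Prop :=
  (i' = i ∧ j' = j + 1 ∧ (b ∨ r ≤ s + j - i)) ∨ (i' = i + 1 ∧ j' = j ∧ (b ∨ r < s + j - i))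

theorem Cond.adj {b : Prop} {i j i' j' : ℕ} {r s : ℤ} (h : Cond b i j i' j' r s) :
    Adj i j i' j' := by
  rcases h with ⟨h1, h2, -⟩ | ⟨h1, h2, -⟩
  · exact Or.inl ⟨h1, h2⟩
  · exact Or.inr ⟨h1, h2⟩

theorem Adj.cond {b : Prop} (hb : b) {i j i' j' : ℕ} {r s : ℤ} (h : Adj i j i' j') :
    Cond b i j i' j' r s := by
  rcases h with ⟨h1, h2⟩ | ⟨h1, h2⟩
  · exact Or.inl ⟨h1, h2, Or.inl hb⟩
  · exact Or.inr ⟨h1, h2, Or.inl hb⟩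

/-- A valid switch at given cells. -/
structure SwAt (z : Prop) (T : MixedTableau) (i j i' j' : ℕ) (r s : ℤ) (T' : MixedTableau) :
    Prop where
  v : Valid T
  v' : Valid T'
  a : T (i, j) = some (.al r)
  b : T (i', j') = some (.be s)
  cond : Cond z i j i' j' r s
  eq : T' = swapCells T (i, j) (i', j')

def Sw (b : Prop) (T T' : MixedTableau) : Prop := ∃ i j i' j' r s, SwAt b T i j i' j' r s T'

theorem pair_al {i j i' j' k l k' l' : ℕ} {r p : ℤ} (hc : Adj i j i' j') (hd : Adj k l k' l')
    (n1 : (i, j) ≠ (k, l)) (n3 : (i', j') ≠ (k, l))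
    (A : i ≤ k → j ≤ l → p ≤ r ∧ (j = l → i < k → p < r))
    (B : i' ≤ k → j' ≤ l → p ≤ r ∧ (j' = l → i' < k → p < r))
    (C : i ≤ k' → j ≤ l' → p ≤ r ∧ (j = l' → i < k' → p < r)) :
    i' ≤ k' → j' ≤ l' → p ≤ r ∧ (j' = l' → i' < k' → p < r) := by
  intro h1 h2
  simp only [ne_eq, Prod.mk.injEq, not_and] at n1 n3
  have hC := C (by unfold Adj at hc; omega) (by unfold Adj at hc; omega)
  refine ⟨hC.1, fun h3 h4 => ?_⟩
  rcases hc with ⟨rfl, rfl⟩ | ⟨rfl, rfl⟩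
  · rcases hd with ⟨rfl, rfl⟩ | ⟨rfl, rfl⟩
    · exact (A (by omega) (by omega)).2 (by omega) (by omega)
    · exact (B (by omega) (by omega)).2 (by omega) (by omega)
  · exact hC.2 (by omega) (by omega)

theorem pair_be {i j i' j' k l k' l' : ℕ} {s q : ℤ} (hc : Adj i j i' j') (hd : Adj k l k' l')
    (n3 : (i', j') ≠ (k, l))
    (A : i' ≤ k' → j' ≤ l' → q ≤ s ∧ (i' = k' → j' < l' → q < s))
    (B : i ≤ k' → j ≤ l' → q ≤ s ∧ (i = k' → j < l' → q < s))
    (C : i' ≤ k → j' ≤ l → q ≤ s ∧ (i' = k → j' < l → q < s)) :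
    i ≤ k → j ≤ l → q ≤ s ∧ (i = k → j < l → q < s) := by
  intro h1 h2
  simp only [ne_eq, Prod.mk.injEq, not_and] at n3
  have hB := B (by unfold Adj at hd; omega) (by unfold Adj at hd; omega)
  refine ⟨hB.1, fun h3 h4 => ?_⟩
  rcases hd with ⟨rfl, rfl⟩ | ⟨rfl, rfl⟩
  · exact hB.2 (by omega) (by omega)
  · rcases hc with ⟨rfl, rfl⟩ | ⟨rfl, rfl⟩
    · exact (C (by omega) (by omega)).2 (by omega) (by omega)
    · exact (A (by omega) (by omega)).2 (by omega) (by omega)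

/-- After a pair of disjoint moves in the same direction all pairs of entries remain valid if
they are so after each of the moves. -/
theorem valid_swap_swap {T : MixedTableau} {i j i' j' k l k' l' : ℕ}
    (h0 : Valid T) (h1 : Valid (swapCells T (i, j) (i', j')))
    (h2 : Valid (swapCells T (k, l) (k', l')))
    (hc : Adj i j i' j') (hd : Adj k l k' l')
    (n1 : (i, j) ≠ (k, l)) (n2 : (i, j) ≠ (k', l')) (n3 : (i', j') ≠ (k, l))
    (n4 : (i', j') ≠ (k', l'))
    {r s p q : ℤ} (hr : T (i, j) = some (.al r)) (hs : T (i', j') = some (.be s))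
    (hp : T (k, l) = some (.al p)) (hq : T (k', l') = some (.be q)) :
    Valid (swapCells (swapCells T (i, j) (i', j')) (k, l) (k', l')) := by
  have lookup : ∀ x o, swapCells (swapCells T (i, j) (i', j')) (k, l) (k', l') x = o →
      (x = (i, j) ∧ T (i', j') = o) ∨ (x = (i', j') ∧ T (i, j) = o) ∨
      (x = (k, l) ∧ T (k', l') = o) ∨ (x = (k', l') ∧ T (k, l) = o) ∨
      (T x = o ∧ swapCells T (i, j) (i', j') x = o ∧ swapCells T (k, l) (k', l') x = o) := by
    intro x o h
    rcases swapCells_cases h with ⟨rfl, g⟩ | ⟨rfl, g⟩ | ⟨e1, e2, g⟩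
    · rw [swapCells_ne _ n2.symm n4.symm] at g; simp [g]
    · rw [swapCells_ne _ n1.symm n3.symm] at g; simp [g]
    · rcases swapCells_cases g with ⟨rfl, g'⟩ | ⟨rfl, g'⟩ | ⟨e3, e4, g'⟩
      · simp [g']
      · simp [g']
      · right; right; right; right
        exact ⟨g', g, by rw [swapCells_ne _ e1 e2, g']⟩
  have s1 : swapCells T (i, j) (i', j') (i, j) = T (i', j') := swapCells_left ..
  have s2 : swapCells T (i, j) (i', j') (i', j') = T (i, j) := swapCells_right ..
  have s3 : swapCells T (i, j) (i', j') (k, l) = T (k, l) := swapCells_ne _ n1.symm n3.symm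
  have s4 : swapCells T (i, j) (i', j') (k', l') = T (k', l') := swapCells_ne _ n2.symm n4.symm
  have t1 : swapCells T (k, l) (k', l') (k, l) = T (k', l') := swapCells_left ..
  have t2 : swapCells T (k, l) (k', l') (k', l') = T (k, l) := swapCells_right ..
  have t3 : swapCells T (k, l) (k', l') (i, j) = T (i, j) := swapCells_ne _ n1 n2
  have t4 : swapCells T (k, l) (k', l') (i', j') = T (i', j') := swapCells_ne _ n3 n4
  rw [hs] at s1 t4
  rw [hr] at s2 t3
  rw [hp] at s3 t2
  rw [hq] at s4 t1
  constructor
  · intro a b a' b' x y hx hy ha hb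
    rcases lookup _ _ hx with ⟨e, gx⟩ | ⟨e, gx⟩ | ⟨e, gx⟩ | ⟨e, gx⟩ | ⟨gx, gx', gx''⟩ <;>
    rcases lookup _ _ hy with ⟨f, gy⟩ | ⟨f, gy⟩ | ⟨f, gy⟩ | ⟨f, gy⟩ | ⟨gy, gy', gy''⟩ <;>
    (try simp only [hr, hs, hp, hq, Option.some.injEq, reduceCtorEq, MEntry.al.injEq]
      at gx gy) <;>
    (try simp only [Prod.mk.injEq] at e) <;> (try simp only [Prod.mk.injEq] at f) <;>
    first
    | omega
    | (obtain ⟨rfl, rfl⟩ := e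
       obtain ⟨rfl, rfl⟩ := f
       subst gx gy
       first
       | exact pair_al hc hd n1 n3 (h0.al hr hp) (h1.al s2 s3) (h2.al t3 t2) ha hb
       | exact pair_al hd hc n1.symm n2.symm (h0.al hp hr) (h2.al t2 t3) (h1.al s3 s2) ha hb)
    | (obtain ⟨rfl, rfl⟩ := e
       subst gx
       first | exact h1.al s2 gy' ha hb | exact h2.al t2 gy'' ha hb)
    | (obtain ⟨rfl, rfl⟩ := f
       subst gy
       first | exact h1.al gx' s2 ha hb | exact h2.al gx'' t2 ha hb)
    | exact h0.al gx gy ha hb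
  · intro a b a' b' x y hx hy ha hb
    rcases lookup _ _ hx with ⟨e, gx⟩ | ⟨e, gx⟩ | ⟨e, gx⟩ | ⟨e, gx⟩ | ⟨gx, gx', gx''⟩ <;>
    rcases lookup _ _ hy with ⟨f, gy⟩ | ⟨f, gy⟩ | ⟨f, gy⟩ | ⟨f, gy⟩ | ⟨gy, gy', gy''⟩ <;>
    (try simp only [hr, hs, hp, hq, Option.some.injEq, reduceCtorEq, MEntry.be.injEq]
      at gx gy) <;>
    (try simp only [Prod.mk.injEq] at e) <;> (try simp only [Prod.mk.injEq] at f) <;>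
    first
    | omega
    | (obtain ⟨rfl, rfl⟩ := e
       obtain ⟨rfl, rfl⟩ := f
       subst gx gy
       first
       | exact pair_be hc hd n3 (h0.be hs hq) (h1.be s1 s4) (h2.be t4 t1) ha hb
       | exact pair_be hd hc n2.symm (h0.be hq hs) (h2.be t1 t4) (h1.be s4 s1) ha hb)
    | (obtain ⟨rfl, rfl⟩ := e
       subst gx
       first | exact h1.be s1 gy' ha hb | exact h2.be t1 gy'' ha hb)
    | (obtain ⟨rfl, rfl⟩ := f
       subst gy
       first | exact h1.be gx' s1 ha hb | exact h2.be gx'' t1 ha hb)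
    | exact h0.be gx gy ha hb

theorem SwAt.fwd_eq {z : Prop} {T T₁ T₂ : MixedTableau} {i j i' j' k l k' l' : ℕ} {r s p q : ℤ}
    (h1 : SwAt z T i j i' j' r s T₁) (h2 : SwAt z T k l k' l' p q T₂) :
    T₁ = T₂ ∨ ((i, j) ≠ (k, l) ∧ (i, j) ≠ (k', l') ∧ (i', j') ≠ (k, l) ∧ (i', j') ≠ (k', l')) := by
  obtain ⟨v, v1, a, b, c, e⟩ := h1
  obtain ⟨-, v2, a', b', c', e'⟩ := h2
  have ne1 : (i, j) ≠ (k', l') := fun h => by rw [h, b'] at a; cases a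
  have ne2 : (i', j') ≠ (k, l) := fun h => by rw [h, a'] at b; cases b
  have x1 : T₁ (i, j) = some (.be s) := by rw [e, swapCells_left, b]
  have x2 : T₁ (i', j') = some (.al r) := by rw [e, swapCells_right, a]
  have y1 : T₂ (k, l) = some (.be q) := by rw [e', swapCells_left, b']
  have y2 : T₂ (k', l') = some (.al p) := by rw [e', swapCells_right, a']
  by_cases h : (i, j) = (k, l)
  · by_cases h' : (i', j') = (k', l')
    · left; rw [e, e', h, h']
    · exfalso
      have x3 : T₁ (k', l') = some (.be q) := by rw [e, swapCells_ne _ ne1.symm (Ne.symm h'), b']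
      have y3 : T₂ (i', j') = some (.be s) := by rw [e', swapCells_ne _ ne2 h', b]
      have A := c.adj
      have A' := c'.adj
      unfold Adj at A A'
      simp only [Prod.mk.injEq] at h h'
      have := v1.be x1 x3
      have := v2.be y1 y3
      omega
  · by_cases h' : (i', j') = (k', l')
    · exfalso
      have x3 : T₁ (k, l) = some (.al p) := by rw [e, swapCells_ne _ (Ne.symm h) ne2.symm, a']
      have y3 : T₂ (i, j) = some (.al r) := by rw [e', swapCells_ne _ h ne1, a]
      have A := c.adj
      have A' := c'.adj
      unfold Adj at A A'
      simp only [Prod.mk.injEq] at h h'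
      have := v1.al x3 x2
      have := v2.al y3 y2
      omega
    · exact Or.inr ⟨h, ne1, ne2, h'⟩

theorem Sw.diamond {z : Prop} {T T₁ T₂ : MixedTableau} (h1 : Sw z T T₁) (h2 : Sw z T T₂) :
    T₁ = T₂ ∨ ∃ T₃, Sw z T₁ T₃ ∧ Sw z T₂ T₃ := by
  obtain ⟨i, j, i', j', r, s, h1⟩ := h1
  obtain ⟨k, l, k', l', p, q, h2⟩ := h2
  rcases h1.fwd_eq h2 with h | ⟨n1, n2, n3, n4⟩
  · exact Or.inl h
  right
  obtain ⟨v, v1, a, b, c, rfl⟩ := h1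
  obtain ⟨-, v2, a', b', c', rfl⟩ := h2
  have v3 := valid_swap_swap v v1 v2 c.adj c'.adj n1 n2 n3 n4 a b a' b'
  have hcomm : swapCells (swapCells T (i, j) (i', j')) (k, l) (k', l') =
      swapCells (swapCells T (k, l) (k', l')) (i, j) (i', j') := by
    funext x
    by_cases x1 : x = (i, j)
    · subst x1
      rw [swapCells_ne _ n1 n2, swapCells_left, swapCells_left, swapCells_ne _ n3 n4]
    by_cases x2 : x = (i', j')
    · subst x2
      rw [swapCells_ne _ n3 n4, swapCells_right, swapCells_right, swapCells_ne _ n1 n2]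
    by_cases x3 : x = (k, l)
    · subst x3
      rw [swapCells_left, swapCells_ne _ n2.symm n4.symm, swapCells_ne _ x1 x2, swapCells_left]
    by_cases x4 : x = (k', l')
    · subst x4
      rw [swapCells_right, swapCells_ne _ n1.symm n3.symm, swapCells_ne _ x1 x2, swapCells_right]
    rw [swapCells_ne _ x3 x4, swapCells_ne _ x1 x2, swapCells_ne _ x1 x2, swapCells_ne _ x3 x4]
  refine ⟨_, ⟨k, l, k', l', p, q, v1, v3, ?_, ?_, c', rfl⟩,
    ⟨i, j, i', j', r, s, v2, v3, ?_, ?_, c, hcomm⟩⟩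
  · rw [swapCells_ne _ n1.symm n3.symm, a']
  · rw [swapCells_ne _ n2.symm n4.symm, b']
  · rw [swapCells_ne _ n1 n2, a]
  · rw [swapCells_ne _ n3 n4, b]

theorem Sw.confluent {z : Prop} {T T₁ T₂ : MixedTableau} (h1 : Relation.ReflTransGen (Sw z) T T₁)
    (h2 : Relation.ReflTransGen (Sw z) T T₂) :
    ∃ T₃, Relation.ReflTransGen (Sw z) T₁ T₃ ∧ Relation.ReflTransGen (Sw z) T₂ T₃ := by
  refine Relation.church_rosser (fun a b c hb hc => ?_) h1 h2
  rcases hb.diamond hc with rfl | ⟨d, hd, hd'⟩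
  · exact ⟨b, .refl, .refl⟩
  · exact ⟨d, .single hd, .single hd'⟩

/-- A normal form reached from `T` is reached from everything reachable from `T`. -/
theorem Sw.reach_normal {z : Prop} {T T₁ R : MixedTableau}
    (h1 : Relation.ReflTransGen (Sw z) T T₁) (h2 : Relation.ReflTransGen (Sw z) T R)
    (hR : ∀ R', ¬ Sw z R R') : Relation.ReflTransGen (Sw z) T₁ R := by
  obtain ⟨T₃, h3, h4⟩ := Sw.confluent h1 h2
  rcases Relation.ReflTransGen.cases_head h4 with rfl | ⟨c, hc, -⟩
  · exact h3
  · exact (hR _ hc).elim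

theorem Sw.normal_unique {z : Prop} {T R R' : MixedTableau}
    (h1 : Relation.ReflTransGen (Sw z) T R) (h2 : Relation.ReflTransGen (Sw z) T R')
    (hR : ∀ S, ¬ Sw z R S) (hR' : ∀ S, ¬ Sw z R' S) : R = R' := by
  have h := Sw.reach_normal h1 h2 hR'
  rcases Relation.ReflTransGen.cases_head h with rfl | ⟨c, hc, -⟩
  · rfl
  · exact (hR _ hc).elim

theorem Sw.mono {z z' : Prop} (hz : z → z') {T T' : MixedTableau} (h : Sw z T T') : Sw z' T T' := by
  obtain ⟨i, j, i', j', r, s, v, v1, a, b, c, e⟩ := h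
  refine ⟨i, j, i', j', r, s, v, v1, a, b, ?_, e⟩
  unfold Cond at c ⊢
  tauto

end Groth

namespace Groth

/-- The filled cells are convex for the componentwise order. -/
def Convex (T : MixedTableau) : Prop :=
  ∀ {i j i' j' a b : ℕ}, T (i, j) ≠ none → T (i', j') ≠ none → i ≤ a → a ≤ i' → j ≤ b → b ≤ j' →
    T (a, b) ≠ none

/-- Consecutive equal `α`-entries lying strictly northeast of each other are separated by a fence
which the lower one cannot cross. -/
def FenceA (T : MixedTableau) : Prop :=
  ∀ {i j i' j' : ℕ} {r : ℤ}, T (i, j) = some (.al r) → T (i', j') = some (.al r) →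
    i < i' → j < j' → (∀ a b, T (a, b) = some (.al r) → ¬ (j < b ∧ b < j')) →
    ∃ f : ℕ → ℕ, (∀ a, i ≤ a → a < i' → j < f a ∧ f a ≤ j' ∧
        ∃ s t, T (a, f a) = some (.be s) ∧ T (a + 1, f a - 1) = some (.be t) ∧ s < t) ∧
      (∀ a a', i ≤ a → a ≤ a' → a' < i' → f a ≤ f a')

/-- Consecutive equal `β`-entries lying strictly northeast of each other are separated by a fence
which the upper one cannot cross. -/
def FenceB (T : MixedTableau) : Prop :=
  ∀ {i j i' j' : ℕ} {t : ℤ}, T (i, j) = some (.be t) → T (i', j') = some (.be t) →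
    i < i' → j < j' → (∀ a b, T (a, b) = some (.be t) → ¬ (i < a ∧ a < i')) →
    ∃ g : ℕ → ℕ, (∀ b, j < b → b ≤ j' → i ≤ g b ∧ g b < i' ∧
        ∃ r q, T (g b, b) = some (.al r) ∧ T (g b + 1, b - 1) = some (.al q) ∧ q < r) ∧
      (∀ b b', j < b → b ≤ b' → b' ≤ j' → g b ≤ g b')

theorem Valid.al_col {T : MixedTableau} (h : Valid T) {i i' j : ℕ} {r : ℤ}
    (h1 : T (i, j) = some (.al r)) (h2 : T (i', j) = some (.al r)) : i = i' := by
  rcases lt_trichotomy i i' with hl | hl | hl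
  · exact absurd ((h.al h1 h2 hl.le le_rfl).2 rfl hl) (lt_irrefl _)
  · exact hl
  · exact absurd ((h.al h2 h1 hl.le le_rfl).2 rfl hl) (lt_irrefl _)

theorem Valid.be_row {T : MixedTableau} (h : Valid T) {i j j' : ℕ} {r : ℤ}
    (h1 : T (i, j) = some (.be r)) (h2 : T (i, j') = some (.be r)) : j = j' := by
  rcases lt_trichotomy j j' with hl | hl | hl
  · exact absurd ((h.be h1 h2 le_rfl hl.le).2 rfl hl) (lt_irrefl _)
  · exact hl
  · exact absurd ((h.be h2 h1 le_rfl hl.le).2 rfl hl) (lt_irrefl _)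

section
variable {z : Prop} {T T' : MixedTableau} {k l k' l' : ℕ} {x y : ℤ}

theorem SwAt.left (h : SwAt z T k l k' l' x y T') : T' (k, l) = some (.be y) := by
  rw [h.eq, swapCells_left, h.b]

theorem SwAt.right (h : SwAt z T k l k' l' x y T') : T' (k', l') = some (.al x) := by
  rw [h.eq, swapCells_right, h.a]

theorem SwAt.other (h : SwAt z T k l k' l' x y T') {c : Cell} (h1 : c ≠ (k, l))
    (h2 : c ≠ (k', l')) : T' c = T c := by
  rw [h.eq, swapCells_ne _ h1 h2]

theorem SwAt.ne_none (h : SwAt z T k l k' l' x y T') (c : Cell) : T' c ≠ none ↔ T c ≠ none := by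
  by_cases h1 : c = (k, l)
  · subst h1; simp [h.left, h.a]
  by_cases h2 : c = (k', l')
  · subst h2; simp [h.right, h.b]
  rw [h.other h1 h2]

theorem SwAt.convex (h : SwAt z T k l k' l' x y T') (hc : Convex T) : Convex T' := by
  intro i j i' j' a b h1 h2
  rw [h.ne_none] at h1 h2 ⊢
  exact hc h1 h2

/-- A `β`-cell other than the switched one is unchanged. -/
theorem SwAt.be_other (h : SwAt z T k l k' l' x y T') {a b : ℕ} {s : ℤ}
    (h1 : T (a, b) = some (.be s)) (h2 : (a, b) ≠ (k', l')) : T' (a, b) = some (.be s) := by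
  rw [h.other (fun e => ?_) h2, h1]
  rw [e, h.a] at h1; cases h1

theorem SwAt.al_other (h : SwAt z T k l k' l' x y T') {a b : ℕ} {s : ℤ}
    (h1 : T (a, b) = some (.al s)) (h2 : (a, b) ≠ (k, l)) : T' (a, b) = some (.al s) := by
  rw [h.other h2 (fun e => ?_), h1]
  rw [e, h.b] at h1; cases h1

theorem SwAt.al_back (h : SwAt z T k l k' l' x y T') {a b : ℕ} {s : ℤ}
    (h1 : T' (a, b) = some (.al s)) (h2 : (a, b) ≠ (k', l')) : T (a, b) = some (.al s) := by
  rw [← h1, h.other (fun e => ?_) h2]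
  rw [e, h.left] at h1; cases h1

theorem SwAt.be_back (h : SwAt z T k l k' l' x y T') {a b : ℕ} {s : ℤ}
    (h1 : T' (a, b) = some (.be s)) (h2 : (a, b) ≠ (k, l)) : T (a, b) = some (.be s) := by
  rw [← h1, h.other h2 (fun e => ?_)]
  rw [e, h.right] at h1; cases h1

theorem ne_cell {a b c d : ℕ} (h : a ≠ c ∨ b ≠ d) : ((a, b) : Cell) ≠ (c, d) := by
  intro e; rw [Prod.mk.injEq] at e; omega

theorem SwAt.fenceA (h : SwAt z T k l k' l' x y T') (hc : Convex T) (hf : FenceA T) :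
    FenceA T' := by
  intro i j i' j' r hi hi' hlt hlt' hcon
  by_cases e1 : (i, j) = (k', l')
  · rw [Prod.mk.injEq] at e1
    obtain ⟨rfl, rfl⟩ := e1
    have hxr : x = r := by have := h.right; rw [hi] at this; simpa using this.symm
    subst hxr
    have hd := h.al_back hi' (ne_cell (by omega))
    have A := h.cond.adj
    have hcon' : ∀ a b, T (a, b) = some (.al x) → ¬ (l < b ∧ b < j') := by
      rintro a b hab ⟨h1, h2⟩
      have h3 := h.al_other hab (ne_cell (by omega))
      have h4 := hcon a b h3
      have h5 : b = j := by unfold Adj at A; omega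
      subst h5
      have h6 := h.v'.al_col h3 hi
      subst h6
      rw [h.b] at hab; cases hab
    rcases A with ⟨rfl, rfl⟩ | ⟨rfl, rfl⟩
    · obtain ⟨f, hf1, hf2⟩ := hf h.a hd hlt (by omega) hcon'
      have hk : l + 1 < f i := by
        obtain ⟨h1, h2, s, t, hs, ht, hst⟩ := hf1 i le_rfl hlt
        by_contra hcontra
        have h3 : f i = l + 1 := by omega
        rw [h3] at hs ht
        simp only [Nat.add_sub_cancel] at ht
        rw [h.b] at hs
        have ht' := h.be_other ht (ne_cell (by omega))
        have := (h.v'.be h.left ht' (by omega) le_rfl).1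
        simp only [Option.some.injEq, MEntry.be.injEq] at hs
        omega
      refine ⟨f, fun a ha ha' => ?_, hf2⟩
      obtain ⟨h1, h2, s, t, hs, ht, hst⟩ := hf1 a ha ha'
      have := hf2 i a le_rfl ha ha'
      exact ⟨by omega, h2, s, t, h.be_other hs (ne_cell (by omega)),
        h.be_other ht (ne_cell (by omega)), hst⟩
    · obtain ⟨f, hf1, hf2⟩ := hf h.a hd (by omega) hlt' hcon'
      refine ⟨f, fun a ha ha' => ?_, fun a a' ha => hf2 a a' (by omega)⟩
      obtain ⟨h1, h2, s, t, hs, ht, hst⟩ := hf1 a (by omega) ha'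
      exact ⟨h1, h2, s, t, h.be_other hs (ne_cell (by omega)),
        h.be_other ht (ne_cell (by omega)), hst⟩
  by_cases e2 : (i', j') = (k', l')
  · rw [Prod.mk.injEq] at e2
    obtain ⟨rfl, rfl⟩ := e2
    have hxr : x = r := by have := h.right; rw [hi'] at this; simpa using this.symm
    subst hxr
    have hC := h.al_back hi e1
    have A := h.cond.adj
    have hcon' : ∀ a b, T (a, b) = some (.al x) → ¬ (j < b ∧ b < l) := by
      rintro a b hab ⟨h1, h2⟩
      have h3 := h.al_other hab (ne_cell (by omega))
      have h4 := hcon a b h3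
      unfold Adj at A; omega
    rcases A with ⟨rfl, rfl⟩ | ⟨rfl, rfl⟩
    · have hjl : j < l := by
        by_contra hcontra
        have : j = l := by omega
        subst this
        have := h.v.al_col hC h.a
        omega
      obtain ⟨f, hf1, hf2⟩ := hf hC h.a hlt hjl hcon'
      refine ⟨f, fun a ha ha' => ?_, hf2⟩
      obtain ⟨h1, h2, s, t, hs, ht, hst⟩ := hf1 a ha ha'
      exact ⟨h1, by omega, s, t, h.be_other hs (ne_cell (by omega)),
        h.be_other ht (ne_cell (by omega)), hst⟩
    · have hf0 : ∃ f : ℕ → ℕ, (∀ a, i ≤ a → a < k → j < f a ∧ f a ≤ j' ∧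
          ∃ s t, T (a, f a) = some (.be s) ∧ T (a + 1, f a - 1) = some (.be t) ∧ s < t) ∧
          (∀ a a', i ≤ a → a ≤ a' → a' < k → f a ≤ f a') := by
        rcases Nat.lt_or_ge i k with hik | hik
        · exact hf hC h.a hik hlt' hcon'
        · exact ⟨fun _ => 0, fun a _ _ => by omega, fun a a' _ _ _ => by omega⟩
      obtain ⟨f, hf1, hf2⟩ := hf0
      refine ⟨fun a => if a = k then j' else f a, fun a ha ha' => ?_, fun a a' ha haa ha' => ?_⟩
      · by_cases hak : a = k
        · subst hak
          simp only [if_true]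
          have hn : T (a + 1, j' - 1) ≠ none :=
            hc (i := i) (j := j) (i' := a + 1) (j' := j') (by simp [hC]) (by simp [h.b])
              (by omega) le_rfl (by omega) (by omega)
          have ho := h.other (c := (a + 1, j' - 1)) (ne_cell (by omega)) (ne_cell (by omega))
          refine ⟨hlt', le_rfl, y, ?_⟩
          rcases hT : T (a + 1, j' - 1) with _ | (q | t)
          · exact absurd hT hn
          · exfalso
            rw [hT] at ho
            have h1 := (h.v'.al ho hi' le_rfl (by omega)).1
            have h2 := (h.v'.al hi ho (by omega) (by omega)).1
            have h3 : q = x := by omega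
            subst h3
            have h4 := hcon _ _ ho
            have h5 : j' - 1 = j := by omega
            rw [h5] at ho
            have := h.v'.al_col hi ho
            omega
          · have := (h.v.be hT h.b le_rfl (by omega)).2 rfl (by omega)
            exact ⟨t, h.left, by rw [ho, hT], this⟩
        · simp only [if_neg hak]
          obtain ⟨h1, h2, s, t, hs, ht, hst⟩ := hf1 a ha (by omega)
          exact ⟨h1, by omega, s, t, h.be_other hs (ne_cell (by omega)),
            h.be_other ht (ne_cell (by omega)), hst⟩
      · dsimp only
        split_ifs with h1 h2 h2
        · exact le_rfl
        · omega
        · exact (hf1 a ha (by omega)).2.1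
        · exact hf2 a a' ha haa (by omega)
  have hC := h.al_back hi e1
  have hD := h.al_back hi' e2
  have A := h.cond.adj
  have hcon' : ∀ a b, T (a, b) = some (.al r) → ¬ (j < b ∧ b < j') := by
    rintro a b hab ⟨h1, h2⟩
    by_cases e : (a, b) = (k, l)
    · rw [Prod.mk.injEq] at e
      obtain ⟨rfl, rfl⟩ := e
      have hxr : x = r := by have := h.a; rw [hab] at this; simpa using this.symm
      subst hxr
      have h3 := hcon _ _ h.right
      have h4 : l' = j' := by unfold Adj at A; omega
      subst h4
      have := h.v'.al_col hi' h.right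
      exact e2 (by rw [this])
    · exact hcon _ _ (h.al_other hab e) ⟨h1, h2⟩
  have key : ¬ (i ≤ k' ∧ k' ≤ i' ∧ j ≤ l' ∧ l' ≤ j') := by
    rintro ⟨h1, h2, h3, h4⟩
    have h5 := (h.v'.al hi h.right h1 h3).1
    have h6 := (h.v'.al h.right hi' h2 h4).1
    have hxr : x = r := by omega
    subst hxr
    have h7 := hcon _ _ h.right
    have h8 : l' = j ∨ l' = j' := by omega
    rcases h8 with rfl | rfl
    · exact e1 (by rw [h.v'.al_col hi h.right])
    · exact e2 (by rw [h.v'.al_col hi' h.right])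
  obtain ⟨f, hf1, hf2⟩ := hf hC hD hlt hlt' hcon'
  refine ⟨f, fun a ha ha' => ?_, hf2⟩
  obtain ⟨h1, h2, s, t, hs, ht, hst⟩ := hf1 a ha ha'
  exact ⟨h1, h2, s, t, h.be_other hs (ne_cell (by omega)),
    h.be_other ht (ne_cell (by omega)), hst⟩

theorem SwAt.fenceB (h : SwAt z T k l k' l' x y T') (hc : Convex T) (hf : FenceB T) :
    FenceB T' := by
  intro i j i' j' t hi hi' hlt hlt' hcon
  by_cases e1 : (i', j') = (k, l)
  · rw [Prod.mk.injEq] at e1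
    obtain ⟨rfl, rfl⟩ := e1
    have hyt : y = t := by have := h.left; rw [hi'] at this; simpa using this.symm
    subst hyt
    have hd := h.be_back hi (ne_cell (by omega))
    have A := h.cond.adj
    have hcon' : ∀ a b, T (a, b) = some (.be y) → ¬ (i < a ∧ a < k') := by
      rintro a b hab ⟨h1, h2⟩
      have h3 := h.be_other hab (ne_cell (by omega))
      have h4 := hcon a b h3
      have h5 : a = i' := by unfold Adj at A; omega
      subst h5
      have h6 := h.v'.be_row h3 hi'
      subst h6
      rw [h.a] at hab; cases hab
    rcases A with ⟨rfl, rfl⟩ | ⟨rfl, rfl⟩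
    · obtain ⟨g, hg1, hg2⟩ := hf hd h.b hlt (by omega) hcon'
      refine ⟨g, fun b hb hb' => ?_, fun b b' h1 h2 h3 => hg2 b b' h1 h2 (by omega)⟩
      obtain ⟨h1, h2, r, q, hr, hq, hrq⟩ := hg1 b hb (by omega)
      exact ⟨h1, h2, r, q, h.al_other hr (ne_cell (by omega)),
        h.al_other hq (ne_cell (by omega)), hrq⟩
    · obtain ⟨g, hg1, hg2⟩ := hf hd h.b (by omega) hlt' hcon'
      have hk : g l' < i' := by
        obtain ⟨h1, h2, r, q, hr, hq, hrq⟩ := hg1 l' hlt' le_rfl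
        by_contra hcontra
        have h3 : g l' = i' := by omega
        rw [h3] at hr hq
        rw [h.a] at hr
        have hq' := h.al_other hq (ne_cell (by omega))
        have := (h.v'.al hq' h.right le_rfl (by omega)).1
        simp only [Option.some.injEq, MEntry.al.injEq] at hr
        omega
      refine ⟨g, fun b hb hb' => ?_, hg2⟩
      obtain ⟨h1, h2, r, q, hr, hq, hrq⟩ := hg1 b hb hb'
      have := hg2 b l' hb hb' le_rfl
      exact ⟨h1, by omega, r, q, h.al_other hr (ne_cell (by omega)),
        h.al_other hq (ne_cell (by omega)), hrq⟩
  by_cases e2 : (i, j) = (k, l)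
  · rw [Prod.mk.injEq] at e2
    obtain ⟨rfl, rfl⟩ := e2
    have hyt : y = t := by have := h.left; rw [hi] at this; simpa using this.symm
    subst hyt
    have hD := h.be_back hi' e1
    have A := h.cond.adj
    have hcon' : ∀ a b, T (a, b) = some (.be y) → ¬ (k' < a ∧ a < i') := by
      rintro a b hab ⟨h1, h2⟩
      have h3 := h.be_other hab (ne_cell (by omega))
      have h4 := hcon a b h3
      unfold Adj at A; omega
    rcases A with ⟨rfl, rfl⟩ | ⟨rfl, rfl⟩
    · have hg0 : ∃ g : ℕ → ℕ, (∀ b, j + 1 < b → b ≤ j' → k' ≤ g b ∧ g b < i' ∧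
          ∃ r q, T (g b, b) = some (.al r) ∧ T (g b + 1, b - 1) = some (.al q) ∧ q < r) ∧
          (∀ b b', j + 1 < b → b ≤ b' → b' ≤ j' → g b ≤ g b') := by
        rcases Nat.lt_or_ge (j + 1) j' with hik | hik
        · exact hf h.b hD hlt hik hcon'
        · exact ⟨fun _ => 0, fun a _ _ => by omega, fun a a' _ _ _ => by omega⟩
      obtain ⟨g, hg1, hg2⟩ := hg0
      refine ⟨fun b => if b = j + 1 then k' else g b, fun b hb hb' => ?_,
        fun b b' hb hbb hb' => ?_⟩
      · by_cases hbj : b = j + 1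
        · subst hbj
          simp only [if_true, Nat.add_sub_cancel]
          have hn : T (k' + 1, j) ≠ none :=
            hc (i := k') (j := j) (i' := i') (j' := j') (by simp [h.a]) (by simp [hD])
              (by omega) (by omega) le_rfl (by omega)
          have ho := h.other (c := (k' + 1, j)) (ne_cell (by omega)) (ne_cell (by omega))
          refine ⟨le_rfl, hlt, x, ?_⟩
          rcases hT : T (k' + 1, j) with _ | (q | q)
          · exact absurd hT hn
          · have := (h.v.al h.a hT (by omega) le_rfl).2 rfl (by omega)
            exact ⟨q, h.right, by rw [ho, hT], this⟩
          · exfalso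
            rw [hT] at ho
            have h1 := (h.v'.be hi ho (by omega) le_rfl).1
            have h2 := (h.v'.be ho hi' (by omega) (by omega)).1
            have h3 : q = y := by omega
            subst h3
            have h4 := hcon _ _ ho
            have h5 : k' + 1 = i' := by omega
            rw [h5] at ho
            have := h.v'.be_row hi' ho
            omega
        · simp only [if_neg hbj]
          obtain ⟨h1, h2, r, q, hr, hq, hrq⟩ := hg1 b (by omega) hb'
          exact ⟨h1, h2, r, q, h.al_other hr (ne_cell (by omega)),
            h.al_other hq (ne_cell (by omega)), hrq⟩
      · dsimp only
        split_ifs with h1 h2 h2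
        · exact le_rfl
        · exact (hg1 b' (by omega) hb').1
        · omega
        · exact hg2 b b' (by omega) hbb hb'
    · have hjl : i + 1 < i' := by
        by_contra hcontra
        have : i + 1 = i' := by omega
        subst this
        have := h.v.be_row h.b hD
        omega
      obtain ⟨g, hg1, hg2⟩ := hf h.b hD hjl hlt' hcon'
      refine ⟨g, fun b hb hb' => ?_, hg2⟩
      obtain ⟨h1, h2, r, q, hr, hq, hrq⟩ := hg1 b hb hb'
      exact ⟨by omega, h2, r, q, h.al_other hr (ne_cell (by omega)),
        h.al_other hq (ne_cell (by omega)), hrq⟩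
  have hC := h.be_back hi e2
  have hD := h.be_back hi' e1
  have A := h.cond.adj
  have hcon' : ∀ a b, T (a, b) = some (.be t) → ¬ (i < a ∧ a < i') := by
    rintro a b hab ⟨h1, h2⟩
    by_cases e : (a, b) = (k', l')
    · rw [Prod.mk.injEq] at e
      obtain ⟨rfl, rfl⟩ := e
      have hyt : y = t := by have := h.b; rw [hab] at this; simpa using this.symm
      subst hyt
      have h3 := hcon _ _ h.left
      have h4 : k = i := by unfold Adj at A; omega
      subst h4
      have := h.v'.be_row hi h.left
      exact e2 (by rw [this])
    · exact hcon _ _ (h.be_other hab e) ⟨h1, h2⟩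
  have key : ¬ (i ≤ k ∧ k ≤ i' ∧ j ≤ l ∧ l ≤ j') := by
    rintro ⟨h1, h2, h3, h4⟩
    have h5 := (h.v'.be hi h.left h1 h3).1
    have h6 := (h.v'.be h.left hi' h2 h4).1
    have hyt : y = t := by omega
    subst hyt
    have h7 := hcon _ _ h.left
    have h8 : k = i ∨ k = i' := by omega
    rcases h8 with rfl | rfl
    · exact e2 (by rw [h.v'.be_row hi h.left])
    · exact e1 (by rw [h.v'.be_row hi' h.left])
  obtain ⟨g, hg1, hg2⟩ := hf hC hD hlt hlt' hcon'
  refine ⟨g, fun b hb hb' => ?_, hg2⟩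
  obtain ⟨h1, h2, r, q, hr, hq, hrq⟩ := hg1 b hb hb'
  exact ⟨h1, h2, r, q, h.al_other hr (ne_cell (by omega)),
    h.al_other hq (ne_cell (by omega)), hrq⟩

end

end Groth

namespace Groth

/-- The invariant of the switching process. -/
structure State (T : MixedTableau) : Prop where
  v : Valid T
  c : Convex T
  fa : FenceA T
  fb : FenceB T

theorem SwAt.state {z : Prop} {T T' : MixedTableau} {k l k' l' : ℕ} {x y : ℤ}
    (h : SwAt z T k l k' l' x y T') (hs : State T) : State T' :=
  ⟨h.v', h.convex hs.c, h.fenceA hs.c hs.fa, h.fenceB hs.c hs.fb⟩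

/-- The entry `α_r` at `(i, j)` can be moved. -/
def Pend (b : Prop) (T : MixedTableau) (i j : ℕ) (r : ℤ) : Prop :=
  T (i, j) = some (.al r) ∧ ∃ i' j' s, T (i', j') = some (.be s) ∧ Cond b i j i' j' r s

theorem Pend.rt {b : Prop} {T : MixedTableau} {i j : ℕ} {r s : ℤ} (h : T (i, j) = some (.al r))
    (h' : T (i, j + 1) = some (.be s)) (hb : b ∨ r ≤ s + j - i) : Pend b T i j r :=
  ⟨h, i, j + 1, s, h', Or.inl ⟨rfl, rfl, hb⟩⟩

theorem Pend.up {b : Prop} {T : MixedTableau} {i j : ℕ} {r s : ℤ} (h : T (i, j) = some (.al r))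
    (h' : T (i + 1, j) = some (.be s)) (hb : b ∨ r < s + j - i) : Pend b T i j r :=
  ⟨h, i + 1, j, s, h', Or.inr ⟨rfl, rfl, hb⟩⟩

/-- The entry `α_r` at `(i, j)` is the rightmost movable one with smallest index. -/
def Chosen (b : Prop) (T : MixedTableau) (i j : ℕ) (r : ℤ) : Prop :=
  T (i, j) = some (.al r) ∧ ∀ a c q, Pend b T a c q → r < q ∨ (r = q ∧ c ≤ j)

theorem last_switch {f : ℕ → Prop} {a e : ℕ} (ha : f a) (he : ¬ f e) (hae : a < e) :
    ∃ m, a ≤ m ∧ m < e ∧ f m ∧ ∀ x, m < x → x ≤ e → ¬ f x := by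
  induction e with
  | zero => omega
  | succ e ih =>
    by_cases h : f e
    · refine ⟨e, by omega, by omega, h, fun x h1 h2 => ?_⟩
      obtain rfl : x = e + 1 := by omega
      exact he
    · have hne : a ≠ e := fun h' => h (h' ▸ ha)
      obtain ⟨m, h1, h2, h3, h4⟩ := ih h (by omega)
      refine ⟨m, h1, by omega, h3, fun x h5 h6 => ?_⟩
      by_cases hx : x = e + 1
      · subst hx; exact he
      · exact h4 x h5 (by omega)

theorem first_switch {f : ℕ → Prop} {a e : ℕ} (ha : f a) (he : ¬ f e) (hae : a < e) :
    ∃ m, a ≤ m ∧ m < e ∧ ¬ f (m + 1) ∧ ∀ x, a ≤ x → x ≤ m → f x := by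
  have hex : ∃ x, a < x ∧ ¬ f x := ⟨e, hae, he⟩
  obtain ⟨h1, h2⟩ := Nat.find_spec hex
  have h3 := Nat.find_le (n := e) (h := hex) ⟨hae, he⟩
  obtain ⟨m, hm⟩ : ∃ m, Nat.find hex = m + 1 := ⟨Nat.find hex - 1, by omega⟩
  rw [hm] at h1 h2 h3
  refine ⟨m, by omega, by omega, h2, fun x h5 h6 => ?_⟩
  by_cases hx : x = a
  · exact hx ▸ ha
  · by_contra hf
    have := Nat.find_min hex (m := x) (by omega)
    exact this ⟨by omega, hf⟩

/-- A filled cell holding no `α` holds a `β`. -/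
theorem be_of_not_al {T : MixedTableau} {c : Cell} (h : T c ≠ none)
    (h' : ¬ ∃ q, T c = some (.al q)) : ∃ s, T c = some (.be s) := by
  rcases hc : T c with _ | (k | k)
  · exact absurd hc h
  · exact absurd ⟨k, hc⟩ h'
  · exact ⟨k, rfl⟩

theorem ne_none_of_eq {T : MixedTableau} {c : Cell} {e : MEntry} (h : T c = some e) :
    T c ≠ none := by rw [h]; simp

theorem not_al_of_be {T : MixedTableau} {c : Cell} {s : ℤ} (h : T c = some (.be s)) :
    ¬ ∃ q, T c = some (.al q) := by
  rintro ⟨q, hq⟩; rw [h] at hq; simp at hq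

/-- A run of `β` entries in a row drops strictly. -/
theorem Valid.be_run {T : MixedTableau} (hv : Valid T) {i m : ℕ} {u t : ℤ} (n : ℕ)
    (hu : T (i, m) = some (.be u)) (ht : T (i, m + n) = some (.be t))
    (hr : ∀ x, m ≤ x → x ≤ m + n → ∃ s, T (i, x) = some (.be s)) : t + n ≤ u := by
  induction n generalizing t with
  | zero =>
    rw [Nat.add_zero, hu] at ht
    simp at ht; simp [ht]
  | succ n ih =>
    obtain ⟨s, hs⟩ := hr (m + n) (by omega) (by omega)
    have h1 := ih hs (fun x h1 h2 => hr x h1 (by omega))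
    have h2 := (hv.be hs ht le_rfl (by omega)).2 rfl (by omega)
    push_cast; omega

/-- A run of `α` entries in a column drops strictly. -/
theorem Valid.al_run {T : MixedTableau} (hv : Valid T) {i j : ℕ} {u t : ℤ} (n : ℕ)
    (hu : T (i, j) = some (.al u)) (ht : T (i + n, j) = some (.al t))
    (hr : ∀ x, i ≤ x → x ≤ i + n → ∃ s, T (x, j) = some (.al s)) : t + n ≤ u := by
  induction n generalizing t with
  | zero =>
    rw [Nat.add_zero, hu] at ht
    simp at ht; simp [ht]
  | succ n ih =>
    obtain ⟨s, hs⟩ := hr (i + n) (by omega) (by omega)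
    have h1 := ih hs (fun x h1 h2 => hr x h1 (by omega))
    have h2 := (hv.al hs ht (by omega) le_rfl).2 rfl (by omega)
    push_cast; omega

section
variable {b : Prop} {T : MixedTableau} {i j : ℕ} {r s t : ℤ}

/-- Validity of a swap in coordinates. -/
theorem valid_swap_of {T : MixedTableau} {c c' d d' : ℕ} {r s : ℤ} (hv : Valid T)
    (ha : T (c, d) = some (.al r)) (hb : T (c', d') = some (.be s))
    (A1 : ∀ x y q, T (x, y) = some (.al q) → c' ≤ x → d' ≤ y →
      q ≤ r ∧ (d' = y → c' < x → q < r))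
    (A2 : ∀ x y q, T (x, y) = some (.al q) → (x, y) ≠ (c, d) → x ≤ c' → y ≤ d' →
      r ≤ q ∧ (y = d' → x < c' → r < q))
    (B1 : ∀ x y q, T (x, y) = some (.be q) → (x, y) ≠ (c', d') → c ≤ x → d ≤ y →
      q ≤ s ∧ (c = x → d < y → q < s))
    (B2 : ∀ x y q, T (x, y) = some (.be q) → x ≤ c → y ≤ d →
      s ≤ q ∧ (x = c → y < d → s < q)) :
    Valid (swapCells T (c, d) (c', d')) := by
  constructor
  · intro x y x' y' p q h h' hx hy
    rcases swapCells_cases h with ⟨-, g⟩ | ⟨e, g⟩ | ⟨n1, n2, g⟩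
    · rw [hb] at g; simp at g
    · rw [Prod.mk.injEq] at e
      obtain ⟨rfl, rfl⟩ := e
      rw [ha] at g
      obtain rfl : r = p := by simpa using g
      rcases swapCells_cases h' with ⟨-, g'⟩ | ⟨e, g'⟩ | ⟨n1, n2, g'⟩
      · rw [hb] at g'; simp at g'
      · rw [Prod.mk.injEq] at e
        obtain ⟨rfl, rfl⟩ := e
        rw [ha] at g'
        obtain rfl : r = q := by simpa using g'
        exact ⟨le_rfl, fun _ h => absurd h (lt_irrefl _)⟩
      · exact A1 _ _ _ g' hx hy
    · rcases swapCells_cases h' with ⟨-, g'⟩ | ⟨e, g'⟩ | ⟨n1', n2', g'⟩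
      · rw [hb] at g'; simp at g'
      · rw [Prod.mk.injEq] at e
        obtain ⟨rfl, rfl⟩ := e
        rw [ha] at g'
        obtain rfl : r = q := by simpa using g'
        exact A2 _ _ _ g n1 hx hy
      · exact hv.al g g' hx hy
  · intro x y x' y' p q h h' hx hy
    rcases swapCells_cases h with ⟨e, g⟩ | ⟨-, g⟩ | ⟨n1, n2, g⟩
    · rw [Prod.mk.injEq] at e
      obtain ⟨rfl, rfl⟩ := e
      rw [hb] at g
      obtain rfl : s = p := by simpa using g
      rcases swapCells_cases h' with ⟨e, g'⟩ | ⟨-, g'⟩ | ⟨n1, n2, g'⟩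
      · rw [Prod.mk.injEq] at e
        obtain ⟨rfl, rfl⟩ := e
        rw [hb] at g'
        obtain rfl : s = q := by simpa using g'
        exact ⟨le_rfl, fun _ h => absurd h (lt_irrefl _)⟩
      · rw [ha] at g'; simp at g'
      · exact B1 _ _ _ g' n2 hx hy
    · rw [ha] at g; simp at g
    · rcases swapCells_cases h' with ⟨e, g'⟩ | ⟨-, g'⟩ | ⟨n1', n2', g'⟩
      · rw [Prod.mk.injEq] at e
        obtain ⟨rfl, rfl⟩ := e
        rw [hb] at g'
        obtain rfl : s = q := by simpa using g'
        exact B2 _ _ _ g hx hy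
      · rw [ha] at g'; simp at g'
      · exact hv.be g g' hx hy

theorem Chosen.valid_rt (hs : State T) (hch : Chosen b T i j r)
    (hβ : T (i, j + 1) = some (.be s)) (hc : b ∨ r ≤ s + j - i)
    (tie : ∀ t, T (i + 1, j) = some (.be t) → (b ∨ r < t + j - i) → t ≤ s) :
    Valid (swapCells T (i, j) (i, j + 1)) := by
  have hv := hs.v
  have hα := hch.1
  have key : ∀ a c q, Pend b T a c q → ¬ (q < r ∨ (q = r ∧ j < c)) := by
    intro a c q h h'
    rcases hch.2 a c q h with h1 | ⟨h1, h2⟩ <;> omega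
  refine valid_swap_of hv hα hβ ?_ ?_ ?_ ?_
  · intro x y q h hx hy
    have h1 := (hv.al hα h hx (by omega)).1
    refine ⟨h1, fun hyj hlt => lt_of_le_of_ne h1 ?_⟩
    rintro rfl
    obtain ⟨f, hf, -⟩ := hs.fa hα h hlt (by omega) (by omega)
    obtain ⟨h2, h3, s', t, h4, h5, h6⟩ := hf i le_rfl hlt
    obtain hfi : f i = j + 1 := by omega
    rw [hfi] at h4 h5
    rw [hβ] at h4
    obtain rfl : s = s' := by simpa using h4
    have h7 := tie t (by simpa using h5) (hc.imp id (fun h => by omega))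
    omega
  · intro x y q h hne hx hy
    by_cases hyj : y ≤ j
    · exact ⟨(hv.al h hα hx hyj).1, fun h' => by omega⟩
    · obtain rfl : y = j + 1 := by omega
      suffices hq : ∀ (_ : x < i), r < q by
        have hxi : x < i := by
          refine lt_of_le_of_ne hx ?_
          rintro rfl
          rw [hβ] at h; simp at h
        exact ⟨(hq hxi).le, fun _ _ => hq hxi⟩
      intro hxi
      by_contra hlt
      obtain ⟨m, h1, h2, ⟨q', h3⟩, h4⟩ := last_switch
        (f := fun x => ∃ q, T (x, j + 1) = some (.al q)) ⟨q, h⟩ (not_al_of_be hβ) hxi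
      obtain ⟨u, hu⟩ := be_of_not_al (hs.c (ne_none_of_eq h3) (ne_none_of_eq hβ) (by omega)
        (by omega : m + 1 ≤ i) le_rfl le_rfl) (h4 (m + 1) (by omega) (by omega))
      have h5 := (hv.al h h3 h1 le_rfl).1
      have h6 := (hv.be hu hβ (by omega) le_rfl).1
      refine key m (j + 1) q' (Pend.up h3 hu (hc.imp id (fun h => by omega))) (by omega)
  · intro x y u h hne hx hy
    by_cases hyj : j + 1 ≤ y
    · have h1 := hv.be hβ h hx hyj
      refine ⟨h1.1, fun hix hjy => h1.2 hix (lt_of_le_of_ne hyj ?_)⟩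
      rintro rfl
      exact hne (by rw [hix])
    · obtain rfl : y = j := by omega
      refine ⟨?_, fun _ h => absurd h (lt_irrefl _)⟩
      by_contra hlt
      have hxi : i < x := by
        refine lt_of_le_of_ne hx ?_
        rintro rfl
        rw [hα] at h; simp at h
      obtain ⟨m, h1, h2, h3, h4⟩ := first_switch
        (f := fun x => ∃ q, T (x, y) = some (.al q)) ⟨r, hα⟩ (not_al_of_be h) hxi
      obtain ⟨t', ht'⟩ := be_of_not_al (hs.c (ne_none_of_eq hα) (ne_none_of_eq h)
        (by omega : i ≤ m + 1) (by omega) le_rfl le_rfl) h3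
      have h5 := (hv.be ht' h (by omega) le_rfl).1
      by_cases hmi : m = i
      · subst hmi
        have := tie _ ht' (hc.imp id (fun h => by omega))
        omega
      · obtain ⟨p, hp⟩ := h4 m h1 le_rfl
        obtain ⟨n, rfl⟩ := Nat.exists_eq_add_of_le h1
        have h6 := hv.al_run n hα hp h4
        exact key _ _ p (Pend.up hp ht' (hc.imp id (fun h => by omega))) (by omega)
  · intro x y u h hx hy
    have h1 := hv.be h hβ hx (by omega)
    exact ⟨h1.1, fun h2 h3 => h1.2 h2 (by omega)⟩

theorem Chosen.valid_up (hs : State T) (hch : Chosen b T i j r)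
    (hβ : T (i + 1, j) = some (.be t)) (hc : b ∨ r < t + j - i)
    (tie : ∀ s, T (i, j + 1) = some (.be s) → (b ∨ r ≤ s + j - i) → s < t) :
    Valid (swapCells T (i, j) (i + 1, j)) := by
  have hv := hs.v
  have hα := hch.1
  have key : ∀ a c q, Pend b T a c q → ¬ (q < r ∨ (q = r ∧ j < c)) := by
    intro a c q h h'
    rcases hch.2 a c q h with h1 | ⟨h1, h2⟩ <;> omega
  refine valid_swap_of hv hα hβ ?_ ?_ ?_ ?_
  · intro x y q h hx hy
    have h1 := hv.al hα h (by omega) hy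
    exact ⟨h1.1, fun h2 h3 => h1.2 h2 (by omega)⟩
  · intro x y q h hne hx hy
    by_cases hxi : x ≤ i
    · have h1 := hv.al h hα hxi hy
      refine ⟨h1.1, fun h2 h3 => h1.2 h2 (lt_of_le_of_ne hxi ?_)⟩
      rintro rfl
      exact hne (by rw [h2])
    · obtain rfl : x = i + 1 := by omega
      refine ⟨?_, fun _ h => absurd h (lt_irrefl _)⟩
      by_contra hlt
      have hyj : y < j := by
        refine lt_of_le_of_ne hy ?_
        rintro rfl
        rw [hβ] at h; simp at h
      obtain ⟨m, h1, h2, ⟨q', h3⟩, h4⟩ := last_switch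
        (f := fun y => ∃ q, T (i + 1, y) = some (.al q)) ⟨q, h⟩ (not_al_of_be hβ) hyj
      have hrun : ∀ x, m + 1 ≤ x → x ≤ j → ∃ s, T (i + 1, x) = some (.be s) := fun x h5 h6 =>
        be_of_not_al (hs.c (ne_none_of_eq h) (ne_none_of_eq hβ) le_rfl le_rfl (by omega) h6)
          (h4 x (by omega) h6)
      obtain ⟨u, hu⟩ := hrun (m + 1) le_rfl (by omega)
      have h5 := (hv.al h h3 le_rfl h1).1
      obtain ⟨n, rfl⟩ := Nat.exists_eq_add_of_le (show m + 1 ≤ j by omega)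
      have h6 := hv.be_run n hu hβ hrun
      refine key _ m q' (Pend.rt h3 hu (hc.imp id (fun h => by push_cast at *; omega))) (by omega)
  · intro x y u h hne hx hy
    by_cases hxi : i + 1 ≤ x
    · exact ⟨(hv.be hβ h hxi hy).1, fun h' => by omega⟩
    · obtain rfl : x = i := by omega
      suffices hq : ∀ (_ : j < y), u < t by
        have hyj : j < y := by
          refine lt_of_le_of_ne hy ?_
          rintro rfl
          rw [hα] at h; simp at h
        exact ⟨(hq hyj).le, fun _ _ => hq hyj⟩
      intro hyj
      by_contra hlt
      obtain ⟨m, h1, h2, h3, h4⟩ := first_switch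
        (f := fun y => ∃ q, T (x, y) = some (.al q)) ⟨r, hα⟩ (not_al_of_be h) hyj
      obtain ⟨u', hu'⟩ := be_of_not_al (hs.c (ne_none_of_eq hα) (ne_none_of_eq h)
        le_rfl le_rfl (by omega : j ≤ m + 1) (by omega)) h3
      have h5 := (hv.be hu' h le_rfl (by omega)).1
      by_cases hmj : m = j
      · subst hmj
        have := tie _ hu' (hc.imp id (fun h => by omega))
        omega
      · obtain ⟨p, hp⟩ := h4 m h1 le_rfl
        have h6 := (hv.al hα hp le_rfl h1).1
        exact key _ _ p (Pend.rt hp hu' (hc.imp id (fun h => by omega))) (by omega)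
  · intro x y u h hx hy
    have h1 := (hv.be h hβ (by omega) hy).1
    refine ⟨h1, fun hxi hlt => lt_of_le_of_ne h1 ?_⟩
    rintro rfl
    subst hxi
    obtain ⟨g, hg, -⟩ := hs.fb h hβ (by omega) hlt (by omega)
    obtain ⟨h2, h3, r', q, h4, h5, h6⟩ := hg j hlt le_rfl
    obtain hgi : g j = x := by omega
    rw [hgi] at h4 h5
    rw [hα] at h4
    obtain rfl : r = r' := by simpa using h4
    obtain ⟨m, rfl⟩ : ∃ m, j = m + 1 := ⟨j - 1, by omega⟩
    exact key _ _ q (Pend.rt h5 hβ (hc.imp id (fun h => by push_cast at *; omega))) (by omega)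

end

end Groth

namespace Groth

section
variable {b : Prop} {T T' : MixedTableau} {i j : ℕ} {r s t : ℤ}

theorem Chosen.step (hs : State T) (hch : Chosen b T i j r) (hp : Pend b T i j r) :
    ∃ T', Sw b T T' := by
  by_cases hr : ∃ s, T (i, j + 1) = some (.be s) ∧ (b ∨ r ≤ s + j - i)
  · obtain ⟨s, h1, h2⟩ := hr
    by_cases hu : ∃ t, T (i + 1, j) = some (.be t) ∧ (b ∨ r < t + j - i) ∧ s < t
    · obtain ⟨t, h3, h4, h5⟩ := hu
      refine ⟨_, i, j, i + 1, j, r, t, hs.v, hch.valid_up hs h3 h4 ?_, hch.1, h3,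
        Or.inr ⟨rfl, rfl, h4⟩, rfl⟩
      intro s' h6 _
      rw [h1] at h6
      obtain rfl : s = s' := by simpa using h6
      exact h5
    · refine ⟨_, i, j, i, j + 1, r, s, hs.v, hch.valid_rt hs h1 h2 ?_, hch.1, h1,
        Or.inl ⟨rfl, rfl, h2⟩, rfl⟩
      intro t h3 h4
      by_contra h5
      exact hu ⟨t, h3, h4, by omega⟩
  · obtain ⟨-, i', j', s, h1, ⟨rfl, rfl, h2⟩ | ⟨rfl, rfl, h2⟩⟩ := hp
    · exact absurd ⟨s, h1, h2⟩ hr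
    · exact ⟨_, i, j', i + 1, j', r, s, hs.v,
        hch.valid_up hs h1 h2 (fun s' h3 h4 => absurd ⟨s', h3, h4⟩ hr), hch.1, h1,
        Or.inr ⟨rfl, rfl, h2⟩, rfl⟩

theorem exists_chosen (hf : (mshape T).Finite) (h : ∃ i j r, Pend b T i j r) :
    ∃ i j r, Pend b T i j r ∧ Chosen b T i j r := by
  have hfin : {c : Cell | ∃ r, Pend b T c.1 c.2 r}.Finite :=
    hf.subset (fun c ⟨r, hr⟩ => ne_none_of_eq hr.1)
  obtain ⟨i, j, r, h⟩ := h
  let idx : Cell → ℤ := fun c => ((T c).map MEntry.idx).getD 0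
  have hidx : ∀ {a c q}, Pend b T a c q → idx (a, c) = q := by
    intro a c q h
    simp [idx, h.1, MEntry.idx]
  obtain ⟨c₀, ⟨r₀, h₀⟩, hmin⟩ := hfin.exists_minimalFor idx _ ⟨(i, j), r, h⟩
  obtain ⟨⟨i₁, j₁⟩, ⟨h₁, he₁⟩, hmax⟩ :=
    (hfin.subset (fun c hc => hc.1 :
      {c : Cell | (∃ r, Pend b T c.1 c.2 r) ∧ idx c = idx c₀} ⊆ _)).exists_maximalFor
      (fun c => c.2) _ ⟨c₀, ⟨r₀, h₀⟩, rfl⟩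
  obtain ⟨r₁, h₁⟩ := h₁
  refine ⟨i₁, j₁, r₁, h₁, h₁.1, fun a c q hq => ?_⟩
  have e1 := hidx hq
  have e2 := hidx h₁
  have h3 : r₁ ≤ q := by
    rw [← e1, ← e2, he₁]
    rcases le_total (idx (a, c)) (idx c₀) with h | h
    · exact hmin ⟨q, hq⟩ h
    · exact h
  rcases h3.lt_or_eq with h4 | h4
  · exact Or.inl h4
  · refine Or.inr ⟨h4, ?_⟩
    rcases le_total c j₁ with h | h
    · exact h
    · exact hmax (j := (a, c)) ⟨⟨q, hq⟩, by rw [e1, ← h4, ← e2, he₁]⟩ h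

theorem State.progress (hs : State T) (hf : (mshape T).Finite) (h : ∃ i j r, Pend b T i j r) :
    ∃ T', Sw b T T' := by
  obtain ⟨i, j, r, hp, hc⟩ := exists_chosen hf h
  exact hc.step hs hp

theorem SwAt.mshape_eq {z : Prop} {k l k' l' : ℕ} {x y : ℤ} (h : SwAt z T k l k' l' x y T') :
    mshape T' = mshape T := by
  ext c; exact h.ne_none c

theorem Sw.mshape_eq (h : Sw b T T') : mshape T' = mshape T := by
  obtain ⟨i, j, i', j', r, s, h⟩ := h; exact h.mshape_eq

theorem Sw.state (h : Sw b T T') (hs : State T) : State T' := by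
  obtain ⟨i, j, i', j', r, s, h⟩ := h; exact h.state hs

theorem Sw.steps_mshape (h : Relation.ReflTransGen (Sw b) T T') : mshape T' = mshape T := by
  induction h with
  | refl => rfl
  | tail _ h ih => rw [h.mshape_eq, ih]

theorem Sw.steps_state (h : Relation.ReflTransGen (Sw b) T T') (hs : State T) : State T' := by
  induction h with
  | refl => exact hs
  | tail _ h ih => exact h.state ih

theorem Sw.steps_mono {z z' : Prop} (hz : z → z') (h : Relation.ReflTransGen (Sw z) T T') :
    Relation.ReflTransGen (Sw z') T T' :=
  by
  induction h with
  | refl => exact Relation.ReflTransGen.refl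
  | tail _ h ih => exact ih.tail (h.mono hz)

/-- The total height of the `β` entries. -/
noncomputable def bsum (F : Finset Cell) (T : MixedTableau) : ℕ :=
  ∑ c ∈ F, if isBetaCell T c then c.1 + c.2 else 0

theorem SwAt.bsum_eq {z : Prop} {k l k' l' : ℕ} {x y : ℤ} (h : SwAt z T k l k' l' x y T')
    {F : Finset Cell} (hF : mshape T ⊆ F) : bsum F T' + 1 = bsum F T := by
  have m1 : (k, l) ∈ F := hF (ne_none_of_eq h.a)
  have hA := h.cond.adj
  have hne : ((k', l') : Cell) ≠ (k, l) := by
    intro he; rw [Prod.mk.injEq] at he; unfold Adj at hA; omega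
  have m2 : (k', l') ∈ F.erase (k, l) := Finset.mem_erase.2 ⟨hne, hF (ne_none_of_eq h.b)⟩
  have hsum : ∀ f : Cell → ℕ, ∑ c ∈ F, f c =
      f (k, l) + (f (k', l') + ∑ c ∈ (F.erase (k, l)).erase (k', l'), f c) := fun f => by
    rw [Finset.add_sum_erase _ _ m2, Finset.add_sum_erase _ _ m1]
  unfold bsum
  rw [hsum, hsum]
  have e1 : isBetaCell T' (k, l) := ⟨_, h.left⟩
  have e2 : ¬ isBetaCell T' (k', l') := by rintro ⟨q, hq⟩; rw [h.right] at hq; simp at hq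
  have e3 : ¬ isBetaCell T (k, l) := by rintro ⟨q, hq⟩; rw [h.a] at hq; simp at hq
  have e4 : isBetaCell T (k', l') := ⟨_, h.b⟩
  rw [if_pos e1, if_neg e2, if_neg e3, if_pos e4]
  have hcongr : ∀ c ∈ (F.erase (k, l)).erase (k', l'),
      (if isBetaCell T' c then c.1 + c.2 else 0) = if isBetaCell T c then c.1 + c.2 else 0 := by
    intro c hc
    simp only [Finset.mem_erase] at hc
    have hiff : isBetaCell T' c ↔ isBetaCell T c := by
      simp only [isBetaCell, h.other hc.2.1 hc.1]
    by_cases hβ : isBetaCell T c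
    · rw [if_pos hβ, if_pos (hiff.2 hβ)]
    · rw [if_neg hβ, if_neg (fun h' => hβ (hiff.1 h'))]
  rw [Finset.sum_congr rfl hcongr]
  unfold Adj at hA
  dsimp only
  omega

theorem exists_normal (b : Prop) (hs : State T) (hf : (mshape T).Finite) :
    ∃ R, Relation.ReflTransGen (Sw b) T R ∧ ∀ R', ¬ Sw b R R' := by
  have aux : ∀ n, ∀ T, State T → mshape T ⊆ hf.toFinset → bsum hf.toFinset T = n →
      ∃ R, Relation.ReflTransGen (Sw b) T R ∧ ∀ R', ¬ Sw b R R' := by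
    intro n
    induction n using Nat.strong_induction_on with
    | _ n ih =>
      intro T hs hF hn
      by_cases hstep : ∃ T', Sw b T T'
      · obtain ⟨T', h⟩ := hstep
        have hlt : bsum hf.toFinset T' < n := by
          obtain ⟨i, j, i', j', r, s, h⟩ := h
          have := h.bsum_eq hF
          omega
        obtain ⟨R, h1, h2⟩ := ih _ hlt T' (h.state hs) (h.mshape_eq ▸ hF) rfl
        exact ⟨R, Relation.ReflTransGen.head h h1, h2⟩
      · exact ⟨T, Relation.ReflTransGen.refl, fun R' h => hstep ⟨R', h⟩⟩
  exact aux _ T hs (by simp) rfl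

theorem Sw.pend (h : Sw b T T') : ∃ i j r, Pend b T i j r := by
  obtain ⟨i, j, i', j', r, s, h⟩ := h
  exact ⟨i, j, r, h.a, i', j', s, h.b, h.cond⟩

theorem Sw.mcount_eq (h : Sw b T T') (e : MEntry) : mcount T' e = mcount T e := by
  obtain ⟨i, j, i', j', r, s, h⟩ := h
  unfold mcount
  rw [h.eq, swapCells_eq]
  have : {c | T (Equiv.swap (i, j) (i', j') c) = some e} =
      Equiv.swap (i, j) (i', j') '' {c | T c = some e} := by
    ext c
    simp only [Set.mem_ofPred_eq, Set.mem_image]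
    constructor
    · intro h; exact ⟨_, h, by simp⟩
    · rintro ⟨d, hd, rfl⟩; simpa using hd
  rw [this, Set.ncard_image_of_injective _ (Equiv.injective _)]

theorem Sw.steps_mcount (h : Relation.ReflTransGen (Sw b) T T') (e : MEntry) :
    mcount T' e = mcount T e := by
  induction h with
  | refl => rfl
  | tail _ h ih => rw [h.mcount_eq, ih]

/-! ### Out-of-order invariants -/

/-- No `β` followed by an `α` to the right or above is in the wrong order. -/
def BOrd (T : MixedTableau) : Prop :=
  (∀ {i j : ℕ} {r s : ℤ}, T (i, j) = some (.be s) → T (i, j + 1) = some (.al r) →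
    r ≤ s + j - i) ∧
  (∀ {i j : ℕ} {r s : ℤ}, T (i, j) = some (.be s) → T (i + 1, j) = some (.al r) →
    r < s + j - i)

/-- No `α` is out of order. -/
def AOrd (T : MixedTableau) : Prop := ∀ {i j r}, ¬ Pend False T i j r

theorem AOrd.rt (h : AOrd T) (h1 : T (i, j) = some (.al r)) (h2 : T (i, j + 1) = some (.be s)) :
    s + j - i < r := by
  by_contra h3
  exact h (Pend.rt h1 h2 (Or.inr (by omega)))

theorem AOrd.up (h : AOrd T) (h1 : T (i, j) = some (.al r)) (h2 : T (i + 1, j) = some (.be s)) :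
    s + j - i ≤ r := by
  by_contra h3
  exact h (Pend.up h1 h2 (Or.inr (by omega)))

theorem aord_of (h1 : ∀ {i j : ℕ} {r s : ℤ}, T (i, j) = some (.al r) →
      T (i, j + 1) = some (.be s) → s + j - i < r)
    (h2 : ∀ {i j : ℕ} {r s : ℤ}, T (i, j) = some (.al r) →
      T (i + 1, j) = some (.be s) → s + j - i ≤ r) : AOrd T := by
  rintro i j r ⟨h, i', j', s, h', ⟨rfl, rfl, h3⟩ | ⟨rfl, rfl, h3⟩⟩
  · have := h1 h h'
    rcases h3 with h3 | h3
    · exact h3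
    · omega
  · have := h2 h h'
    rcases h3 with h3 | h3
    · exact h3
    · omega

variable {k l k' l' : ℕ} {x y : ℤ}

theorem SwAt.bOrd (h : SwAt False T k l k' l' x y T') (hI : BOrd T) : BOrd T' := by
  have hv := h.v
  have ha := h.a
  have hb := h.b
  have hc : (k' = k ∧ l' = l + 1 ∧ x ≤ y + l - k) ∨ (k' = k + 1 ∧ l' = l ∧ x < y + l - k) := by
    have := h.cond
    simpa [Cond] using this
  constructor
  · intro i j r s h1 h2
    rw [h.eq] at h1 h2
    rcases swapCells_cases h1 with ⟨e, g⟩ | ⟨e, g⟩ | ⟨n1, n2, g⟩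
    · rw [Prod.mk.injEq] at e
      obtain ⟨rfl, rfl⟩ := e
      rw [hb] at g
      obtain rfl : y = s := by simpa using g
      rcases swapCells_cases h2 with ⟨e, g'⟩ | ⟨e, g'⟩ | ⟨m1, m2, g'⟩
      · rw [Prod.mk.injEq] at e; omega
      · rw [ha] at g'
        obtain rfl : x = r := by simpa using g'
        omega
      · have := (hv.al ha g' le_rfl (by omega)).1
        omega
    · rw [ha] at g; simp at g
    · rcases swapCells_cases h2 with ⟨e, g'⟩ | ⟨e, g'⟩ | ⟨m1, m2, g'⟩
      · rw [hb] at g'; simp at g'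
      · rw [Prod.mk.injEq] at e
        obtain ⟨rfl, rfl⟩ := e
        rw [ha] at g'
        obtain rfl : x = r := by simpa using g'
        rcases hc with ⟨rfl, hl, h3⟩ | ⟨rfl, rfl, h3⟩
        · exact absurd (by rw [show j = l by omega]) n1
        · have := (hv.be g hb le_rfl (by omega)).2 rfl (by omega)
          push_cast at *
          omega
      · exact hI.1 g g'
  · intro i j r s h1 h2
    rw [h.eq] at h1 h2
    rcases swapCells_cases h1 with ⟨e, g⟩ | ⟨e, g⟩ | ⟨n1, n2, g⟩
    · rw [Prod.mk.injEq] at e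
      obtain ⟨rfl, rfl⟩ := e
      rw [hb] at g
      obtain rfl : y = s := by simpa using g
      rcases swapCells_cases h2 with ⟨e, g'⟩ | ⟨e, g'⟩ | ⟨m1, m2, g'⟩
      · rw [Prod.mk.injEq] at e; omega
      · rw [Prod.mk.injEq] at e
        rw [ha] at g'
        obtain rfl : x = r := by simpa using g'
        omega
      · have := (hv.al ha g' (by omega) le_rfl).2 rfl (by omega)
        omega
    · rw [ha] at g; simp at g
    · rcases swapCells_cases h2 with ⟨e, g'⟩ | ⟨e, g'⟩ | ⟨m1, m2, g'⟩
      · rw [hb] at g'; simp at g'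
      · rw [Prod.mk.injEq] at e
        obtain ⟨rfl, rfl⟩ := e
        rw [ha] at g'
        obtain rfl : x = r := by simpa using g'
        rcases hc with ⟨rfl, rfl, h3⟩ | ⟨hl, rfl, h3⟩
        · have := (hv.be g hb (by omega) le_rfl).1
          push_cast at *
          omega
        · exact absurd (by rw [show i = k by omega]) n1
      · exact hI.2 g g'

theorem SwAt.bOrd_back {z : Prop} (h : SwAt z T k l k' l' x y T') (hI : BOrd T') :
    SwAt False T k l k' l' x y T' ∧ BOrd T := by
  have hv := h.v
  have ha := h.a
  have hb := h.b
  have hc : (k' = k ∧ l' = l + 1 ∧ x ≤ y + l - k) ∨ (k' = k + 1 ∧ l' = l ∧ x < y + l - k) := by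
    rcases h.cond with ⟨rfl, rfl, -⟩ | ⟨rfl, rfl, -⟩
    · exact Or.inl ⟨rfl, rfl, hI.1 h.left h.right⟩
    · exact Or.inr ⟨rfl, rfl, hI.2 h.left h.right⟩
  refine ⟨⟨h.v, h.v', ha, hb, by simpa [Cond] using hc, h.eq⟩, ?_, ?_⟩
  · intro i j r s h1 h2
    by_cases e : (i, j + 1) = (k, l)
    · rw [e, ha] at h2
      obtain rfl : x = r := by simpa using h2
      rw [Prod.mk.injEq] at e
      obtain ⟨rfl, rfl⟩ := e
      rcases hc with ⟨rfl, rfl, h3⟩ | ⟨rfl, rfl, h3⟩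
      · have := (hv.be h1 hb le_rfl (by omega)).2 rfl (by omega)
        push_cast at *; omega
      · have := (hv.be h1 hb (by omega) (by omega)).1
        push_cast at *; omega
    · by_cases e' : (i, j) = (k', l')
      · rw [e', hb] at h1
        obtain rfl : y = s := by simpa using h1
        rw [Prod.mk.injEq] at e'
        obtain ⟨rfl, rfl⟩ := e'
        have := (hv.al ha h2 (by omega) (by omega)).1
        omega
      · refine hI.1 (h.be_other h1 e') (h.al_other h2 e)
  · intro i j r s h1 h2
    by_cases e : (i + 1, j) = (k, l)
    · rw [e, ha] at h2
      obtain rfl : x = r := by simpa using h2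
      rw [Prod.mk.injEq] at e
      obtain ⟨rfl, rfl⟩ := e
      have := (hv.be h1 hb (by omega) (by omega)).1
      push_cast at *; omega
    · by_cases e' : (i, j) = (k', l')
      · rw [e', hb] at h1
        obtain rfl : y = s := by simpa using h1
        rw [Prod.mk.injEq] at e'
        obtain ⟨rfl, rfl⟩ := e'
        have h3 := hv.al ha h2 (by omega) (by omega)
        rcases hc with ⟨rfl, rfl, h4⟩ | ⟨rfl, rfl, h4⟩
        · push_cast at *; omega
        · have := h3.2 rfl (by omega)
          push_cast at *; omega
      · refine hI.2 (h.be_other h1 e') (h.al_other h2 e)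

theorem SwAt.aOrd {z : Prop} (h : SwAt z T k l k' l' x y T') (hJ : AOrd T) : AOrd T' := by
  have hv := h.v
  have ha := h.a
  have hb := h.b
  have hc : (k' = k ∧ l' = l + 1 ∧ y + l - k < x) ∨ (k' = k + 1 ∧ l' = l ∧ y + l - k ≤ x) := by
    rcases h.cond with ⟨rfl, rfl, -⟩ | ⟨rfl, rfl, -⟩
    · exact Or.inl ⟨rfl, rfl, hJ.rt ha hb⟩
    · exact Or.inr ⟨rfl, rfl, hJ.up ha hb⟩
  apply aord_of
  · intro i j r s h1 h2
    rw [h.eq] at h1 h2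
    rcases swapCells_cases h1 with ⟨e, g⟩ | ⟨e, g⟩ | ⟨n1, n2, g⟩
    · rw [hb] at g; simp at g
    · rw [Prod.mk.injEq] at e
      obtain ⟨rfl, rfl⟩ := e
      rw [ha] at g
      obtain rfl : x = r := by simpa using g
      rcases swapCells_cases h2 with ⟨e, g'⟩ | ⟨e, g'⟩ | ⟨m1, m2, g'⟩
      · rw [Prod.mk.injEq] at e; omega
      · rw [ha] at g'; simp at g'
      · have := (hv.be hb g' (by omega) (by omega)).2 rfl (by omega)
        rcases hc with ⟨rfl, rfl, h4⟩ | ⟨rfl, rfl, h4⟩ <;> push_cast at * <;> omega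
    · rcases swapCells_cases h2 with ⟨e, g'⟩ | ⟨e, g'⟩ | ⟨m1, m2, g'⟩
      · rw [Prod.mk.injEq] at e
        obtain ⟨rfl, rfl⟩ := e
        rw [hb] at g'
        obtain rfl : y = s := by simpa using g'
        have := (hv.al g ha (by omega) (by omega)).1
        rcases hc with ⟨rfl, rfl, h4⟩ | ⟨rfl, rfl, h4⟩ <;> push_cast at * <;> omega
      · rw [ha] at g'; simp at g'
      · exact hJ.rt g g'
  · intro i j r s h1 h2
    rw [h.eq] at h1 h2
    rcases swapCells_cases h1 with ⟨e, g⟩ | ⟨e, g⟩ | ⟨n1, n2, g⟩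
    · rw [hb] at g; simp at g
    · rw [Prod.mk.injEq] at e
      obtain ⟨rfl, rfl⟩ := e
      rw [ha] at g
      obtain rfl : x = r := by simpa using g
      rcases swapCells_cases h2 with ⟨e, g'⟩ | ⟨e, g'⟩ | ⟨m1, m2, g'⟩
      · rw [Prod.mk.injEq] at e; omega
      · rw [ha] at g'; simp at g'
      · have := (hv.be hb g' (by omega) (by omega)).1
        rcases hc with ⟨rfl, rfl, h4⟩ | ⟨rfl, rfl, h4⟩ <;> push_cast at * <;> omega
    · rcases swapCells_cases h2 with ⟨e, g'⟩ | ⟨e, g'⟩ | ⟨m1, m2, g'⟩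
      · rw [Prod.mk.injEq] at e
        obtain ⟨rfl, rfl⟩ := e
        rw [hb] at g'
        obtain rfl : y = s := by simpa using g'
        have := (hv.al g ha (by omega) (by omega)).2 rfl (by omega)
        rcases hc with ⟨rfl, rfl, h4⟩ | ⟨rfl, rfl, h4⟩ <;> push_cast at * <;> omega
      · rw [ha] at g'; simp at g'
      · exact hJ.up g g'

theorem Sw.steps_bOrd (h : Relation.ReflTransGen (Sw False) T T') (hI : BOrd T) : BOrd T' := by
  induction h with
  | refl => exact hI
  | tail _ h ih =>
    obtain ⟨i, j, i', j', r, s, h⟩ := h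
    exact h.bOrd ih

theorem Sw.steps_bOrd_back (h : Relation.ReflTransGen (Sw True) T T') (hI : BOrd T') :
    Relation.ReflTransGen (Sw False) T T' := by
  suffices Relation.ReflTransGen (Sw False) T T' ∧ BOrd T from this.1
  induction h using Relation.ReflTransGen.head_induction_on with
  | refl => exact ⟨Relation.ReflTransGen.refl, hI⟩
  | head h _ ih =>
    obtain ⟨i, j, i', j', r, s, h⟩ := h
    obtain ⟨h1, h2⟩ := h.bOrd_back ih.2
    exact ⟨Relation.ReflTransGen.head ⟨_, _, _, _, _, _, h1⟩ ih.1, h2⟩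

/-! ### Flags -/

/-- The flag condition for the `α` entries. -/
def AFlag (T : MixedTableau) : Prop :=
  ∀ {i j : ℕ} {k : ℤ}, T (i, j) = some (.al k) → 0 < k ∧ k < j

/-- The flag condition for the `β` entries. -/
def BFlag (T : MixedTableau) : Prop :=
  ∀ {i j : ℕ} {k : ℤ}, T (i, j) = some (.be k) → 0 < k ∧ k < i

theorem isFMT_iff : IsFMT T ↔ AFlag T ∧ BFlag T :=
  ⟨fun h => ⟨fun h' => h.1 _ _ h', fun h' => h.2 _ _ h'⟩,
    fun h => ⟨fun _ _ h' => h.1 h', fun _ _ h' => h.2 h'⟩⟩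

theorem SwAt.aFlag {z : Prop} (h : SwAt z T k l k' l' x y T') (hA : AFlag T) : AFlag T' := by
  intro i j q hq
  rw [h.eq] at hq
  rcases swapCells_cases hq with ⟨e, g⟩ | ⟨e, g⟩ | ⟨n1, n2, g⟩
  · rw [h.b] at g; simp at g
  · rw [Prod.mk.injEq] at e
    obtain ⟨rfl, rfl⟩ := e
    have := hA g
    have hadj := h.cond.adj
    unfold Adj at hadj
    omega
  · exact hA g

theorem SwAt.bFlag_back {z : Prop} (h : SwAt z T k l k' l' x y T') (hB : BFlag T') :
    BFlag T := by
  intro i j q hq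
  by_cases e : (i, j) = (k', l')
  · rw [e, h.b] at hq
    obtain rfl : y = q := by simpa using hq
    rw [Prod.mk.injEq] at e
    have := hB h.left
    have hadj := h.cond.adj
    unfold Adj at hadj
    omega
  · exact hB (h.be_other hq e)

theorem Sw.steps_aFlag (h : Relation.ReflTransGen (Sw b) T T') (hA : AFlag T) : AFlag T' := by
  induction h with
  | refl => exact hA
  | tail _ h ih =>
    obtain ⟨i, j, i', j', r, s, h⟩ := h
    exact h.aFlag ih

theorem Sw.steps_bFlag_back (h : Relation.ReflTransGen (Sw b) T T') (hB : BFlag T') :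
    BFlag T := by
  induction h using Relation.ReflTransGen.head_induction_on with
  | refl => exact hB
  | head h _ ih =>
    obtain ⟨i, j, i', j', r, s, h⟩ := h
    exact h.bFlag_back ih

theorem Sw.steps_flags_back (h : Relation.ReflTransGen (Sw False) T T')
    (hF : AFlag T' ∧ BFlag T') : AFlag T ∧ BFlag T := by
  induction h using Relation.ReflTransGen.head_induction_on with
  | refl => exact hF
  | head h _ ih =>
    obtain ⟨k, l, k', l', x, y, h⟩ := h
    refine ⟨?_, h.bFlag_back ih.2⟩
    intro i j q hq
    by_cases e : (i, j) = (k, l)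
    · rw [e, h.a] at hq
      obtain rfl : x = q := by simpa using hq
      rw [Prod.mk.injEq] at e
      have h1 := ih.1 h.right
      have h2 := ih.2 h.left
      have hc := h.cond
      simp only [Cond, false_or] at hc
      omega
    · exact ih.1 (h.al_other hq e)

theorem Sw.steps_flags (h : Relation.ReflTransGen (Sw b) T T') (hJ : AOrd T)
    (hF : AFlag T ∧ BFlag T) : AFlag T' ∧ BFlag T' := by
  suffices AOrd T' ∧ AFlag T' ∧ BFlag T' from this.2
  induction h with
  | refl => exact ⟨hJ, hF⟩
  | tail _ h ih =>
    obtain ⟨k, l, k', l', x, y, h⟩ := h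
    refine ⟨h.aOrd ih.1, h.aFlag ih.2.1, ?_⟩
    intro i j q hq
    rw [h.eq] at hq
    rcases swapCells_cases hq with ⟨e, g⟩ | ⟨e, g⟩ | ⟨n1, n2, g⟩
    · rw [Prod.mk.injEq] at e
      have h1 := ih.2.1 h.a
      have h2 := ih.2.2 g
      rw [h.b] at g
      obtain rfl : y = q := by simpa using g
      rcases h.cond with ⟨rfl, rfl, -⟩ | ⟨rfl, rfl, -⟩
      · omega
      · have := AOrd.up ih.1 h.a h.b
        omega
    · rw [h.a] at g; simp at g
    · exact ih.2.2 g

end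

end Groth

namespace Groth

/-! ### Duality -/

/-- Exchange the roles of `α` and `β`. -/
def flipE : MEntry → MEntry
  | .al k => .be k
  | .be k => .al k

/-- Transpose a mixed tableau, exchanging the roles of `α` and `β`. -/
def star (T : MixedTableau) : MixedTableau := fun c => (T (c.2, c.1)).map flipE

theorem star_al {T : MixedTableau} {i j : ℕ} {r : ℤ} :
    star T (i, j) = some (.al r) ↔ T (j, i) = some (.be r) := by
  unfold star
  rcases h : T (j, i) with _ | (k | k) <;> simp [flipE]

theorem star_be {T : MixedTableau} {i j : ℕ} {r : ℤ} :
    star T (i, j) = some (.be r) ↔ T (j, i) = some (.al r) := by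
  unfold star
  rcases h : T (j, i) with _ | (k | k) <;> simp [flipE]

theorem star_ne_none {T : MixedTableau} {i j : ℕ} :
    star T (i, j) ≠ none ↔ T (j, i) ≠ none := by
  simp [star]

theorem star_star (T : MixedTableau) : star (star T) = T := by
  funext ⟨i, j⟩
  rcases h : T (i, j) with _ | (k | k) <;> simp [star, h, flipE]

theorem Valid.star {T : MixedTableau} (h : Valid T) : Valid (star T) :=
  ⟨fun h1 h2 hi hj => by
      rw [star_al] at h1 h2; exact h.be h1 h2 hj hi,
    fun h1 h2 hi hj => by
      rw [star_be] at h1 h2; exact h.al h1 h2 hj hi⟩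

theorem star_swapCells (T : MixedTableau) (i j k l : ℕ) :
    star (swapCells T (i, j) (k, l)) = swapCells (star T) (j, i) (l, k) := by
  funext ⟨a, c⟩
  by_cases h1 : (c, a) = (i, j)
  · rw [Prod.mk.injEq] at h1
    obtain ⟨rfl, rfl⟩ := h1
    simp [star, swapCells_left]
  · by_cases h2 : (c, a) = (k, l)
    · rw [Prod.mk.injEq] at h2
      obtain ⟨rfl, rfl⟩ := h2
      simp [star, swapCells_right]
    · have h1' : ((a, c) : Cell) ≠ (j, i) := fun h => h1 (by
        rw [Prod.mk.injEq] at h ⊢; exact h.symm)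
      have h2' : ((a, c) : Cell) ≠ (l, k) := fun h => h2 (by
        rw [Prod.mk.injEq] at h ⊢; exact h.symm)
      rw [swapCells_ne _ h1' h2']
      simp [star, swapCells_ne _ h1 h2]

theorem Sw.dual {T T' : MixedTableau} (h : Sw True T T') : Sw True (star T') (star T) := by
  obtain ⟨i, j, i', j', r, s, h⟩ := h
  have hA := h.cond.adj
  refine ⟨j, i, j', i', s, r, h.v'.star, h.v.star, star_al.2 h.left, star_be.2 h.right,
    Adj.cond trivial (by unfold Adj at *; omega), ?_⟩
  rw [h.eq, star_swapCells, swapCells_swapCells]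

theorem Sw.steps_star {T T' : MixedTableau} (h : Relation.ReflTransGen (Sw True) T T') :
    Relation.ReflTransGen (Sw True) (star T') (star T) := by
  induction h with
  | refl => exact Relation.ReflTransGen.refl
  | tail _ h ih => exact Relation.ReflTransGen.head h.dual ih

theorem Convex.star {T : MixedTableau} (h : Convex T) : Convex (star T) := by
  intro i j i' j' a b h1 h2 h3 h4 h5 h6
  rw [star_ne_none] at *
  exact h h1 h2 h5 h6 h3 h4

theorem mshape_star_finite {T : MixedTableau} (h : (mshape T).Finite) :
    (mshape (star T)).Finite := by
  refine (h.image Prod.swap).subset ?_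
  rintro ⟨i, j⟩ hc
  exact ⟨(j, i), star_ne_none.1 hc, rfl⟩

/-- Equal entries of the same kind are never strictly northeast of each other. -/
def Strong (T : MixedTableau) : Prop :=
  (∀ {i j i' j' : ℕ} {r : ℤ}, T (i, j) = some (.al r) → T (i', j') = some (.al r) →
    i < i' → ¬ j < j') ∧
  (∀ {i j i' j' : ℕ} {r : ℤ}, T (i, j) = some (.be r) → T (i', j') = some (.be r) →
    i < i' → ¬ j < j')

theorem Strong.star {T : MixedTableau} (h : Strong T) : Strong (star T) :=
  ⟨fun h1 h2 hi hj => by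
      rw [star_al] at h1 h2; exact h.2 h1 h2 hj hi,
    fun h1 h2 hi hj => by
      rw [star_be] at h1 h2; exact h.1 h1 h2 hj hi⟩

theorem Strong.state {T : MixedTableau} (h : Strong T) (hv : Valid T) (hc : Convex T) : State T :=
  ⟨hv, hc, fun h1 h2 hi hj _ => absurd hj (h.1 h1 h2 hi),
    fun h1 h2 hi hj _ => absurd hj (h.2 h1 h2 hi)⟩

/-! ### Exquisite tableaux -/

/-- The value of an entry in `cBetaPlus`. -/
def tval (c : Cell) : MEntry → ℤ
  | .al k => k
  | .be k => k + ((c.2 : ℤ) - (c.1 : ℤ))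

theorem cBetaPlus_some {T : MixedTableau} {c : Cell} {e : MEntry} (h : T c = some e) :
    ∃ e', cBetaPlus T c = some e' ∧ e'.idx = tval c e := by
  unfold cBetaPlus
  rw [h]
  rcases e with k | k <;> exact ⟨_, rfl, rfl⟩

theorem of_cBetaPlus_some {T : MixedTableau} {c : Cell} {e' : MEntry}
    (h : cBetaPlus T c = some e') : ∃ e, T c = some e ∧ e'.idx = tval c e := by
  unfold cBetaPlus at h
  rcases hc : T c with _ | (k | k) <;> rw [hc] at h <;> simp at h <;> subst h <;>
    exact ⟨_, rfl, rfl⟩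

theorem tcs_iff {T : MixedTableau} : TotallyColumnStrict (cBetaPlus T) ↔
    (∀ c e e', T c = some e → T (upCell c) = some e' → tval (upCell c) e' < tval c e) ∧
    (∀ c e e', T c = some e → T (rtCell c) = some e' → tval (rtCell c) e' ≤ tval c e) := by
  constructor
  · intro h
    constructor
    · intro c e e' h1 h2
      obtain ⟨f, g1, g2⟩ := cBetaPlus_some h1
      obtain ⟨f', g1', g2'⟩ := cBetaPlus_some h2
      rw [← g2, ← g2']
      exact h.1 _ _ _ g1 g1'
    · intro c e e' h1 h2
      obtain ⟨f, g1, g2⟩ := cBetaPlus_some h1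
      obtain ⟨f', g1', g2'⟩ := cBetaPlus_some h2
      rw [← g2, ← g2']
      exact h.2 _ _ _ g1 g1'
  · intro h
    constructor
    · intro c e e' h1 h2
      obtain ⟨f, g1, g2⟩ := of_cBetaPlus_some h1
      obtain ⟨f', g1', g2'⟩ := of_cBetaPlus_some h2
      rw [g2, g2']
      exact h.1 _ _ _ g1 g1'
    · intro c e e' h1 h2
      obtain ⟨f, g1, g2⟩ := of_cBetaPlus_some h1
      obtain ⟨f', g1', g2'⟩ := of_cBetaPlus_some h2
      rw [g2, g2']
      exact h.2 _ _ _ g1 g1'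

/-- Monotonicity of the values of a totally column strict tableau. -/
theorem tcs_mono {T : MixedTableau} (h : TotallyColumnStrict (cBetaPlus T)) (hc : Convex T)
    {i j i' j' : ℕ} {e e' : MEntry} (h1 : T (i, j) = some e) (h2 : T (i', j') = some e')
    (hi : i ≤ i') (hj : j ≤ j') : tval (i', j') e' + (i' - i) ≤ tval (i, j) e := by
  rw [tcs_iff] at h
  obtain ⟨m, rfl⟩ := Nat.exists_eq_add_of_le hi
  obtain ⟨n, rfl⟩ := Nat.exists_eq_add_of_le hj
  clear hi hj
  induction m generalizing e' with
  | zero =>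
    induction n generalizing e' with
    | zero => simp only [Nat.add_zero] at h2 ⊢; rw [h1] at h2; simp at h2; subst h2; simp
    | succ n ih =>
      obtain ⟨f, hf⟩ := Option.ne_none_iff_exists'.1 (hc (ne_none_of_eq h1) (ne_none_of_eq h2)
        (by omega : i ≤ i + 0) (by omega) (by omega : j ≤ j + n) (by omega))
      have := ih hf
      have h3 := h.2 _ _ _ hf h2
      simp only [rtCell, ← Nat.add_assoc] at h3 ⊢
      omega
  | succ m ih =>
    obtain ⟨f, hf⟩ := Option.ne_none_iff_exists'.1 (hc (ne_none_of_eq h1) (ne_none_of_eq h2)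
      (by omega : i ≤ i + m) (by omega) (by omega : j ≤ j + n) (by omega))
    have := ih hf
    have h3 := h.1 _ _ _ hf h2
    simp only [upCell, ← Nat.add_assoc] at h3 ⊢
    push_cast at *
    omega

theorem valid_of_tcs {T : MixedTableau} (h : TotallyColumnStrict (cBetaPlus T)) (hc : Convex T) :
    Valid T := by
  constructor
  · intro i j i' j' r q h1 h2 hi hj
    have := tcs_mono h hc h1 h2 hi hj
    simp only [tval] at this
    omega
  · intro i j i' j' r q h1 h2 hi hj
    have := tcs_mono h hc h1 h2 hi hj
    simp only [tval] at this
    omega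

theorem strong_of_tcs {T : MixedTableau} (h : TotallyColumnStrict (cBetaPlus T)) (hc : Convex T) :
    Strong T := by
  constructor
  · intro i j i' j' r h1 h2 hi hj
    have := tcs_mono h hc h1 h2 hi.le hj.le
    simp only [tval] at this
    omega
  · intro i j i' j' r h1 h2 hi hj
    have := tcs_mono h hc h1 h2 hi.le hj.le
    simp only [tval] at this
    omega

theorem bOrd_of_tcs {T : MixedTableau} (h : TotallyColumnStrict (cBetaPlus T)) (hc : Convex T) :
    BOrd T := by
  constructor
  · intro i j r s h1 h2
    have := tcs_mono h hc h1 h2 (by omega) (by omega)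
    simp only [tval] at this
    omega
  · intro i j r s h1 h2
    have := tcs_mono h hc h1 h2 (by omega) (by omega)
    simp only [tval] at this
    omega

theorem aOrd_of_tcs {T : MixedTableau} (h : TotallyColumnStrict (cBetaPlus T)) (hc : Convex T) :
    AOrd T := by
  apply aord_of
  · intro i j r s h1 h2
    have := tcs_mono h hc h1 h2 (by omega) (by omega)
    simp only [tval] at this
    omega
  · intro i j r s h1 h2
    have := tcs_mono h hc h1 h2 (by omega) (by omega)
    simp only [tval] at this
    omega

theorem tcs_of {T : MixedTableau} (hv : Valid T) (hI : BOrd T) (hJ : AOrd T) :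
    TotallyColumnStrict (cBetaPlus T) := by
  rw [tcs_iff]
  constructor
  · rintro ⟨i, j⟩ (r | r) (q | q) h1 h2 <;> simp only [upCell, tval] at *
    · exact (hv.al h1 h2 (by omega) le_rfl).2 rfl (by omega)
    · have := AOrd.up hJ h1 h2; push_cast; omega
    · have := hI.2 h1 h2; omega
    · have := (hv.be h1 h2 (by omega) le_rfl).1; push_cast; omega
  · rintro ⟨i, j⟩ (r | r) (q | q) h1 h2 <;> simp only [rtCell, tval] at *
    · exact (hv.al h1 h2 le_rfl (by omega)).1
    · have := AOrd.rt hJ h1 h2; push_cast; omega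
    · have := hI.1 h1 h2; omega
    · have := (hv.be h1 h2 le_rfl (by omega)).2 rfl (by omega); push_cast; omega

/-! ### The shuffle -/

section
variable {Q R Q' : MixedTableau} {i j : ℕ} {r : ℤ}

theorem pend_true_iff : Pend True Q i j r ↔ Q (i, j) = some (.al r) ∧ ShuffPending Q (i, j) := by
  constructor
  · rintro ⟨h, i', j', s, h', ⟨rfl, rfl, -⟩ | ⟨rfl, rfl, -⟩⟩
    · exact ⟨h, ⟨r, h⟩, Or.inr ⟨s, h'⟩⟩
    · exact ⟨h, ⟨r, h⟩, Or.inl ⟨s, h'⟩⟩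
  · rintro ⟨h, -, ⟨s, h'⟩ | ⟨s, h'⟩⟩
    · exact Pend.up h h' (Or.inl trivial)
    · exact Pend.rt h h' (Or.inl trivial)

theorem chosen_of_shuffChosen (h : ShuffChosen Q (i, j)) :
    ∃ r, Pend True Q i j r ∧ Chosen True Q i j r := by
  obtain ⟨h0, r, h1, h2, h3⟩ := h
  refine ⟨r, pend_true_iff.2 ⟨h1, h0⟩, h1, fun a c q hq => ?_⟩
  rw [pend_true_iff] at hq
  rcases (h2 _ _ hq.2 hq.1).lt_or_eq with h4 | h4
  · exact Or.inl h4
  · subst h4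
    exact Or.inr ⟨rfl, h3 _ hq.2 hq.1⟩

theorem shuffChosen_of_chosen (hp : Pend True Q i j r) (h : Chosen True Q i j r) :
    ShuffChosen Q (i, j) := by
  refine ⟨(pend_true_iff.1 hp).2, r, h.1, ?_, ?_⟩
  · rintro ⟨a, c⟩ q h1 h2
    rcases h.2 a c q (pend_true_iff.2 ⟨h2, h1⟩) with h3 | h3 <;> omega
  · rintro ⟨a, c⟩ h1 h2
    rcases h.2 a c r (pend_true_iff.2 ⟨h2, h1⟩) with h3 | h3
    · exact absurd h3 (lt_irrefl _)
    · exact h3.2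

/-- A move of the shuffle is a switch, after which the moved entry is still extremal. -/
theorem ShuffMoveTo.sw (hs : State Q) (hch : Chosen True Q i j r) {c' : Cell}
    (h : ShuffMoveTo Q (i, j) c' Q') :
    ∃ s, SwAt True Q i j c'.1 c'.2 r s Q' ∧ Chosen True Q' c'.1 c'.2 r := by
  have main : ∃ s, SwAt True Q i j c'.1 c'.2 r s Q' := by
    obtain ⟨-, h1, ⟨⟨s, h2⟩, h3, rfl⟩ | ⟨⟨t, h2⟩, h3, rfl⟩ |
      ⟨k, s, h2, h3, ⟨h4, rfl⟩ | ⟨h4, rfl⟩⟩⟩ := h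
    · exact ⟨s, hs.v, h1 ▸ hch.valid_rt hs h2 (Or.inl trivial) (fun t h4 _ => absurd ⟨t, h4⟩ h3),
        hch.1, h2, Or.inl ⟨rfl, rfl, Or.inl trivial⟩, h1⟩
    · exact ⟨t, hs.v, h1 ▸ hch.valid_up hs h2 (Or.inl trivial) (fun t h4 _ => absurd ⟨t, h4⟩ h3),
        hch.1, h2, Or.inr ⟨rfl, rfl, Or.inl trivial⟩, h1⟩
    · refine ⟨k, hs.v, h1 ▸ hch.valid_up hs h2 (Or.inl trivial) (fun t h5 _ => ?_),
        hch.1, h2, Or.inr ⟨rfl, rfl, Or.inl trivial⟩, h1⟩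
      change Q (i, j + 1) = _ at h3
      rw [h3] at h5
      simp at h5; omega
    · refine ⟨s, hs.v, h1 ▸ hch.valid_rt hs h3 (Or.inl trivial) (fun t h5 _ => ?_),
        hch.1, h3, Or.inl ⟨rfl, rfl, Or.inl trivial⟩, h1⟩
      change Q (i + 1, j) = _ at h2
      rw [h2] at h5
      simp at h5; omega
  obtain ⟨s, hsw⟩ := main
  refine ⟨s, hsw, hsw.right, ?_⟩
  rintro a d q ⟨hq, a', d', t, ht, hcond⟩
  have hA := hsw.cond.adj
  by_cases e : (a, d) = (c'.1, c'.2)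
  · rw [e, hsw.right] at hq
    obtain rfl : r = q := by simpa using hq
    rw [Prod.mk.injEq] at e
    exact Or.inr ⟨rfl, by omega⟩
  · have hq' := hsw.al_back hq e
    by_cases e' : (a', d') = (i, j)
    · rw [Prod.mk.injEq] at e'
      obtain ⟨rfl, rfl⟩ := e'
      have hA' := hcond.adj
      unfold Adj at hA hA'
      have h1 := hs.v.al hq' hch.1 (by omega) (by omega)
      rcases h1.1.lt_or_eq with h2 | h2
      · exact Or.inl h2
      · refine Or.inr ⟨h2, by omega⟩
    · have ht' := hsw.be_back ht e'
      rcases hch.2 a d q ⟨hq', a', d', t, ht', hcond⟩ with h1 | h1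
      · exact Or.inl h1
      · refine Or.inr ⟨h1.1, ?_⟩
        unfold Adj at hA
        omega

theorem ShuffTrack.steps {c : Cell} (h : ShuffTrack Q c R) : ∀ {i j r}, c = (i, j) → State Q →
    Chosen True Q i j r → Relation.ReflTransGen (Sw True) Q R := by
  induction h with
  | done Q c h => intros; exact Relation.ReflTransGen.refl
  | step Q c c' Q' R hm _ ih =>
    rintro i j r rfl hs hch
    obtain ⟨s, h1, h2⟩ := ShuffMoveTo.sw hs hch hm
    exact Relation.ReflTransGen.head ⟨_, _, _, _, _, _, h1⟩ (ih rfl (h1.state hs) h2)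

theorem ShuffRel.steps (h : ShuffRel Q R) (hs : State Q) :
    Relation.ReflTransGen (Sw True) Q R ∧ ∀ R', ¬ Sw True R R' := by
  induction h with
  | done Q h =>
    refine ⟨Relation.ReflTransGen.refl, fun R' hR => ?_⟩
    obtain ⟨i, j, r, hp⟩ := hR.pend
    exact h _ (pend_true_iff.1 hp).2
  | step Q c Q' R hc ht _ ih =>
    obtain ⟨i, j⟩ := c
    obtain ⟨r, -, h1⟩ := chosen_of_shuffChosen hc
    have h2 := ShuffTrack.steps ht rfl hs h1
    have h3 := ih (Sw.steps_state h2 hs)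
    exact ⟨h2.trans h3.1, h3.2⟩

theorem exists_shuffMoveTo (h : Q (i, j) = some (.al r)) (hp : ¬ ShuffSettled Q (i, j)) :
    ∃ c' Q', ShuffMoveTo Q (i, j) c' Q' := by
  by_cases hu : isBetaCell Q (upCell (i, j))
  · by_cases hr : isBetaCell Q (rtCell (i, j))
    · obtain ⟨k, hk⟩ := hu
      obtain ⟨s, hs⟩ := hr
      rcases lt_or_ge s k with hlt | hge
      · exact ⟨_, _, ⟨r, h⟩, rfl, Or.inr (Or.inr ⟨k, s, hk, hs, Or.inl ⟨hlt, rfl⟩⟩)⟩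
      · exact ⟨_, _, ⟨r, h⟩, rfl, Or.inr (Or.inr ⟨k, s, hk, hs, Or.inr ⟨hge, rfl⟩⟩)⟩
    · exact ⟨_, _, ⟨r, h⟩, rfl, Or.inr (Or.inl ⟨hu, hr, rfl⟩)⟩
  · by_cases hr : isBetaCell Q (rtCell (i, j))
    · exact ⟨_, _, ⟨r, h⟩, rfl, Or.inl ⟨hr, hu, rfl⟩⟩
    · exact absurd ⟨hu, hr⟩ hp

theorem exists_shuffTrack {F : Finset Cell} (hs : State Q) (hF : mshape Q ⊆ F)
    (hch : Chosen True Q i j r) :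
    ∃ R, ShuffTrack Q (i, j) R ∧ Relation.ReflTransGen (Sw True) Q R ∧ bsum F R ≤ bsum F Q ∧
      (¬ ShuffSettled Q (i, j) → bsum F R < bsum F Q) := by
  generalize hn : bsum F Q = n
  induction n using Nat.strong_induction_on generalizing Q i j with
  | _ n ih =>
    by_cases hset : ShuffSettled Q (i, j)
    · exact ⟨Q, .done _ _ hset, Relation.ReflTransGen.refl, hn.le, fun h => absurd hset h⟩
    · obtain ⟨c', Q', hm⟩ := exists_shuffMoveTo hch.1 hset
      obtain ⟨s, h1, h2⟩ := ShuffMoveTo.sw hs hch hm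
      have h3 := h1.bsum_eq hF
      obtain ⟨R, h4, h5, h6, -⟩ :=
        ih _ (by omega) (h1.state hs) (h1.mshape_eq ▸ hF) h2 rfl
      exact ⟨R, .step _ _ _ _ _ hm h4, Relation.ReflTransGen.head ⟨_, _, _, _, _, _, h1⟩ h5,
        by omega, fun _ => by omega⟩

theorem exists_shuffRel (hs : State Q) (hf : (mshape Q).Finite) : ∃ R, ShuffRel Q R := by
  obtain ⟨F, hF⟩ : ∃ F : Finset Cell, mshape Q ⊆ F := ⟨hf.toFinset, by simp⟩
  generalize hn : bsum F Q = n
  induction n using Nat.strong_induction_on generalizing Q with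
  | _ n ih =>
    by_cases hp : ∃ i j r, Pend True Q i j r
    · obtain ⟨i, j, r, h1, h2⟩ := exists_chosen hf hp
      obtain ⟨R, h3, h4, -, h5⟩ := exists_shuffTrack hs hF h2
      have h6 : ¬ ShuffSettled Q (i, j) := fun h =>
        (pend_true_iff.1 h1).2.2.elim (fun h' => h.1 h') (fun h' => h.2 h')
      have hm := Sw.steps_mshape h4
      obtain ⟨R', h7⟩ := ih _ (hn ▸ h5 h6) (Sw.steps_state h4 hs) (hm ▸ hf) (hm ▸ hF) rfl
      exact ⟨R', .step _ _ _ _ (shuffChosen_of_chosen h1 h2) h3 h7⟩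
    · refine ⟨Q, .done _ ?_⟩
      rintro ⟨i, j⟩ h
      obtain ⟨r, hr⟩ := h.1
      exact hp ⟨i, j, r, pend_true_iff.2 ⟨hr, h⟩⟩

end

end Groth

namespace Groth

/-! ### Biflagged and exquisite tableaux -/

section
variable {lam mu : Set Cell} {T Q E R : MixedTableau}

theorem HasSkewShape.convex (h : HasSkewShape T lam mu) : Convex T := by
  obtain ⟨h1, h2, h3, h4⟩ := h
  intro i j i' j' a b hc hc' hi hi' hj hj'
  change (i, j) ∈ mshape T at hc
  change (i', j') ∈ mshape T at hc'
  change (a, b) ∈ mshape T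
  rw [h4] at *
  have hp := h2.2.1 _ hc.1
  refine ⟨h2.2.2 _ _ _ _ hc'.1 (by simp at hp; omega) hi' (by simp at hp; omega) hj', fun h => ?_⟩
  exact hc.2 (h1.2.2 _ _ _ _ h hp.1 hi hp.2 hj)

theorem HasSkewShape.of_mshape_eq (h : HasSkewShape T lam mu) (he : mshape R = mshape T) :
    HasSkewShape R lam mu := ⟨h.1, h.2.1, h.2.2.1, he.trans h.2.2.2⟩

theorem isMixedTableau_of (h : IsMixedTableau T) (he : mshape R = mshape T) (hR : AFlag R) :
    IsMixedTableau R :=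
  ⟨he ▸ h.1, he ▸ h.2.1, fun ⟨_, _⟩ _ h' => (hR h').1⟩

/-- In a sorted tableau no `β` is weakly southwest of an `α`. -/
theorem ABSortedShape.not_le (h : ABSortedShape T lam mu) {i j i' j' : ℕ} {r s : ℤ}
    (hb : T (i, j) = some (.be s)) (ha : T (i', j') = some (.al r)) (hl : IsPartitionShape mu)
    (hi : i ≤ i') (hj : j ≤ j') : False := by
  obtain ⟨nu, h1, h2, h3, h4, h5⟩ := h
  have hb' : (i, j) ∈ mu \ nu := h5 ▸ ⟨s, hb⟩
  have ha' : (i', j') ∈ nu \ lam := h4 ▸ ⟨r, ha⟩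
  have := hl.2.1 _ hb'.1
  exact hb'.2 (h1.2.2 _ _ _ _ ha'.1 this.1 hi this.2 hj)

theorem ABSortedShape.strong (h : ABSortedShape T lam mu) (hs : HasSkewShape T lam mu)
    (hv : Valid T) : Strong T := by
  have hc : Convex T := HasSkewShape.convex hs
  constructor
  · intro i j i' j' r h1 h2 hi hj
    have hne := hc (ne_none_of_eq h1) (ne_none_of_eq h2) hi.le le_rfl le_rfl hj.le
    by_cases ha : ∃ q, T (i', j) = some (.al q)
    · obtain ⟨q, hq⟩ := ha
      have := (hv.al h1 hq hi.le le_rfl).2 rfl hi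
      have := (hv.al hq h2 le_rfl hj.le).1
      omega
    · obtain ⟨s, hs'⟩ := be_of_not_al hne ha
      exact ABSortedShape.not_le h hs' h2 hs.2.1 le_rfl hj.le
  · intro i j i' j' r h1 h2 hi hj
    have hne := hc (ne_none_of_eq h1) (ne_none_of_eq h2) le_rfl hi.le hj.le le_rfl
    by_cases ha : ∃ q, T (i, j') = some (.al q)
    · obtain ⟨q, hq⟩ := ha
      exact ABSortedShape.not_le h h1 hq hs.2.1 le_rfl hj.le
    · obtain ⟨s, hs'⟩ := be_of_not_al hne ha
      have := (hv.be h1 hs' le_rfl hj.le).2 rfl hj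
      have := (hv.be hs' h2 hi.le le_rfl).1
      omega

theorem ABSortedShape.bOrd (h : ABSortedShape T lam mu) (hs : HasSkewShape T lam mu) : BOrd T :=
  ⟨fun h1 h2 => (ABSortedShape.not_le h h1 h2 hs.2.1 le_rfl (by omega)).elim,
    fun h1 h2 => (ABSortedShape.not_le h h1 h2 hs.2.1 (by omega) le_rfl).elim⟩

theorem ABSortedShape.star_normal (h : ABSortedShape T lam mu) (hs : HasSkewShape T lam mu) :
    ∀ R, ¬ Sw True (star T) R := by
  rintro R ⟨i, j, i', j', r, s, h1⟩
  have hA := h1.cond.adj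
  unfold Adj at hA
  exact ABSortedShape.not_le h (star_al.1 h1.a) (star_be.1 h1.b) hs.2.1 (by omega) (by omega)

/-- A tableau without a `β` directly left of or below an `α` is sorted. -/
theorem abSortedShape_of (hs : HasSkewShape T lam mu)
    (hr : ∀ {i j : ℕ} {r s : ℤ}, T (i, j) = some (.be s) → T (i, j + 1) ≠ some (.al r))
    (hu : ∀ {i j : ℕ} {r s : ℤ}, T (i, j) = some (.be s) → T (i + 1, j) ≠ some (.al r)) :
    ABSortedShape T lam mu := by
  have hc : Convex T := HasSkewShape.convex hs
  have hrow : ∀ {i j j' : ℕ} {s : ℤ}, T (i, j) = some (.be s) → j ≤ j' → T (i, j') ≠ none →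
      ∃ s', T (i, j') = some (.be s') := by
    intro i j j' s h hle hne
    obtain ⟨n, rfl⟩ := Nat.exists_eq_add_of_le hle
    clear hle
    induction n with
    | zero => exact ⟨s, h⟩
    | succ n ih =>
      obtain ⟨s', h'⟩ := ih (hc (ne_none_of_eq h) hne le_rfl le_rfl (by omega) (by omega))
      exact be_of_not_al hne fun ⟨q, hq⟩ => hr h' hq
  have hcol : ∀ {i i' j : ℕ} {s : ℤ}, T (i, j) = some (.be s) → i ≤ i' → T (i', j) ≠ none →
      ∃ s', T (i', j) = some (.be s') := by
    intro i i' j s h hle hne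
    obtain ⟨n, rfl⟩ := Nat.exists_eq_add_of_le hle
    clear hle
    induction n with
    | zero => exact ⟨s, h⟩
    | succ n ih =>
      obtain ⟨s', h'⟩ := ih (hc (ne_none_of_eq h) hne (by omega) (by omega) le_rfl le_rfl)
      exact be_of_not_al hne fun ⟨q, hq⟩ => hu h' hq
  have hal : alphaCells T ⊆ mu \ lam := by
    rintro c ⟨k, hk⟩
    rw [← hs.2.2.2]
    exact ne_none_of_eq hk
  obtain ⟨h1, h2, h3, h4⟩ := hs
  have hsub : lam ∪ alphaCells T ⊆ mu := Set.union_subset h3 fun c hc => (hal hc).1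
  refine ⟨lam ∪ alphaCells T, ⟨h2.1.subset hsub, fun c hc => h2.2.1 _ (hsub hc), ?_⟩,
    Set.subset_union_left, hsub, ?_, ?_⟩
  · rintro i j i' j' (h | ⟨r, h⟩) p1 p2 p3 p4
    · exact Or.inl (h1.2.2 _ _ _ _ h p1 p2 p3 p4)
    · by_cases hl : (i', j') ∈ lam
      · exact Or.inl hl
      refine Or.inr ?_
      have hm : (i, j) ∈ mu := hsub (Or.inr ⟨r, h⟩)
      have hne : T (i', j') ≠ none := by
        change (i', j') ∈ mshape T
        rw [h4]
        exact ⟨h2.2.2 _ _ _ _ hm p1 p2 p3 p4, hl⟩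
      by_contra hb
      obtain ⟨s, hs⟩ := be_of_not_al hne hb
      obtain ⟨s', hs'⟩ := hrow hs p4 (hc hne (ne_none_of_eq h) le_rfl p2 p4 le_rfl)
      obtain ⟨s'', hs''⟩ := hcol hs' p2 (ne_none_of_eq h)
      rw [h] at hs''
      simp at hs''
  · ext c
    constructor
    · intro hc; exact ⟨Or.inr hc, (hal hc).2⟩
    · rintro ⟨h | h, h'⟩
      · exact absurd h h'
      · exact h
  · ext c
    constructor
    · rintro ⟨k, hk⟩
      have : c ∈ mshape T := ne_none_of_eq hk
      rw [h4] at this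
      refine ⟨this.1, ?_⟩
      rintro (h | ⟨q, h⟩)
      · exact this.2 h
      · rw [hk] at h; simp at h
    · rintro ⟨hm, hn⟩
      have : c ∈ mshape T := by rw [h4]; exact ⟨hm, fun h => hn (Or.inl h)⟩
      exact be_of_not_al this fun h => hn (Or.inr h)

theorem IsBFT.valid (h : IsBFT lam mu Q) : Valid Q := valid_of_strict h.2.2.1 h.2.2.2.1

theorem IsBFT.strong (h : IsBFT lam mu Q) : Strong Q :=
  ABSortedShape.strong h.2.2.2.2.1 h.2.1 (IsBFT.valid h)

theorem IsBFT.state (h : IsBFT lam mu Q) : State Q :=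
  (IsBFT.strong h).state (IsBFT.valid h) (HasSkewShape.convex h.2.1)

/-- The exquisite tableau of a biflagged tableau. -/
theorem IsBFT.exists_exq (h : IsBFT lam mu Q) :
    ∃ E, IsEXQ lam mu E ∧ Relation.ReflTransGen (Sw False) Q E ∧ ∀ R, ¬ Sw False E R := by
  have hst := IsBFT.state h
  obtain ⟨E, h1, h2⟩ := exists_normal False hst h.1.1
  refine ⟨E, ?_, h1, h2⟩
  have hE := Sw.steps_state h1 hst
  have hm := Sw.steps_mshape h1
  have hI := Sw.steps_bOrd h1 (ABSortedShape.bOrd h.2.2.2.2.1 h.2.1)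
  have hJ : AOrd E := fun {i j r} hp => by
    obtain ⟨T', hT⟩ := hE.progress (hm ▸ h.1.1) ⟨i, j, r, hp⟩
    exact h2 _ hT
  obtain ⟨R, hR⟩ := h.2.2.2.2.2.2.1
  have h3 := ShuffRel.steps hR hst
  have h4 : Relation.ReflTransGen (Sw True) E R :=
    Sw.reach_normal (Sw.steps_mono (fun _ => trivial) h1) h3.1 h3.2
  have hA : AFlag E := Sw.steps_aFlag h1 (isFMT_iff.1 h.2.2.2.2.2.1).1
  have hB : BFlag E := Sw.steps_bFlag_back h4 (isFMT_iff.1 (h.2.2.2.2.2.2.2 R hR)).2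
  exact ⟨isMixedTableau_of h.1 hm hA, HasSkewShape.of_mshape_eq h.2.1 hm,
    isFMT_iff.2 ⟨hA, hB⟩, tcs_of hE.v hI hJ⟩

/-- Every exquisite tableau comes from a biflagged tableau. -/
theorem IsEXQ.exists_bft (h : IsEXQ lam mu E) :
    ∃ Q, IsBFT lam mu Q ∧ Relation.ReflTransGen (Sw False) Q E ∧ ∀ R, ¬ Sw False E R := by
  obtain ⟨hM, hS, hF, hT⟩ := h
  have hc : Convex E := HasSkewShape.convex hS
  have hv := valid_of_tcs hT hc
  have hstr := strong_of_tcs hT hc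
  have hJ : AOrd E := aOrd_of_tcs hT hc
  obtain ⟨X, h1, h2⟩ := exists_normal True (hstr.star.state hv.star hc.star)
    (mshape_star_finite hM.1)
  have hX := Sw.steps_state h1 (hstr.star.state hv.star hc.star)
  have h3 := Sw.steps_star h1
  rw [star_star] at h3
  have h4 := Sw.steps_bOrd_back h3 (bOrd_of_tcs hT hc)
  have hm := (Sw.steps_mshape h4).symm
  have hQv := hX.v.star
  have hQs := HasSkewShape.of_mshape_eq hS hm
  have hXn : ∀ {i j r}, ¬ Pend True X i j r := fun {i j r} hp => by
    obtain ⟨T', hT⟩ := hX.progress (by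
      rw [Sw.steps_mshape h1]; exact mshape_star_finite hM.1) ⟨i, j, r, hp⟩
    exact h2 _ hT
  have hQab : ABSortedShape (star X) lam mu := by
    apply abSortedShape_of hQs
    · intro i j r s g1 g2
      exact hXn (Pend.up (star_be.1 g1) (star_al.1 g2) (Or.inl trivial))
    · intro i j r s g1 g2
      exact hXn (Pend.rt (star_be.1 g1) (star_al.1 g2) (Or.inl trivial))
  have hQst : State (star X) := (ABSortedShape.strong hQab hQs hQv).state hQv (HasSkewShape.convex hQs)
  have hfl := Sw.steps_flags_back h4 (isFMT_iff.1 hF)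
  have hQM := isMixedTableau_of hM hm hfl.1
  refine ⟨star X, ⟨hQM, hQs, hQv.alphaColumnStrict, hQv.betaRowStrict, hQab,
    isFMT_iff.2 hfl, exists_shuffRel hQst hQM.1, fun R hR => ?_⟩, h4, ?_⟩
  · have h5 := ShuffRel.steps hR hQst
    have h6 : Relation.ReflTransGen (Sw True) E R := Sw.reach_normal h3 h5.1 h5.2
    exact isFMT_iff.2 (Sw.steps_flags h6 hJ (isFMT_iff.1 hF))
  · intro R hR
    obtain ⟨i, j, r, hp⟩ := hR.pend
    exact hJ hp

/-- The exquisite tableau obtained from a biflagged tableau by resolving out-of-order pairs. -/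
noncomputable def toExq (Q : MixedTableau) : MixedTableau :=
  if h : ∃ E, Relation.ReflTransGen (Sw False) Q E ∧ ∀ R, ¬ Sw False E R then h.choose else Q

theorem toExq_eq (h : Relation.ReflTransGen (Sw False) Q E) (hn : ∀ R, ¬ Sw False E R) :
    toExq Q = E := by
  have hex : ∃ E, Relation.ReflTransGen (Sw False) Q E ∧ ∀ R, ¬ Sw False E R := ⟨E, h, hn⟩
  rw [toExq, dif_pos hex]
  exact Sw.normal_unique hex.choose_spec.1 h hex.choose_spec.2 hn

theorem toExq_injOn {Q' : MixedTableau} {mu' : Set Cell} (h : IsBFT lam mu Q)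
    (h' : IsBFT lam mu' Q') (he : toExq Q = toExq Q') : Q = Q' := by
  obtain ⟨E, h1, h2, h3⟩ := IsBFT.exists_exq h
  obtain ⟨E', h1', h2', h3'⟩ := IsBFT.exists_exq h'
  rw [toExq_eq h2 h3, toExq_eq h2' h3'] at he
  subst he
  have g := Sw.steps_star (Sw.steps_mono (fun _ => trivial) h2)
  have g' := Sw.steps_star (Sw.steps_mono (fun _ => trivial) h2')
  have := Sw.normal_unique g g' (ABSortedShape.star_normal h.2.2.2.2.1 h.2.1)
    (ABSortedShape.star_normal h'.2.2.2.2.1 h'.2.1)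
  rw [← star_star Q, this, star_star]

end

theorem bijOn_bft_exq (lam : Set Cell) (a b : ℤ → ℕ) (xv : ℕ → ℕ) :
    Set.BijOn (fun p : Set Cell × HVTab × MixedTableau => (p.1, p.2.1, toExq p.2.2))
      (GrothBFT lam a b xv) (GrothEXQ lam a b xv) := by
  refine ⟨?_, ?_, ?_⟩
  · rintro ⟨mu, P, Q⟩ ⟨h1, h2, h3, h4, h5, h6, h7, h8⟩
    obtain ⟨E, g1, g2, g3⟩ := IsBFT.exists_exq h5
    refine ⟨h1, h2, h3, h4, ?_, h6, fun k => ?_, fun k => ?_⟩ <;>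
      simp only [toExq_eq g2 g3]
    · exact g1
    · rw [Sw.steps_mcount g2]; exact h7 k
    · rw [Sw.steps_mcount g2]; exact h8 k
  · rintro ⟨mu, P, Q⟩ h ⟨mu', P', Q'⟩ h' he
    simp only [Prod.mk.injEq] at he ⊢
    exact ⟨he.1, he.2.1, toExq_injOn h.2.2.2.2.1 h'.2.2.2.2.1 he.2.2⟩
  · rintro ⟨mu, P, E⟩ ⟨h1, h2, h3, h4, h5, h6, h7, h8⟩
    obtain ⟨Q, g1, g2, g3⟩ := IsEXQ.exists_bft h5
    refine ⟨(mu, P, Q), ⟨h1, h2, h3, h4, g1, h6, fun k => ?_, fun k => ?_⟩, ?_⟩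
    · rw [← Sw.steps_mcount g2]; exact h7 k
    · rw [← Sw.steps_mcount g2]; exact h8 k
    · simp only [toExq_eq g2 g3]

theorem bft_finite_iff (lam : Set Cell) (a b : ℤ → ℕ) (xv : ℕ → ℕ) :
    (GrothBFT lam a b xv).Finite ↔ (GrothEXQ lam a b xv).Finite :=
  (bijOn_bft_exq lam a b xv).finite_iff_finite

theorem exq_ncard_eq_bft (lam : Set Cell) (a b : ℤ → ℕ) (xv : ℕ → ℕ) :
    (GrothEXQ lam a b xv).ncard = (GrothBFT lam a b xv).ncard := by
  have h := bijOn_bft_exq lam a b xv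
  rw [← h.image_eq, h.injOn.ncard_image]

end Groth

namespace Groth

/-! ### Generating functions of weighted sets -/

section GF
variable {σ X Y ι : Type*}

/-- The weighted set `(S, w)` has finite fibres, and `g` is its generating function. -/
structure HasGF (S : Set X) (w : X → σ →₀ ℕ) (g : MvPowerSeries σ ℤ) : Prop where
  fin : ∀ m, {x | x ∈ S ∧ w x = m}.Finite
  coeff : ∀ m, MvPowerSeries.coeff m g = ({x | x ∈ S ∧ w x = m}.ncard : ℤ)

variable {S : Set X} {S' : Set Y} {w : X → σ →₀ ℕ} {w' : Y → σ →₀ ℕ} {g g' : MvPowerSeries σ ℤ}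

theorem HasGF.unique (h : HasGF S w g) (h' : HasGF S w g') : g = g' := by
  ext m
  rw [h.coeff, h'.coeff]

theorem HasGF.of_bijOn {f : X → Y} (h : HasGF S' w' g) (hf : Set.BijOn f S S')
    (hw : ∀ x ∈ S, w' (f x) = w x) : HasGF S w g := by
  have key : ∀ m, f '' {x | x ∈ S ∧ w x = m} = {y | y ∈ S' ∧ w' y = m} := by
    intro m
    ext y
    constructor
    · rintro ⟨x, ⟨h1, h2⟩, rfl⟩
      exact ⟨hf.mapsTo h1, (hw x h1).trans h2⟩
    · rintro ⟨h1, h2⟩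
      obtain ⟨x, h3, rfl⟩ := hf.surjOn h1
      exact ⟨x, ⟨h3, (hw x h3).symm.trans h2⟩, rfl⟩
  have hinj : ∀ m, Set.InjOn f {x | x ∈ S ∧ w x = m} :=
    fun m => hf.injOn.mono fun x hx => hx.1
  refine ⟨fun m => ?_, fun m => ?_⟩
  · exact Set.Finite.of_finite_image (by rw [key]; exact h.fin m) (hinj m)
  · rw [h.coeff, ← key, (hinj m).ncard_image]

theorem HasGF.singleton (x : X) (w : X → σ →₀ ℕ) :
    HasGF {x} w (MvPowerSeries.monomial (w x) 1) := by
  have : ∀ m, {y | y ∈ ({x} : Set X) ∧ w y = m} = if m = w x then {x} else ∅ := by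
    intro m
    ext y
    by_cases hm : m = w x
    · simp only [hm, if_true, Set.mem_singleton_iff]
      constructor
      · exact fun h => h.1
      · rintro rfl; exact ⟨rfl, rfl⟩
    · simp only [hm, if_false, Set.mem_empty_iff_false, iff_false]
      rintro ⟨h1, h2⟩
      rw [Set.mem_singleton_iff] at h1
      subst h1
      exact hm h2.symm
  refine ⟨fun m => ?_, fun m => ?_⟩
  · rw [this]; split_ifs <;> simp
  · rw [this, MvPowerSeries.coeff_monomial]
    split_ifs <;> simp

theorem HasGF.empty (w : X → σ →₀ ℕ) : HasGF (∅ : Set X) w 0 :=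
  ⟨fun m => by simp, fun m => by simp⟩

theorem HasGF.prod (h : HasGF S w g) (h' : HasGF S' w' g') :
    HasGF (S ×ˢ S') (fun p => w p.1 + w' p.2) (g * g') := by
  have key : ∀ m, {p : X × Y | p ∈ S ×ˢ S' ∧ w p.1 + w' p.2 = m} =
      ⋃ q ∈ Finset.HasAntidiagonal.antidiagonal m, {x | x ∈ S ∧ w x = q.1} ×ˢ {y | y ∈ S' ∧ w' y = q.2} := by
    intro m
    ext ⟨x, y⟩
    simp only [Set.mem_prod, Set.mem_iUnion, Finset.HasAntidiagonal.mem_antidiagonal, exists_prop, Prod.exists]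
    constructor
    · rintro ⟨⟨h1, h2⟩, h3⟩
      exact ⟨w x, w' y, h3, ⟨h1, rfl⟩, ⟨h2, rfl⟩⟩
    · rintro ⟨q, r, h3, ⟨h1, h4⟩, ⟨h2, h5⟩⟩
      refine ⟨⟨h1, h2⟩, ?_⟩
      change w x = q at h4
      change w' y = r at h5
      change w x + w' y = m
      rw [h4, h5, h3]
  have hfin : ∀ q : (σ →₀ ℕ) × (σ →₀ ℕ),
      ({x | x ∈ S ∧ w x = q.1} ×ˢ {y | y ∈ S' ∧ w' y = q.2}).Finite :=
    fun q => (h.fin _).prod (h'.fin _)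
  refine ⟨fun m => ?_, fun m => ?_⟩
  · rw [key]
    exact Set.Finite.biUnion (Finset.finite_toSet _) fun q _ => hfin q
  · rw [key, MvPowerSeries.coeff_mul]
    have := Finset.card_biUnion (s := Finset.HasAntidiagonal.antidiagonal m) (t := fun q => (hfin q).toFinset) (by
      intro q _ r _ hqr
      rw [Function.onFun, Finset.disjoint_left]
      rintro ⟨x, y⟩ h1 h2
      simp only [Set.Finite.mem_toFinset, Set.mem_prod] at h1 h2
      exact hqr (Prod.ext (h1.1.2.symm.trans h2.1.2) (h1.2.2.symm.trans h2.2.2)))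
    have h2 : (⋃ q ∈ Finset.HasAntidiagonal.antidiagonal m,
        {x | x ∈ S ∧ w x = q.1} ×ˢ {y | y ∈ S' ∧ w' y = q.2}) =
        ((Finset.HasAntidiagonal.antidiagonal m).biUnion (fun q => (hfin q).toFinset) : Finset (X × Y)) := by
      ext p; simp
    rw [h2, Set.ncard_coe_finset, this]
    push_cast
    refine Finset.sum_congr rfl fun q _ => ?_
    rw [h.coeff, h'.coeff, ← Set.ncard_eq_toFinset_card _ (hfin q), Set.ncard_prod]
    push_cast; rfl

theorem HasGF.fiberwise (p : X → ι) (I : Finset ι) (G : ι → MvPowerSeries σ ℤ)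
    (hp : ∀ x ∈ S, p x ∈ I) (h : ∀ i ∈ I, HasGF {x | x ∈ S ∧ p x = i} w (G i)) :
    HasGF S w (∑ i ∈ I, G i) := by
  have key : ∀ m, {x | x ∈ S ∧ w x = m} =
      ⋃ i ∈ I, {x | x ∈ {x | x ∈ S ∧ p x = i} ∧ w x = m} := by
    intro m
    ext x
    simp only [Set.mem_iUnion, exists_prop]
    constructor
    · rintro ⟨h1, h2⟩
      exact ⟨p x, hp x h1, ⟨h1, rfl⟩, h2⟩
    · rintro ⟨i, -, ⟨h1, -⟩, h2⟩
      exact ⟨h1, h2⟩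
  have hf : ∀ m, ∀ i ∈ I, {x | x ∈ {x | x ∈ S ∧ p x = i} ∧ w x = m}.Finite :=
    fun m i hi => (h i hi).fin m
  refine ⟨fun m => ?_, fun m => ?_⟩
  · rw [key]
    exact Set.Finite.biUnion (Finset.finite_toSet _) (hf m)
  · have hfin : {x | x ∈ S ∧ w x = m}.Finite := by
      rw [key]
      exact Set.Finite.biUnion (Finset.finite_toSet _) (hf m)
    rw [map_sum, Set.ncard_eq_toFinset_card _ hfin,
      Finset.card_eq_sum_card_fiberwise (f := p) (t := I)
        (fun x hx => hp x ((hfin.mem_toFinset.1 hx).1))]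
    push_cast
    refine Finset.sum_congr rfl fun i hi => ?_
    rw [(h i hi).coeff, Set.ncard_eq_toFinset_card _ (hf m i hi)]
    congr 2
    ext x
    simp only [Set.Finite.mem_toFinset, Finset.mem_filter]
    constructor
    · rintro ⟨⟨h1, h2⟩, h3⟩; exact ⟨⟨h1, h3⟩, h2⟩
    · rintro ⟨⟨h1, h2⟩, h3⟩; exact ⟨⟨h1, h3⟩, h2⟩

theorem HasGF.shift (h : HasGF S w g) (s : σ →₀ ℕ) :
    HasGF S (fun x => s + w x) (MvPowerSeries.monomial s 1 * g) := by
  have := (HasGF.singleton () (fun _ => s)).prod h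
  refine this.of_bijOn (f := fun x => ((), x)) ⟨?_, ?_, ?_⟩ (fun _ _ => rfl)
  · intro x hx; exact ⟨rfl, hx⟩
  · intro x _ y _ hxy; exact (Prod.mk.inj hxy).2
  · rintro ⟨_, x⟩ hx; exact ⟨x, hx.2, rfl⟩

theorem HasGF.finset (I : Finset X) (w : X → σ →₀ ℕ) :
    HasGF (I : Set X) w (∑ x ∈ I, MvPowerSeries.monomial (w x) 1) := by
  refine HasGF.fiberwise id I _ (fun x hx => hx) fun x hx => ?_
  have : {y | y ∈ (I : Set X) ∧ id y = x} = {x} := by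
    ext y
    constructor
    · exact fun h => h.2
    · rintro rfl; exact ⟨hx, rfl⟩
  rw [this]
  exact HasGF.singleton x w

/-- The geometric series in a monomial. -/
noncomputable def geo (s : σ →₀ ℕ) : MvPowerSeries σ ℤ :=
  fun m => if ∃ k : ℕ, k • s = m then 1 else 0

theorem hasGF_geo {s : σ →₀ ℕ} (hs : s ≠ 0) :
    HasGF (Set.univ : Set ℕ) (fun k => k • s) (geo s) := by
  have hinj : ∀ k l : ℕ, k • s = l • s → k = l := by
    intro k l h
    obtain ⟨i, hi⟩ := Finsupp.ne_iff.1 hs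
    have := DFunLike.congr_fun h i
    simp only [Finsupp.smul_apply, smul_eq_mul] at this
    exact Nat.eq_of_mul_eq_mul_right (Nat.pos_of_ne_zero hi) this
  have key : ∀ m, {k : ℕ | k ∈ Set.univ ∧ k • s = m}.Subsingleton :=
    fun m k hk l hl => hinj k l (hk.2.trans hl.2.symm)
  refine ⟨fun m => (key m).finite, fun m => ?_⟩
  change (if ∃ k : ℕ, k • s = m then (1 : ℤ) else 0) = _
  split_ifs with h
  · obtain ⟨k, hk⟩ := h
    rw [show {k : ℕ | k ∈ Set.univ ∧ k • s = m} = {k} from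
      (key m).eq_singleton_of_mem ⟨trivial, hk⟩]
    simp
  · rw [show {k : ℕ | k ∈ Set.univ ∧ k • s = m} = ∅ from by
      ext k; simpa using fun hk => h ⟨k, hk⟩]
    simp

theorem one_sub_mul_geo {s : σ →₀ ℕ} (hs : s ≠ 0) :
    (1 - MvPowerSeries.monomial s 1) * geo s = 1 := by
  have h1 := hasGF_geo hs
  have h0 : HasGF {k : ℕ | k ∈ Set.univ ∧ min k 1 = 0} (fun k => k • s)
      (MvPowerSeries.monomial (0 : σ →₀ ℕ) 1) := by
    have := HasGF.singleton (0 : ℕ) (fun k : ℕ => k • s)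
    rw [zero_smul] at this
    convert this using 1
    ext k; simp
  have h2 : HasGF {k : ℕ | k ∈ Set.univ ∧ min k 1 = 1} (fun k => k • s)
      (MvPowerSeries.monomial s 1 * geo s) := by
    refine (h1.shift s).of_bijOn (f := fun k => k - 1) ⟨fun _ _ => trivial, ?_, ?_⟩ ?_
    · rintro k ⟨-, hk⟩ l ⟨-, hl⟩ h
      simp only at h; omega
    · intro k _
      exact ⟨k + 1, ⟨trivial, by omega⟩, by simp⟩
    · rintro k ⟨-, hk⟩
      have : k = (k - 1) + 1 := by omega
      conv_rhs => rw [this]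
      rw [add_smul, one_smul, add_comm]
  have := h1.unique (HasGF.fiberwise (fun k => min k 1) {0, 1}
    (fun i => if i = 0 then MvPowerSeries.monomial (0 : σ →₀ ℕ) 1
      else MvPowerSeries.monomial s 1 * geo s)
    (fun k _ => by simp; omega) (by
      intro i hi
      simp only [Finset.mem_insert, Finset.mem_singleton] at hi
      rcases hi with rfl | rfl
      · simpa using h0
      · simpa using h2))
  rw [Finset.sum_pair (by norm_num)] at this
  simp only [if_true, one_ne_zero, if_false] at this
  rw [sub_mul, one_mul, sub_eq_iff_eq_add]
  exact this

/-- Functions on an index set, supported in `F`, with prescribed ranges. -/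
theorem HasGF.pi {M : Type*} [Zero M] (F : Finset ι) (A : ι → Set M) (w : ι → M → σ →₀ ℕ)
    (G : ι → MvPowerSeries σ ℤ) (h : ∀ i ∈ F, HasGF (A i) (w i) (G i)) :
    HasGF {f : ι → M | (∀ i ∈ F, f i ∈ A i) ∧ ∀ i, i ∉ F → f i = 0}
      (fun f => ∑ i ∈ F, w i (f i)) (∏ i ∈ F, G i) := by
  induction F using Finset.induction_on with
  | empty =>
    have := HasGF.singleton (0 : ι → M) (fun _ => (0 : σ →₀ ℕ))
    rw [Finset.prod_empty]
    rw [MvPowerSeries.monomial_zero_one] at this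
    simp only [Finset.sum_empty]
    convert this using 1
    ext f
    simp [funext_iff]
  | insert a F ha ih =>
    rw [Finset.prod_insert ha]
    have ih' := ih fun i hi => h i (Finset.mem_insert_of_mem hi)
    refine ((h a (Finset.mem_insert_self _ _)).prod ih').of_bijOn
      (f := fun f => (f a, Function.update f a 0)) ⟨?_, ?_, ?_⟩ ?_
    · rintro f ⟨h1, h2⟩
      refine ⟨h1 a (Finset.mem_insert_self _ _), fun i hi => ?_, fun i hi => ?_⟩
      · have : i ≠ a := fun e => ha (e ▸ hi)
        simpa [this] using h1 i (Finset.mem_insert_of_mem hi)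
      · by_cases hia : i = a
        · simp [hia]
        · simpa [hia] using h2 i (by simp [hia, hi])
    · rintro f - f' - he
      obtain ⟨e1, e2⟩ := Prod.mk.inj he
      funext i
      by_cases hia : i = a
      · rw [hia]; exact e1
      · have := congr_fun e2 i
        simpa [hia] using this
    · rintro ⟨m, f⟩ ⟨hm, h1, h2⟩
      refine ⟨Function.update f a m, ⟨fun i hi => ?_, fun i hi => ?_⟩, ?_⟩
      · by_cases hia : i = a
        · subst hia; simpa using hm
        · simpa [hia] using h1 i (by simpa [hia] using hi)
      · have : i ≠ a := fun e => hi (e ▸ Finset.mem_insert_self _ _)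
        simpa [this] using h2 i fun hi' => hi (Finset.mem_insert_of_mem hi')
      · have := h2 a ha
        simp only at this
        simp [Function.update_eq_self_iff, this]
    · rintro f -
      rw [Finset.sum_insert ha]
      congr 1
      refine Finset.sum_congr rfl fun i hi => ?_
      have : i ≠ a := fun e => ha (e ▸ hi)
      simp [this]

end GF

end Groth

namespace Groth

/-! ### Bialternants -/

section Box

/-- Extend a tuple by zero, reading it in reverse order. -/
def rext (n : ℕ) (f : Fin n → ℕ) : ℕ → ℕ :=
  fun i => if h : i < n then f ⟨n - 1 - i, by omega⟩ else 0

/-- Functions between `lo` and `hi` on `{0, …, n - 1}` and zero elsewhere. -/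
noncomputable def boxF (n : ℕ) (lo hi : ℕ → ℕ) : Finset (ℕ → ℕ) :=
  (Fintype.piFinset fun r : Fin n => Finset.Icc (lo (n - 1 - r)) (hi (n - 1 - r))).image (rext n)

theorem rext_apply {n : ℕ} (f : Fin n → ℕ) (r : Fin n) : rext n f (n - 1 - r) = f r := by
  have h : n - 1 - (r : ℕ) < n := by omega
  rw [rext, dif_pos h]
  congr 1
  ext
  simp only
  omega

theorem rext_injective (n : ℕ) : Function.Injective (rext n) := by
  intro f g h
  funext r
  rw [← rext_apply f r, h, rext_apply]

theorem mem_boxF {n : ℕ} {lo hi ν : ℕ → ℕ} :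
    ν ∈ boxF n lo hi ↔ (∀ i < n, lo i ≤ ν i ∧ ν i ≤ hi i) ∧ ∀ i, n ≤ i → ν i = 0 := by
  simp only [boxF, Finset.mem_image, Fintype.mem_piFinset, Finset.mem_Icc]
  constructor
  · rintro ⟨f, hf, rfl⟩
    refine ⟨fun i hi => ?_, fun i hi => ?_⟩
    · have h := hf ⟨n - 1 - i, by omega⟩
      have e : n - 1 - (n - 1 - i) = i := by omega
      simp only [e] at h
      rw [rext, dif_pos hi]
      exact h
    · rw [rext, dif_neg (by omega)]
  · rintro ⟨h1, h2⟩
    refine ⟨fun r => ν (n - 1 - r), fun r => h1 _ (by omega), ?_⟩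
    funext i
    by_cases hi : i < n
    · rw [rext, dif_pos hi]
      congr 1
      simp only
      omega
    · rw [rext, dif_neg hi, h2 i (by omega)]

variable {R : Type*} [CommRing R]

theorem sum_boxF (n : ℕ) (lo hi : ℕ → ℕ) (F : (ℕ → ℕ) → R) :
    ∑ ν ∈ boxF n lo hi, F ν =
      ∑ f ∈ Fintype.piFinset fun r : Fin n => Finset.Icc (lo (n - 1 - r)) (hi (n - 1 - r)),
        F (rext n f) := by
  rw [boxF, Finset.sum_image]
  exact fun _ _ _ _ h => rext_injective n h

theorem prod_rev (n : ℕ) (F : ℕ → R) : ∏ r : Fin n, F (n - 1 - r) = ∏ i ∈ Finset.range n, F i := by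
  rw [← Finset.prod_range_reflect, Finset.prod_range]

/-- Multilinear expansion of a determinant along all rows. -/
theorem det_expand (n : ℕ) (lo hi : ℕ → ℕ) (c : ℕ → ℕ → R) (φ : ℕ → ℕ → Fin n → R) :
    (Matrix.of fun (r j : Fin n) => ∑ m ∈ Finset.Icc (lo (n - 1 - r)) (hi (n - 1 - r)),
        c (n - 1 - r) m * φ (n - 1 - r) m j).det =
      ∑ ν ∈ boxF n lo hi, (∏ i ∈ Finset.range n, c i (ν i)) *
        (Matrix.of fun (r j : Fin n) => φ (n - 1 - r) (ν (n - 1 - r)) j).det := by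
  have h := MultilinearMap.map_sum_finset
    (Matrix.detRowAlternating (n := Fin n) (R := R)).toMultilinearMap
    (fun (r : Fin n) (m : ℕ) => c (n - 1 - r) m • φ (n - 1 - r) m)
    (fun r => Finset.Icc (lo (n - 1 - r)) (hi (n - 1 - r)))
  rw [sum_boxF]
  have e1 : (Matrix.of fun (r j : Fin n) => ∑ m ∈ Finset.Icc (lo (n - 1 - r)) (hi (n - 1 - r)),
        c (n - 1 - r) m * φ (n - 1 - r) m j) =
      (fun r : Fin n => ∑ m ∈ Finset.Icc (lo (n - 1 - r)) (hi (n - 1 - r)),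
        c (n - 1 - r) m • φ (n - 1 - r) m) := by
    ext r j
    simp [Finset.sum_apply]
  rw [e1]
  refine h.trans (Finset.sum_congr rfl fun f _ => ?_)
  rw [MultilinearMap.map_smul_univ]
  rw [← prod_rev n (fun i => c i (rext n f i)), smul_eq_mul]
  simp only [rext_apply]
  rfl

end Box

/-- Commuting variables, together with inverses of `1 - α_l x_v` and `1 + β_l x_v`. -/
structure Params (R : Type*) [CommRing R] where
  A : ℕ → R
  B : ℕ → R
  x : ℕ → R
  I : ℕ → ℕ → R
  J : ℕ → ℕ → R
  hI : ∀ l v, (1 - A l * x v) * I l v = 1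
  hJ : ∀ l v, (1 + B l * x v) * J l v = 1
  hA : A 0 = 0
  hB : B 0 = 0

namespace Params
variable {R : Type*} [CommRing R] (P : Params R)

/-- `x_v^m / ∏_{l ≤ m} (1 - α_l x_v)`. -/
def psi (v m : ℕ) : R := P.x v ^ m * ∏ l ∈ Finset.range m, P.I (l + 1) v

/-- `∏_{l ≤ m} (1 + β_l x_v)`. -/
def nn (v m : ℕ) : R := ∏ l ∈ Finset.range m, (1 + P.B (l + 1) * P.x v)

/-- The weight of the largest letter `v` in row `i`, when this row has length `b`, the next row has
length `a` and the smaller letters occupy `m` cells. -/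
def W (v i a b m : ℕ) : R :=
  P.x v ^ (b - m) * (∏ l ∈ Finset.Ico m b, P.I (l + 1) v) *
    if a < m then (1 + P.B (i + 1) * P.x v) * P.I m v else 1

/-- The generating function of hook-valued tableaux with letters at most `n`, recursively. -/
noncomputable def G : ℕ → (ℕ → ℕ) → R
  | 0, _ => 1
  | n + 1, lam => ∑ ν ∈ boxF n (fun i => lam (i + 1)) lam,
      (∏ i ∈ Finset.range (n + 1), P.W (n + 1) i (lam (i + 1)) (lam i) (ν i)) * G n ν

/-- The Vandermonde product. -/
def delta : ℕ → R
  | 0 => 1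
  | n + 1 => (∏ j : Fin n, (P.x (n - j) - P.x (n + 1))) * delta n

/-- The numerator matrix of the bialternant formula. -/
def gmat (n : ℕ) (lam : ℕ → ℕ) : Matrix (Fin n) (Fin n) R :=
  Matrix.of fun r j => P.x (n - j) ^ (r : ℕ) * P.nn (n - j) (n - 1 - r) *
    P.psi (n - j) (lam (n - 1 - r))

theorem W_succ {v i a b m : ℕ} (h : m ≤ b) :
    P.W v i a (b + 1) m = P.x v * P.I (b + 1) v * P.W v i a b m := by
  unfold W
  rw [Nat.sub_add_comm h, pow_succ, Finset.prod_Ico_succ_top h]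
  ring

theorem W_self_lt {v i a b : ℕ} (h : a < b) :
    P.W v i a b b = (1 + P.B (i + 1) * P.x v) * P.I b v := by
  simp [W, h]

/-- The key one-row identity. -/
theorem row_identity (u v i a b : ℕ) (h : a ≤ b) :
    (1 + P.B (i + 1) * P.x v) * (P.x u * P.psi u b) -
      P.x v * (1 + P.B (i + 1) * P.x u) *
        (P.x v ^ (b - a) * ∏ l ∈ Finset.Ico a b, P.I (l + 1) v) * P.psi u a =
      (P.x u - P.x v) * ∑ m ∈ Finset.Icc a b, P.W v i a b m * P.psi u m := by
  induction b, h using Nat.le_induction with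
  | base => simp [W]; ring
  | succ b h ih =>
    rw [← Finset.insert_Icc_right_eq_Icc_add_one (by omega), Finset.sum_insert (by simp)]
    rw [Finset.sum_congr rfl (fun m hm => by
      rw [P.W_succ (Finset.mem_Icc.1 hm).2, mul_assoc]), ← Finset.mul_sum, P.W_self_lt (by omega)]
    have h1 : P.psi u (b + 1) = P.x u * P.I (b + 1) u * P.psi u b := by
      unfold psi
      rw [pow_succ, Finset.prod_range_succ]; ring
    rw [Nat.sub_add_comm h, pow_succ, Finset.prod_Ico_succ_top h, h1]
    have e1 := P.hI (b + 1) u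
    have e2 := P.hI (b + 1) v
    linear_combination (P.x v * P.I (b + 1) v) * ih +
      (-(1 + P.B (i + 1) * P.x v) * P.x u * P.psi u b * P.I (b + 1) u * P.x u) * e2
      + ((1 + P.B (i + 1) * P.x v) * P.x u * P.psi u b * P.I (b + 1) v * P.x v) * e1

theorem prod_J_mul_nn (v n : ℕ) : (∏ i ∈ Finset.range n, P.J (i + 1) v) * P.nn v n = 1 := by
  rw [nn, ← Finset.prod_mul_distrib]
  exact Finset.prod_eq_one fun l _ => by rw [mul_comm, P.hJ]

theorem det_gmat (n : ℕ) (lam : ℕ → ℕ) (hl : Antitone lam) (h0 : ∀ i, n ≤ i → lam i = 0) :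
    (P.gmat n lam).det = P.delta n * P.G n lam := by
  induction n generalizing lam with
  | zero => simp [delta, G]
  | succ n ih =>
    set v := n + 1 with hv
    let c : ℕ → R := fun i => P.x v * (P.x v ^ (lam i - lam (i + 1)) *
      ∏ l ∈ Finset.Ico (lam (i + 1)) (lam i), P.I (l + 1) v) * P.J (i + 1) v
    let M : Matrix (Fin (n + 1)) (Fin (n + 1)) R := Matrix.of fun r j =>
      Fin.cases (P.gmat (n + 1) lam 0 j) (fun r : Fin n => P.J (n - 1 - r + 1) v *
        ((P.x (n + 1 - j) - P.x v) * ∑ m ∈ Finset.Icc (lam (n - 1 - r + 1)) (lam (n - 1 - r)),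
          P.W v (n - 1 - r) (lam (n - 1 - r + 1)) (lam (n - 1 - r)) m *
            (P.x (n + 1 - j) ^ (r : ℕ) * P.nn (n + 1 - j) (n - 1 - r) * P.psi (n + 1 - j) m))) r
    have h1 : (P.gmat (n + 1) lam).det = M.det := by
      refine Matrix.det_eq_of_forall_row_eq_smul_add_pred (fun r : Fin n => c (n - 1 - r))
        (fun j => rfl) fun r j => ?_
      obtain ⟨i, hi⟩ : ∃ i, n - 1 - (r : ℕ) = i := ⟨_, rfl⟩
      have e1 : n + 1 - 1 - ((r.succ : Fin (n + 1)) : ℕ) = i := by simp; omega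
      have e2 : n + 1 - 1 - ((r.castSucc : Fin (n + 1)) : ℕ) = i + 1 := by
        have := r.2; simp; omega
      have hid := P.row_identity (n + 1 - j) v i (lam (i + 1)) (lam i) (hl (Nat.le_succ i))
      have hs : ∑ m ∈ Finset.Icc (lam (i + 1)) (lam i), P.W v i (lam (i + 1)) (lam i) m *
            (P.x (n + 1 - j) ^ (r : ℕ) * P.nn (n + 1 - j) i * P.psi (n + 1 - j) m) =
          P.x (n + 1 - j) ^ (r : ℕ) * P.nn (n + 1 - j) i *
            ∑ m ∈ Finset.Icc (lam (i + 1)) (lam i), P.W v i (lam (i + 1)) (lam i) m *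
              P.psi (n + 1 - j) m := by
        rw [Finset.mul_sum]
        exact Finset.sum_congr rfl fun m _ => by ring
      have hM : M r.succ j = P.J (i + 1) v * ((P.x (n + 1 - j) - P.x v) *
          (P.x (n + 1 - j) ^ (r : ℕ) * P.nn (n + 1 - j) i *
            ∑ m ∈ Finset.Icc (lam (i + 1)) (lam i), P.W v i (lam (i + 1)) (lam i) m *
              P.psi (n + 1 - j) m)) := by
        rw [← hs, ← hi]; rfl
      have hN : P.nn (n + 1 - j) (i + 1) =
          P.nn (n + 1 - j) i * (1 + P.B (i + 1) * P.x (n + 1 - j)) := by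
        rw [nn, Finset.prod_range_succ]; rfl
      have hJ := P.hJ (i + 1) v
      rw [hM, hi]
      simp only [gmat, Matrix.of_apply]
      rw [e1, e2, hN]
      simp only [c, Fin.val_succ, Fin.val_castSucc]
      rw [pow_succ]
      linear_combination (-P.x (n + 1 - j) ^ (r : ℕ) * P.x (n + 1 - j) * P.nn (n + 1 - j) i *
        P.psi (n + 1 - j) (lam i)) * hJ +
        (P.J (i + 1) v * P.x (n + 1 - j) ^ (r : ℕ) * P.nn (n + 1 - j) i) * hid
    have h2 : ∀ r : Fin n, M r.succ 0 = 0 := by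
      intro r
      simp [M, hv]
    have h3 : M 0 0 = P.nn v n * P.psi v (lam n) := by
      simp [M, gmat, hv]
    have h4 : (M.submatrix Fin.succ Fin.succ).det = (∏ j : Fin n, (P.x (n - j) - P.x v)) *
        ∑ ν ∈ boxF n (fun i => lam (i + 1)) lam, (∏ i ∈ Finset.range n,
          (P.J (i + 1) v * P.W v i (lam (i + 1)) (lam i) (ν i))) * (P.gmat n ν).det := by
      have := det_expand n (fun i => lam (i + 1)) lam
        (fun i m => P.J (i + 1) v * P.W v i (lam (i + 1)) (lam i) m)
        (fun i m (j : Fin n) => P.x (n - j) ^ (n - 1 - i) * P.nn (n - j) i * P.psi (n - j) m)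
      have e : ∀ ν : ℕ → ℕ, (Matrix.of fun (r j : Fin n) => P.x (n - j) ^ (n - 1 - (n - 1 - (r : ℕ)))
          * P.nn (n - j) (n - 1 - r) * P.psi (n - j) (ν (n - 1 - r))) = P.gmat n ν := by
        intro ν
        ext r j
        have : n - 1 - (n - 1 - (r : ℕ)) = r := by omega
        simp only [Matrix.of_apply, gmat, this]
      simp only [e] at this
      rw [← this, ← Matrix.det_mul_row]
      congr 1
      ext r j
      have e2 : n - 1 - (n - 1 - (r : ℕ)) = r := by omega
      simp only [Matrix.submatrix_apply, Matrix.of_apply, M, Fin.cases_succ, Fin.val_succ, e2,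
        Nat.add_sub_add_right]
      rw [mul_left_comm, Finset.mul_sum, ]
      congr 1
      exact Finset.sum_congr rfl fun m _ => by ring
    have h5 : M.det = M 0 0 * (M.submatrix Fin.succ Fin.succ).det := by
      rw [Matrix.det_succ_column_zero, Fin.sum_univ_succ, Finset.sum_eq_zero]
      · simp
      · intro r _
        rw [h2]; ring
    rw [h1, h5, h3, h4, delta, G, Finset.mul_sum, Finset.mul_sum, Finset.mul_sum]
    refine Finset.sum_congr rfl fun ν hν => ?_
    rw [mem_boxF] at hν
    have hνa : Antitone ν := by
      refine antitone_nat_of_succ_le fun i => ?_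
      by_cases hi : i + 1 < n
      · exact (hν.1 (i + 1) hi).2.trans (hν.1 i (by omega)).1
      · rw [hν.2 (i + 1) (by omega)]; omega
    rw [ih ν hνa hν.2, Finset.prod_mul_distrib, Finset.prod_range_succ]
    have h6 : P.W v n (lam (n + 1)) (lam n) (ν n) = P.psi v (lam n) := by
      rw [hν.2 n le_rfl, W, psi, Finset.range_eq_Ico]
      simp
    rw [h6]
    have h7 := P.prod_J_mul_nn v n
    linear_combination ((∏ j : Fin n, (P.x (n - j) - P.x v)) * P.delta n * P.G n ν *
      (∏ i ∈ Finset.range n, P.W v i (lam (i + 1)) (lam i) (ν i)) * P.psi v (lam n)) * h7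

end Params

end Groth

namespace Groth

theorem det_eq_of_forall_row_eq_smul_add_succ {R : Type*} [CommRing R] {n : ℕ}
    {A B : Matrix (Fin (n + 1)) (Fin (n + 1)) R} (c : Fin n → R)
    (h0 : ∀ j, A (Fin.last n) j = B (Fin.last n) j)
    (h : ∀ r j, A r.castSucc j = B r.castSucc j + c r * A r.succ j) : A.det = B.det := by
  rw [← Matrix.det_submatrix_equiv_self Fin.revPerm A,
    ← Matrix.det_submatrix_equiv_self Fin.revPerm B]
  refine Matrix.det_eq_of_forall_row_eq_smul_add_pred (fun r => c r.rev) (fun j => ?_)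
    fun r j => ?_
  · simp only [Matrix.submatrix_apply, Fin.revPerm_apply, Fin.rev_zero]
    exact h0 _
  · simp only [Matrix.submatrix_apply, Fin.revPerm_apply, Fin.rev_succ, Fin.rev_castSucc]
    exact h _ _

/-- The upper bounds for the strips of entries `t + 1 - n` added to `lam`. -/
def hiF (L n t : ℕ) (lam : ℕ → ℕ) (i : ℕ) : ℕ :=
  if t + 1 ≤ lam i + n then (if i = 0 then L else lam (i - 1)) else lam i

namespace Params
variable {R : Type*} [CommRing R] (P : Params R)

/-- The weight of a cell of an exquisite tableau with entry `t + 1 - n` (after shifting the `β`). -/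
def cw (n t i j : ℕ) : R := P.A (t + 1 - n) + P.B (t - (j + (n - 1 - i)))

/-- The one-variable functions interpolating between monomials and the rows of `gmat`. -/
def phi (n t p v : ℕ) : R :=
  P.x v ^ p * (∏ l ∈ Finset.range (t - n), P.I (l + 1) v) * P.nn v (t - 1 - p)

/-- The interpolating matrices. -/
def dmat (n t : ℕ) (lam : ℕ → ℕ) : Matrix (Fin n) (Fin n) R :=
  Matrix.of fun r j => P.phi n (min t (lam (n - 1 - r) + n)) (lam (n - 1 - r) + r) (n - j)

theorem phi_succ (n t p v : ℕ) :
    P.phi n (t + 1) p v = P.phi n t p v +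
      (P.A (t + 1 - n) + P.B (t - p)) * P.phi n (t + 1) (p + 1) v := by
  have h1 : ∏ l ∈ Finset.range (t - n), P.I (l + 1) v =
      (1 - P.A (t + 1 - n) * P.x v) * ∏ l ∈ Finset.range (t + 1 - n), P.I (l + 1) v := by
    by_cases h : t + 1 ≤ n
    · rw [show t - n = 0 by omega, show t + 1 - n = 0 by omega, P.hA]; simp
    · rw [show t + 1 - n = t - n + 1 by omega, Finset.prod_range_succ]
      linear_combination (-∏ l ∈ Finset.range (t - n), P.I (l + 1) v) * P.hI (t - n + 1) v
  have h2 : P.nn v (t - p) = P.nn v (t - 1 - p) * (1 + P.B (t - p) * P.x v) := by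
    by_cases h : t ≤ p
    · rw [show t - p = 0 by omega, show t - 1 - p = 0 by omega, P.hB]; simp
    · rw [show t - p = t - 1 - p + 1 by omega, nn, Finset.prod_range_succ]; rfl
  unfold phi
  rw [h1, show t + 1 - 1 - p = t - p by omega, show t + 1 - 1 - (p + 1) = t - 1 - p by omega, h2]
  ring

theorem phi_iterate (n t p q v : ℕ) :
    P.phi n (t + 1) p v = ∑ m ∈ Finset.range q,
        (∏ s ∈ Finset.range m, (P.A (t + 1 - n) + P.B (t - (p + s)))) * P.phi n t (p + m) v +
      (∏ s ∈ Finset.range q, (P.A (t + 1 - n) + P.B (t - (p + s)))) * P.phi n (t + 1) (p + q) v := by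
  induction q with
  | zero => simp
  | succ q ih =>
    rw [ih, P.phi_succ n t (p + q), Finset.sum_range_succ, Finset.prod_range_succ, add_assoc p q 1]
    ring

/-- Truncation of `phi_iterate` to the lengths between two consecutive rows. -/
theorem phi_expand (n t i v a b : ℕ) (h : a ≤ b) (ha : t + 1 ≤ a + n) :
    P.phi n (t + 1) (a + (n - 1 - i)) v = ∑ m ∈ Finset.Icc a b,
        (∏ j ∈ Finset.Ico a m, P.cw n t i j) * P.phi n (min t (m + n)) (m + (n - 1 - i)) v +
      (∏ j ∈ Finset.Ico a (b + 1), P.cw n t i j) * P.phi n (t + 1) (b + 1 + (n - 1 - i)) v := by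
  have hprod : ∀ m, a ≤ m → ∏ j ∈ Finset.Ico a m, P.cw n t i j = ∏ s ∈ Finset.range (m - a),
      (P.A (t + 1 - n) + P.B (t - (a + (n - 1 - i) + s))) := by
    intro m _
    rw [Finset.prod_Ico_eq_prod_range]
    refine Finset.prod_congr rfl fun s _ => ?_
    rw [cw, show a + s + (n - 1 - i) = a + (n - 1 - i) + s by omega]
  rw [P.phi_iterate n t _ (b + 1 - a), hprod _ (by omega),
    show a + (n - 1 - i) + (b + 1 - a) = b + 1 + (n - 1 - i) by omega]
  congr 1
  rw [← Finset.Ico_add_one_right_eq_Icc, Finset.sum_Ico_eq_sum_range]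
  refine Finset.sum_congr rfl fun s _ => ?_
  rw [hprod _ (by omega), show a + s - a = s by omega, show min t (a + s + n) = t by omega,
    show a + s + (n - 1 - i) = a + (n - 1 - i) + s by omega]

theorem det_dmat_succ (n t L : ℕ) (lam : ℕ → ℕ) (hl : Antitone lam)
    (hL : lam 0 ≤ L) (hx : ∀ v, P.x v ^ (L + n) = 0) :
    (P.dmat n (t + 1) lam).det = ∑ ν ∈ boxF n lam (hiF L n t lam),
      (∏ i ∈ Finset.range n, ∏ j ∈ Finset.Ico (lam i) (ν i), P.cw n t i j) *
        (P.dmat n t ν).det := by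
  have hexp := det_expand n lam (hiF L n t lam)
    (fun i m => ∏ j ∈ Finset.Ico (lam i) m, P.cw n t i j)
    (fun i m (j : Fin n) => P.phi n (min t (m + n)) (m + (n - 1 - i)) (n - j))
  have e : ∀ ν : ℕ → ℕ, (Matrix.of fun (r j : Fin n) =>
      P.phi n (min t (ν (n - 1 - r) + n)) (ν (n - 1 - r) + (n - 1 - (n - 1 - (r : ℕ)))) (n - j)) =
        P.dmat n t ν := by
    intro ν
    ext r j
    have : n - 1 - (n - 1 - (r : ℕ)) = r := by omega
    simp only [Matrix.of_apply, dmat, this]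
  simp only [e] at hexp
  rw [← hexp]
  have hfrozen : ∀ i v, i < n → ¬ t + 1 ≤ lam i + n →
      P.phi n (min (t + 1) (lam i + n)) (lam i + (n - 1 - i)) v =
        ∑ m ∈ Finset.Icc (lam i) (hiF L n t lam i), (∏ j ∈ Finset.Ico (lam i) m, P.cw n t i j) *
          P.phi n (min t (m + n)) (m + (n - 1 - i)) v := by
    intro i v _ h
    rw [hiF, if_neg h]
    simp only [Finset.Icc_self, Finset.sum_singleton, Finset.Ico_self, Finset.prod_empty, one_mul]
    rw [show min (t + 1) (lam i + n) = min t (lam i + n) by omega]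
  cases n with
  | zero => simp
  | succ n =>
    refine det_eq_of_forall_row_eq_smul_add_succ (fun r : Fin n =>
      if t + 1 ≤ lam (n - r) + (n + 1) then
        ∏ j ∈ Finset.Ico (lam (n - r)) (lam (n - r - 1) + 1), P.cw (n + 1) t (n - r) j
      else 0) (fun j => ?_) fun r j => ?_
    · simp only [dmat, Matrix.of_apply, Fin.val_last, Nat.add_sub_cancel, Nat.sub_self, Nat.sub_zero]
      by_cases h : t + 1 ≤ lam 0 + (n + 1)
      · have := P.phi_expand (n + 1) t 0 (n + 1 - j) (lam 0) L hL h
        simp only [Nat.add_sub_cancel, Nat.sub_zero] at this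
        rw [show min (t + 1) (lam 0 + (n + 1)) = t + 1 by omega, this, hiF, if_pos h, if_pos rfl]
        have h0 : P.phi (n + 1) (t + 1) (L + 1 + n) (n + 1 - j) = 0 := by
          rw [phi, show L + 1 + n = L + (n + 1) by omega, hx]; ring
        rw [h0, mul_zero, add_zero]
      · have := hfrozen 0 (n + 1 - j) (by omega) h
        simpa only [Nat.add_sub_cancel, Nat.sub_zero] using this
    · have hr := r.2
      simp only [dmat, Matrix.of_apply, Fin.val_castSucc, Fin.val_succ, Nat.add_sub_cancel,
        show n - (n - (r : ℕ)) = r by omega, show n - ((r : ℕ) + 1) = n - r - 1 by omega]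
      by_cases h : t + 1 ≤ lam (n - r) + (n + 1)
      · have hle := hl (show n - (r : ℕ) - 1 ≤ n - r by omega)
        have := P.phi_expand (n + 1) t (n - r) (n + 1 - j) (lam (n - r)) (lam (n - r - 1))
          hle h
        simp only [Nat.add_sub_cancel, show n - (n - (r : ℕ)) = r by omega] at this
        rw [if_pos h, show min (t + 1) (lam (n - r) + (n + 1)) = t + 1 by omega, this, hiF,
          if_pos h, if_neg (by omega), show min (t + 1) (lam (n - r - 1) + (n + 1)) = t + 1 by omega,
          show lam (n - r - 1) + ((r : ℕ) + 1) = lam (n - r - 1) + 1 + r by omega]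
      · have := hfrozen (n - r) (n + 1 - j) (by omega) h
        simp only [Nat.add_sub_cancel, show n - (n - (r : ℕ)) = r by omega] at this
        rw [if_neg h, this, zero_mul, add_zero]

/-- The parameters for semistandard tableaux: all `α` and `β` vanish. -/
def ss : Params R where
  A _ := 0
  B _ := 0
  x := P.x
  I _ _ := 1
  J _ _ := 1
  hI _ _ := by simp
  hJ _ _ := by simp
  hA := rfl
  hB := rfl

/-- The generating function of pairs of a semistandard tableau and an exquisite tableau whose
shifted entries are at most `t - n`, in a box with `n` rows and `L` columns. -/
noncomputable def F (n L : ℕ) : ℕ → (ℕ → ℕ) → R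
  | 0, lam => P.ss.G n lam
  | t + 1, lam => ∑ ν ∈ boxF n lam (hiF L n t lam),
      (∏ i ∈ Finset.range n, ∏ j ∈ Finset.Ico (lam i) (ν i), P.cw n t i j) * F n L t ν

theorem delta_ss (n : ℕ) : P.ss.delta n = P.delta n := by
  induction n with
  | zero => rfl
  | succ n ih => rw [delta, delta, ih]; rfl

theorem antitone_of_mem_strip {n t L : ℕ} {lam ν : ℕ → ℕ} (hl : Antitone lam)
    (hν : ν ∈ boxF n lam (hiF L n t lam)) : Antitone ν := by
  rw [mem_boxF] at hν
  refine antitone_nat_of_succ_le fun i => ?_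
  by_cases hi : i + 1 < n
  · have h1 := (hν.1 (i + 1) hi).2
    have h2 := (hν.1 i (by omega)).1
    have h3 := hl (Nat.le_succ i)
    rw [hiF] at h1
    simp only [Nat.add_sub_cancel, Nat.succ_ne_zero, if_false] at h1
    split_ifs at h1
    · omega
    · exact h1.trans (h3.trans h2)
  · rw [hν.2 (i + 1) (by omega)]; omega

theorem zero_le_of_mem_strip {n t L : ℕ} {lam ν : ℕ → ℕ} (hL : lam 0 ≤ L)
    (hν : ν ∈ boxF n lam (hiF L n t lam)) : ν 0 ≤ L := by
  rw [mem_boxF] at hν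
  by_cases hi : 0 < n
  · have h1 := (hν.1 0 hi).2
    rw [hiF] at h1
    simp only [if_true] at h1
    split_ifs at h1
    · exact h1
    · omega
  · rw [hν.2 0 (by omega)]; omega

theorem det_dmat (n L t : ℕ) (lam : ℕ → ℕ) (hl : Antitone lam) (h0 : ∀ i, n ≤ i → lam i = 0)
    (hL : lam 0 ≤ L) (hx : ∀ v, P.x v ^ (L + n) = 0) :
    (P.dmat n t lam).det = P.delta n * P.F n L t lam := by
  induction t generalizing lam with
  | zero =>
    rw [F, ← P.delta_ss, ← P.ss.det_gmat n lam hl h0]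
    congr 1
    ext r j
    simp [dmat, gmat, phi, psi, nn, ss, pow_add, mul_comm]
  | succ t ih =>
    rw [P.det_dmat_succ n t L lam hl hL hx, F, Finset.mul_sum]
    refine Finset.sum_congr rfl fun ν hν => ?_
    rw [ih ν (antitone_of_mem_strip hl hν) (mem_boxF.1 hν).2 (zero_le_of_mem_strip hL hν)]
    ring

theorem delta_mul_G_eq (n L t : ℕ) (lam : ℕ → ℕ) (hl : Antitone lam) (h0 : ∀ i, n ≤ i → lam i = 0)
    (hL : lam 0 ≤ L) (ht : lam 0 + n ≤ t) (hx : ∀ v, P.x v ^ (L + n) = 0) :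
    P.delta n * P.G n lam = P.delta n * P.F n L t lam := by
  rw [← P.det_gmat n lam hl h0, ← P.det_dmat n L t lam hl h0 hL hx]
  congr 1
  ext r j
  have h1 := hl (Nat.zero_le (n - 1 - r))
  have hr := r.2
  simp only [dmat, gmat, Matrix.of_apply, phi, psi]
  rw [show min t (lam (n - 1 - r) + n) = lam (n - 1 - r) + n by omega,
    show lam (n - 1 - (r : ℕ)) + n - n = lam (n - 1 - r) by omega,
    show lam (n - 1 - (r : ℕ)) + n - 1 - (lam (n - 1 - r) + r) = n - 1 - r by omega, pow_add]
  ring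

section Map
variable {R' : Type*} [CommRing R'] (f : R →+* R')

/-- Base change of parameters. -/
def map : Params R' where
  A i := f (P.A i)
  B i := f (P.B i)
  x v := f (P.x v)
  I l v := f (P.I l v)
  J l v := f (P.J l v)
  hI l v := by simpa using congrArg f (P.hI l v)
  hJ l v := by simpa using congrArg f (P.hJ l v)
  hA := by rw [P.hA, map_zero]
  hB := by rw [P.hB, map_zero]

theorem map_W (v i a b m : ℕ) : (P.map f).W v i a b m = f (P.W v i a b m) := by
  unfold W
  split_ifs <;> simp [map]

theorem map_G (n : ℕ) (lam : ℕ → ℕ) : (P.map f).G n lam = f (P.G n lam) := by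
  induction n generalizing lam with
  | zero => simp [G]
  | succ n ih =>
    simp only [G, map_sum, map_mul, map_prod, ih, map_W]

theorem map_delta (n : ℕ) : (P.map f).delta n = f (P.delta n) := by
  induction n with
  | zero => simp [delta]
  | succ n ih =>
    simp only [delta, map_mul, map_prod, map_sub, ih]
    rfl

theorem map_ss : (P.map f).ss = P.ss.map f := by
  simp [map, ss]

theorem map_F (n L t : ℕ) (lam : ℕ → ℕ) : (P.map f).F n L t lam = f (P.F n L t lam) := by
  induction t generalizing lam with
  | zero => rw [F, F, map_ss, map_G]
  | succ t ih =>
    simp only [F, map_sum, map_mul, map_prod, ih, cw, map_add]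
    rfl

end Map

end Params

end Groth

namespace Groth

/-! ### The variables -/

/-- The variables `α_j`, `β_i` and `x_v`. -/
inductive Var : Type
  | al (j : ℕ)
  | be (i : ℕ)
  | x (v : ℕ)

namespace Var

/-- The monomial `α_j`. -/
noncomputable def sal (j : ℕ) : Var →₀ ℕ := Finsupp.single (al j) 1

/-- The monomial `β_i`. -/
noncomputable def sbe (i : ℕ) : Var →₀ ℕ := Finsupp.single (be i) 1

/-- The monomial `x_v`. -/
noncomputable def sx (v : ℕ) : Var →₀ ℕ := Finsupp.single (x v) 1

end Var

open Var

theorem sal_add_sx_ne_zero (l v : ℕ) : sal l + sx v ≠ 0 := by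
  intro h
  have := DFunLike.congr_fun h (x v)
  simp [sal, sx] at this

/-- The generic parameters; if `fl` holds, then all `α` and `β` are specialised to zero. -/
noncomputable def prm (fl : Prop) : Params (MvPowerSeries Var ℤ) where
  A l := if fl ∨ l = 0 then 0 else MvPowerSeries.monomial (sal l) 1
  B l := if fl ∨ l = 0 then 0 else MvPowerSeries.monomial (sbe l) 1
  x v := MvPowerSeries.monomial (sx v) 1
  I l v := if fl ∨ l = 0 then 1 else geo (sal l + sx v)
  J l v := if fl ∨ l = 0 then 1 else MvPowerSeries.invOfUnit
    (1 + MvPowerSeries.monomial (sbe l) 1 * MvPowerSeries.monomial (sx v) 1) 1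
  hI l v := by
    split_ifs
    · simp
    · rw [MvPowerSeries.monomial_mul_monomial, mul_one, one_sub_mul_geo (sal_add_sx_ne_zero l v)]
  hJ l v := by
    split_ifs
    · simp
    · refine MvPowerSeries.mul_invOfUnit _ _ ?_
      rw [map_add, map_mul, map_one, Units.val_one]
      have : MvPowerSeries.constantCoeff (MvPowerSeries.monomial (sx v) (1 : ℤ)) = 0 := by
        rw [← MvPowerSeries.coeff_zero_eq_constantCoeff_apply, MvPowerSeries.coeff_monomial,
          if_neg]
        intro h
        have := DFunLike.congr_fun h (Var.x v)
        simp [sx] at this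
      rw [this]; ring
  hA := by simp
  hB := by simp

theorem ss_prm (fl : Prop) : (prm fl).ss = prm True := by
  simp [prm, Params.ss]

/-! ### Partition shapes -/

/-- The set of cells of a partition. -/
def cellsOf (lam : ℕ → ℕ) : Set Cell := {c | 1 ≤ c.1 ∧ 1 ≤ c.2 ∧ c.2 ≤ lam (c.1 - 1)}

theorem mk_mem_cellsOf {lam : ℕ → ℕ} {i j : ℕ} : (i + 1, j + 1) ∈ cellsOf lam ↔ j < lam i := by
  simp [cellsOf]

theorem cellsOf_subset {lam ν : ℕ → ℕ} : cellsOf lam ⊆ cellsOf ν ↔ ∀ i, lam i ≤ ν i := by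
  constructor
  · intro h i
    by_contra! hi
    have := @h (i + 1, ν i + 1) (mk_mem_cellsOf.2 hi)
    rw [mk_mem_cellsOf] at this
    omega
  · intro h c hc
    exact ⟨hc.1, hc.2.1, hc.2.2.trans (h _)⟩

theorem cellsOf_injective : Function.Injective cellsOf := by
  intro lam ν h
  funext i
  exact le_antisymm (cellsOf_subset.1 h.subset i) (cellsOf_subset.1 h.symm.subset i)

/-- The cells of a partition with at most `n` parts, as a finite set. -/
def cellsFin (n : ℕ) (lam : ℕ → ℕ) : Finset Cell :=
  (Finset.range n).biUnion fun i => (Finset.range (lam i)).image fun j => (i + 1, j + 1)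

theorem mem_cellsFin {n : ℕ} {lam : ℕ → ℕ} (h0 : ∀ i, n ≤ i → lam i = 0) {c : Cell} :
    c ∈ cellsFin n lam ↔ c ∈ cellsOf lam := by
  simp only [cellsFin, Finset.mem_biUnion, Finset.mem_range, Finset.mem_image]
  constructor
  · rintro ⟨i, _, j, hj, rfl⟩
    exact mk_mem_cellsOf.2 hj
  · intro hc
    obtain ⟨h1, h2, h3⟩ := hc
    refine ⟨c.1 - 1, ?_, c.2 - 1, by omega, by ext <;> simp <;> omega⟩
    by_contra! h
    rw [h0 _ h] at h3
    omega

theorem prod_cellsFin {R : Type*} [CommMonoid R] (n : ℕ) (lam : ℕ → ℕ) (f : Cell → R) :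
    ∏ c ∈ cellsFin n lam, f c = ∏ i ∈ Finset.range n, ∏ j ∈ Finset.range (lam i), f (i + 1, j + 1) := by
  rw [cellsFin, Finset.prod_biUnion]
  · refine Finset.prod_congr rfl fun i _ => ?_
    rw [Finset.prod_image]
    intro a _ b _ h
    simpa using h
  · intro a _ b _ hab
    refine Finset.disjoint_left.2 fun c hc hc' => hab ?_
    simp only [Finset.mem_image] at hc hc'
    obtain ⟨_, _, rfl⟩ := hc
    obtain ⟨_, _, h⟩ := hc'
    simpa using (congrArg Prod.fst h).symm

theorem finite_cellsOf {n : ℕ} {lam : ℕ → ℕ} (h0 : ∀ i, n ≤ i → lam i = 0) :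
    (cellsOf lam).Finite :=
  (cellsFin n lam).finite_toSet.subset fun _ hc => (mem_cellsFin h0).2 hc

theorem isPartitionShape_cellsOf {n : ℕ} {lam : ℕ → ℕ} (hl : Antitone lam)
    (h0 : ∀ i, n ≤ i → lam i = 0) : IsPartitionShape (cellsOf lam) := by
  refine ⟨finite_cellsOf h0, fun c hc => ⟨hc.1, hc.2.1⟩, ?_⟩
  intro i j i' j' h h1 h2 h3 h4
  have := hl (show i' - 1 ≤ i - 1 by omega)
  have h5 := h.2.2
  exact ⟨h1, h3, by simp only at *; omega⟩

/-- The row lengths of a partition shape. -/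
noncomputable def rowLen (s : Set Cell) (i : ℕ) : ℕ := sSup {j | (i + 1, j) ∈ s}

theorem le_rowLen_iff {s : Set Cell} (hs : IsPartitionShape s) {i j : ℕ} (hj : 1 ≤ j) :
    j ≤ rowLen s i ↔ (i + 1, j) ∈ s := by
  have hb : BddAbove {j | (i + 1, j) ∈ s} := by
    refine (Set.Finite.subset (hs.1.image Prod.snd) ?_).bddAbove
    intro j hj
    exact ⟨_, hj, rfl⟩
  constructor
  · intro h
    have hne : {j | (i + 1, j) ∈ s}.Nonempty := by
      by_contra! he
      rw [rowLen, he] at h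
      simp at h
      omega
    exact hs.2.2 _ _ _ _ (Nat.sSup_mem hne hb) (by omega) le_rfl hj h
  · exact fun h => le_csSup hb h

theorem cellsOf_rowLen {s : Set Cell} (hs : IsPartitionShape s) : cellsOf (rowLen s) = s := by
  ext ⟨i, j⟩
  constructor
  · rintro ⟨h1, h2, h3⟩
    have := (le_rowLen_iff hs h2).1 h3
    simp only at *
    rwa [show i - 1 + 1 = i by omega] at this
  · intro h
    obtain ⟨h1, h2⟩ := hs.2.1 _ h
    refine ⟨h1, h2, (le_rowLen_iff hs h2).2 ?_⟩
    simp only at *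
    rwa [show i - 1 + 1 = i by omega]

theorem antitone_of_isPartitionShape {lam : ℕ → ℕ} (h : IsPartitionShape (cellsOf lam)) :
    Antitone lam := by
  intro i j hij
  by_contra! hlt
  have := h.2.2 (j + 1) (lam i + 1) (i + 1) (lam i + 1) (mk_mem_cellsOf.2 hlt) (by omega)
    (by omega) (by omega) le_rfl
  rw [mk_mem_cellsOf] at this
  omega

theorem rowLen_cellsOf {lam : ℕ → ℕ} (h : IsPartitionShape (cellsOf lam)) :
    rowLen (cellsOf lam) = lam := cellsOf_injective (cellsOf_rowLen h)

theorem exists_rowLen_eq_zero {s : Set Cell} (hs : IsPartitionShape s) :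
    ∃ n, ∀ i, n ≤ i → rowLen s i = 0 := by
  obtain ⟨n, hn⟩ := (hs.1.image Prod.fst).bddAbove
  refine ⟨n, fun i hi => ?_⟩
  by_contra hne
  have h1 : 1 ≤ rowLen s i := by omega
  have := hn ⟨_, (le_rowLen_iff hs le_rfl).1 h1, rfl⟩
  simp only at this
  omega

end Groth

namespace Groth
open Var

/-! ### Removing the largest letter from a hook -/

theorem filter_append_replicate {N : ℕ} {l : List ℕ} (hs : l.Pairwise (· ≤ ·))
    (hN : ∀ x ∈ l, x ≤ N) : l.filter (· < N) ++ List.replicate (l.count N) N = l := by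
  induction l with
  | nil => rfl
  | cons a l ih =>
    rw [List.pairwise_cons] at hs
    have ih := ih hs.2 fun x hx => hN x (List.mem_cons_of_mem _ hx)
    rcases (hN a List.mem_cons_self).lt_or_eq with h | h
    · rw [List.filter_cons_of_pos (by simpa using h), List.count_cons_of_ne (by omega),
        List.cons_append, ih]
    · have hl : l = List.replicate l.length N := List.eq_replicate_iff.2
        ⟨rfl, fun b hb => le_antisymm (hN b (List.mem_cons_of_mem _ hb)) (h ▸ hs.1 b hb)⟩
      rw [hl, h]
      simp [List.replicate_succ]

theorem filter_lt_append_replicate {N k : ℕ} {l : List ℕ} (h : ∀ x ∈ l, x < N) :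
    (l ++ List.replicate k N).filter (· < N) = l := by
  rw [List.filter_append, List.filter_eq_self.2 (by simpa using h), List.filter_replicate]
  simp

theorem count_append_replicate {N k : ℕ} {l : List ℕ} (h : ∀ x ∈ l, x < N) :
    (l ++ List.replicate k N).count N = k := by
  rw [List.count_append, List.count_eq_zero_of_not_mem fun hN => (h N hN).false]
  simp

/-- The entries of a possibly empty cell. -/
def oent : Option Hook → Multiset ℕ
  | some H => H.entries
  | none => 0

theorem hentriesAt_eq (T : HVTab) (c : Cell) : hentriesAt T c = oent (T c) := rfl

theorem mem_entries {H : Hook} {x : ℕ} : x ∈ H.entries ↔ x = H.hk ∨ x ∈ H.legs ∨ x ∈ H.arms := by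
  simp [Hook.entries]

theorem valid_iff {H : Hook} : H.Valid ↔ 1 ≤ H.hk ∧ H.legs.Pairwise (· < ·) ∧
    (∀ x ∈ H.legs, H.hk < x) ∧ H.arms.Pairwise (· ≤ ·) ∧ ∀ x ∈ H.arms, H.hk ≤ x := by
  rw [← List.isChain_iff_pairwise, ← List.isChain_iff_pairwise]
  rfl

theorem hk_le_of_mem {H : Hook} (hv : H.Valid) {x : ℕ} (hx : x ∈ H.entries) : H.hk ≤ x := by
  rcases mem_entries.1 hx with h | h | h
  · exact h.ge
  · exact (hv.2.2.1 x h).le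
  · exact hv.2.2.2.2 x h

/-- Remove all entries `≥ N` from a hook. -/
def trunc (N : ℕ) (H : Hook) : Option Hook :=
  if H.hk < N then some ⟨H.hk, H.legs.filter (· < N), H.arms.filter (· < N)⟩ else none

/-- Add `p.1` arm entries and `p.2` leg entries `N` to a hook; an empty cell also receives `N`. -/
def grow (N : ℕ) (p : ℕ × ℕ) : Option Hook → Hook
  | some H => ⟨H.hk, H.legs ++ List.replicate p.2 N, H.arms ++ List.replicate p.1 N⟩
  | none => ⟨N, List.replicate p.2 N, List.replicate p.1 N⟩

/-- The numbers of arm and leg entries `N`. -/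
def cnt (N : ℕ) : Option Hook → ℕ × ℕ
  | some H => (H.arms.count N, H.legs.count N)
  | none => 0

section
variable {N : ℕ} {H : Hook} {o : Option Hook} {p : ℕ × ℕ} {x : ℕ}

theorem mem_oent_trunc (hv : H.Valid) : x ∈ oent (trunc N H) ↔ x ∈ H.entries ∧ x < N := by
  unfold trunc
  split_ifs with h
  · simp only [oent, mem_entries, List.mem_filter, decide_eq_true_eq]
    constructor
    · rintro (rfl | h1 | h1)
      · exact ⟨Or.inl rfl, h⟩
      · exact ⟨Or.inr (Or.inl h1.1), h1.2⟩
      · exact ⟨Or.inr (Or.inr h1.1), h1.2⟩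
    · rintro ⟨h1 | h1 | h1, h2⟩
      · exact Or.inl h1
      · exact Or.inr (Or.inl ⟨h1, h2⟩)
      · exact Or.inr (Or.inr ⟨h1, h2⟩)
  · simp only [oent, Multiset.notMem_zero, false_iff, not_and]
    intro hx
    have := hk_le_of_mem hv hx
    omega

theorem valid_trunc (hv : H.Valid) {H' : Hook} (h : trunc N H = some H') : H'.Valid := by
  unfold trunc at h
  split_ifs at h with h1
  obtain rfl := Option.some.inj h
  rw [valid_iff] at hv ⊢
  obtain ⟨h2, h3, h4, h5, h6⟩ := hv
  exact ⟨h2, h3.filter _, fun x hx => h4 x (List.mem_filter.1 hx).1, h5.filter _,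
    fun x hx => h6 x (List.mem_filter.1 hx).1⟩

theorem count_legs_le (hv : H.Valid) : H.legs.count N ≤ 1 :=
  List.nodup_iff_count_le_one.1 ((valid_iff.1 hv).2.1.imp (fun h => h.ne)) N

theorem count_legs_eq_zero (hv : H.Valid) (h : N ≤ H.hk) : H.legs.count N = 0 :=
  List.count_eq_zero_of_not_mem fun hN => by have := hv.2.2.1 N hN; omega

theorem grow_trunc (hv : H.Valid) (hb : ∀ x ∈ H.entries, x ≤ N) :
    grow N (cnt N (some H)) (trunc N H) = H := by
  have hl := filter_append_replicate ((valid_iff.1 hv).2.1.imp (fun h => h.le))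
    fun x hx => hb x (mem_entries.2 (Or.inr (Or.inl hx)))
  have ha := filter_append_replicate (valid_iff.1 hv).2.2.2.1
    fun x hx => hb x (mem_entries.2 (Or.inr (Or.inr hx)))
  unfold trunc
  split_ifs with h
  · simp only [cnt, grow, hl, ha]
  · have hk : H.hk = N := by have := hb H.hk (mem_entries.2 (Or.inl rfl)); omega
    have e : ∀ l : List ℕ, (∀ x ∈ l, H.hk ≤ x) → l.filter (· < N) = [] := by
      intro l hl
      rw [List.filter_eq_nil_iff]
      intro x hx
      have := hl x hx
      simp; omega
    rw [e _ fun x hx => (hv.2.2.1 x hx).le, List.nil_append] at hl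
    rw [e _ hv.2.2.2.2, List.nil_append] at ha
    obtain ⟨a, b, c⟩ := H
    simp only [cnt, grow] at *
    rw [hl, ha, hk]

theorem trunc_grow (ho : ∀ x ∈ oent o, x < N) : trunc N (grow N p o) = o := by
  cases o with
  | none => simp [grow, trunc]
  | some H =>
    simp only [oent, mem_entries] at ho
    simp only [grow, trunc, ho H.hk (Or.inl rfl), if_true]
    rw [filter_lt_append_replicate fun x hx => ho x (Or.inr (Or.inl hx)),
      filter_lt_append_replicate fun x hx => ho x (Or.inr (Or.inr hx))]

theorem cnt_grow (ho : ∀ x ∈ oent o, x < N) : cnt N (some (grow N p o)) = p := by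
  cases o with
  | none => simp [grow, cnt]
  | some H =>
    simp only [oent, mem_entries] at ho
    simp only [grow, cnt]
    rw [count_append_replicate fun x hx => ho x (Or.inr (Or.inl hx)),
      count_append_replicate fun x hx => ho x (Or.inr (Or.inr hx))]

theorem mem_entries_grow : x ∈ (grow N p o).entries ↔
    x ∈ oent o ∨ x = N ∧ (o = none ∨ p ≠ 0) := by
  obtain ⟨a, b⟩ := p
  have : (a, b) ≠ 0 ↔ a ≠ 0 ∨ b ≠ 0 := by
    rw [Ne, Prod.mk_eq_zero, not_and_or]
  rw [this]
  cases o with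
  | none => simp [grow, mem_entries, oent]; tauto
  | some H => simp [grow, mem_entries, oent]; tauto

theorem valid_grow (hN : 1 ≤ N) (hv : ∀ H, o = some H → H.Valid) (ho : ∀ x ∈ oent o, x < N)
    (hp : p.2 ≤ 1) (hp0 : o = none → p.2 = 0) : (grow N p o).Valid := by
  rw [valid_iff]
  cases o with
  | none =>
    simp only [grow, hp0 rfl, List.replicate_zero]
    simp [hN, List.pairwise_replicate]
  | some H =>
    obtain ⟨h2, h3, h4, h5, h6⟩ := valid_iff.1 (hv H rfl)
    simp only [oent, mem_entries] at ho
    have hk := ho H.hk (Or.inl rfl)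
    simp only [grow, List.pairwise_append, List.pairwise_replicate, List.mem_append,
      List.mem_replicate]
    refine ⟨h2, ⟨h3, Or.inl hp, ?_⟩, ?_, ⟨h5, Or.inr le_rfl, ?_⟩, ?_⟩
    · rintro a ha b ⟨_, rfl⟩
      exact ho a (Or.inr (Or.inl ha))
    · rintro a (ha | ⟨_, rfl⟩)
      · exact h4 a ha
      · exact hk
    · rintro a ha b ⟨_, rfl⟩
      exact (ho a (Or.inr (Or.inr ha))).le
    · rintro a (ha | ⟨_, rfl⟩)
      · exact h6 a ha
      · exact hk.le

/-- The weight of a hook in the cell `c`. -/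
noncomputable def cellWt (c : Cell) : Option Hook → Var →₀ ℕ
  | some H => H.arms.length • sal c.2 + H.legs.length • sbe c.1 + (H.entries.map sx).sum
  | none => 0

theorem cellWt_grow (c : Cell) : cellWt c (some (grow N p o)) = cellWt c o +
    ((if o = none then sx N else 0) + (p.1 • (sal c.2 + sx N) + p.2 • (sbe c.1 + sx N))) := by
  cases o with
  | none => simp [cellWt, grow, Hook.entries, add_smul]; abel
  | some H => simp [cellWt, grow, Hook.entries, add_smul]; abel

end

/-- The weight of a hook-valued tableau. -/
noncomputable def wtT (T : HVTab) : Var →₀ ℕ := ∑ᶠ c, cellWt c (T c)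

theorem wtT_eq_sum {T : HVTab} {F : Finset Cell} (h : hshape T ⊆ F) :
    wtT T = ∑ c ∈ F, cellWt c (T c) := by
  refine finsum_eq_sum_of_support_subset _ fun c hc => h ?_
  intro h0
  simp only [Function.mem_support, h0] at hc
  exact hc rfl

end Groth

namespace Groth
open Var

theorem isPartitionShape_of_step {s : Set Cell} (hf : s.Finite) (hp : ∀ c ∈ s, 1 ≤ c.1 ∧ 1 ≤ c.2)
    (h1 : ∀ c : Cell, 1 ≤ c.1 → upCell c ∈ s → c ∈ s)
    (h2 : ∀ c : Cell, 1 ≤ c.2 → rtCell c ∈ s → c ∈ s) : IsPartitionShape s := by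
  refine ⟨hf, hp, fun i j i' j' h hi' hi hj' hj => ?_⟩
  have h3 : (i', j) ∈ s :=
    Nat.decreasingInduction' (P := fun k => (k, j) ∈ s)
      (fun k _ hk h => h1 (k, j) (hi'.trans hk) h) hi h
  exact Nat.decreasingInduction' (P := fun k => (i', k) ∈ s)
      (fun k _ hk h => h2 (i', k) (hj'.trans hk) h) hj h3

theorem IsPartitionShape.of_up {s : Set Cell} (hs : IsPartitionShape s) {c : Cell} (h1 : 1 ≤ c.1)
    (h : upCell c ∈ s) : c ∈ s :=
  hs.2.2 _ _ _ _ h h1 (Nat.le_succ _) (hs.2.1 _ h).2 le_rfl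

theorem IsPartitionShape.of_rt {s : Set Cell} (hs : IsPartitionShape s) {c : Cell} (h2 : 1 ≤ c.2)
    (h : rtCell c ∈ s) : c ∈ s :=
  hs.2.2 _ _ _ _ h (hs.2.1 _ h).1 le_rfl h2 (Nat.le_succ _)

/-- Hook-valued tableaux of shape `lam` with entries at most `n`; if `fl` holds, then
the tableaux are semistandard. -/
def HV (fl : Prop) (n : ℕ) (lam : ℕ → ℕ) : Set HVTab :=
  {T | IsHVT T ∧ hshape T = cellsOf lam ∧ (∀ c, ∀ x ∈ hentriesAt T c, x ≤ n) ∧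
    (fl → NoArms T ∧ NoLegs T)}

theorem mem_hshape {T : HVTab} {c : Cell} : c ∈ hshape T ↔ ∃ H, T c = some H :=
  Option.ne_none_iff_exists'

theorem hk_mem_hentriesAt {T : HVTab} {c : Cell} {H : Hook} (h : T c = some H) :
    H.hk ∈ hentriesAt T c := by
  rw [hentriesAt_eq, h]
  exact mem_entries.2 (Or.inl rfl)

theorem mem_hshape_of_mem {T : HVTab} {c : Cell} {x : ℕ} (hx : x ∈ hentriesAt T c) :
    c ∈ hshape T := by
  intro h
  rw [hentriesAt_eq, h] at hx
  exact absurd hx (Multiset.notMem_zero x)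

theorem le_hentriesAt {T : HVTab} (hT : IsHVT T) {i j x : ℕ} (hx : x ∈ hentriesAt T (i, j)) :
    i ≤ x := by
  induction i generalizing x with
  | zero => omega
  | succ i ih =>
    rcases Nat.eq_zero_or_pos i with rfl | hi
    · obtain ⟨H, hH⟩ := mem_hshape.1 (mem_hshape_of_mem hx)
      rw [hentriesAt_eq, hH] at hx
      exact (hT.2.1 _ _ hH).1.trans (hk_le_of_mem (hT.2.1 _ _ hH) hx)
    · obtain ⟨H, hH⟩ := mem_hshape.1
        (IsPartitionShape.of_up hT.1 (c := (i, j)) hi (mem_hshape_of_mem hx))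
      have h1 := ih (hk_mem_hentriesAt hH)
      have h2 := hT.2.2.2 (i, j) _ (hk_mem_hentriesAt hH) x hx
      omega

/-- Remove all entries `≥ N` from a tableau. -/
def truncT (N : ℕ) (T : HVTab) : HVTab := fun c => (T c).bind (trunc N)

/-- The numbers of arm and leg entries `N` in the cells. -/
def cntT (N : ℕ) (T : HVTab) (c : Cell) : ℕ × ℕ := cnt N (T c)

/-- Insert entries `N`. -/
noncomputable def growT (N : ℕ) (lam : ℕ → ℕ) (q : HVTab × (Cell → ℕ × ℕ)) : HVTab := fun c =>
  if c ∈ cellsOf lam then some (grow N (q.2 c) (q.1 c)) else none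

theorem mem_truncT {N : ℕ} {T : HVTab} (hT : IsHVT T) {c : Cell} {x : ℕ} :
    x ∈ hentriesAt (truncT N T) c ↔ x ∈ hentriesAt T c ∧ x < N := by
  rw [hentriesAt_eq, hentriesAt_eq, truncT]
  cases h : T c with
  | none => simp [oent]
  | some H => exact mem_oent_trunc (hT.2.1 c H h)

theorem mem_hshape_truncT {N : ℕ} {T : HVTab} {c : Cell} :
    c ∈ hshape (truncT N T) ↔ ∃ H, T c = some H ∧ H.hk < N := by
  rw [mem_hshape, truncT]
  cases h : T c with
  | none => simp
  | some H =>
    simp only [Option.bind_some, trunc, Option.some.injEq, exists_eq_left']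
    split_ifs with h1 <;> simp [h1]

theorem isPartitionShape_truncT {N : ℕ} {T : HVTab} (hT : IsHVT T) :
    IsPartitionShape (hshape (truncT N T)) := by
  have hsub : hshape (truncT N T) ⊆ hshape T := fun c hc => by
    obtain ⟨H, hH, _⟩ := mem_hshape_truncT.1 hc
    exact mem_hshape.2 ⟨H, hH⟩
  refine isPartitionShape_of_step (hT.1.1.subset hsub) (fun c hc => hT.1.2.1 c (hsub hc))
    (fun c h1 hc => ?_) fun c h1 hc => ?_
  · obtain ⟨H, hH⟩ := mem_hshape.1 (IsPartitionShape.of_up hT.1 h1 (hsub hc))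
    obtain ⟨H', hH', hlt⟩ := mem_hshape_truncT.1 hc
    refine mem_hshape_truncT.2 ⟨H, hH, ?_⟩
    have := hT.2.2.2 c _ (hk_mem_hentriesAt hH) _ (hk_mem_hentriesAt hH')
    omega
  · obtain ⟨H, hH⟩ := mem_hshape.1 (IsPartitionShape.of_rt hT.1 h1 (hsub hc))
    obtain ⟨H', hH', hlt⟩ := mem_hshape_truncT.1 hc
    refine mem_hshape_truncT.2 ⟨H, hH, ?_⟩
    have := hT.2.2.1 c _ (hk_mem_hentriesAt hH) _ (hk_mem_hentriesAt hH')
    omega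

/-- The admissible additional entries `n + 1` in the cell `c`. -/
def addSet (fl : Prop) (lam ν : ℕ → ℕ) (c : Cell) : Set (ℕ × ℕ) :=
  {p | (p ≠ 0 → rtCell c ∉ cellsOf ν ∧ upCell c ∉ cellsOf lam ∧ ¬ fl) ∧ p.2 ≤ 1 ∧
    (c ∉ cellsOf ν → p.2 = 0)}

/-- The families of admissible additional entries. -/
def addFam (fl : Prop) (n : ℕ) (lam ν : ℕ → ℕ) : Set (Cell → ℕ × ℕ) :=
  {f | (∀ c ∈ cellsFin (n + 1) lam, f c ∈ addSet fl lam ν c) ∧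
    ∀ c, c ∉ cellsFin (n + 1) lam → f c = 0}

theorem cnt_ne_zero {N : ℕ} {H : Hook} (h : cnt N (some H) ≠ 0) : N ∈ H.entries := by
  rw [mem_entries]
  by_contra! h1
  refine h ?_
  rw [cnt, List.count_eq_zero_of_not_mem h1.2.1, List.count_eq_zero_of_not_mem h1.2.2]
  rfl

section
variable {fl : Prop} {n : ℕ} {lam ν : ℕ → ℕ}

theorem rowLen_truncT_mem {T : HVTab} (hT : T ∈ HV fl (n + 1) lam) :
    rowLen (hshape (truncT (n + 1) T)) ∈ boxF n (fun i => lam (i + 1)) lam := by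
  obtain ⟨hT, hsh, hb, _⟩ := hT
  have hps := isPartitionShape_truncT (N := n + 1) hT
  have hle : ∀ i, rowLen (hshape (truncT (n + 1) T)) i ≤ lam i := by
    rw [← cellsOf_subset, cellsOf_rowLen hps, ← hsh]
    intro c hc
    obtain ⟨H, hH, _⟩ := mem_hshape_truncT.1 hc
    exact mem_hshape.2 ⟨H, hH⟩
  rw [mem_boxF]
  refine ⟨fun i _ => ⟨?_, hle i⟩, fun i hi => ?_⟩
  · by_contra! hlt
    have h1 : upCell (i + 1, lam (i + 1)) ∈ hshape T := by
      rw [hsh]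
      refine ⟨by simp [upCell], by simp only [upCell]; omega, by simp [upCell]⟩
    obtain ⟨H', hH'⟩ := mem_hshape.1 h1
    obtain ⟨H, hH⟩ := mem_hshape.1 (IsPartitionShape.of_up hT.1 (by simp) h1)
    have h2 := hT.2.2.2 _ _ (hk_mem_hentriesAt hH) _ (hk_mem_hentriesAt hH')
    have h3 := hb _ _ (hk_mem_hentriesAt hH')
    have h4 := (le_rowLen_iff hps (by omega)).2 (mem_hshape_truncT.2 ⟨H, hH, by omega⟩)
    omega
  · by_contra hne
    have h1 : 1 ≤ rowLen (hshape (truncT (n + 1) T)) i := by omega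
    obtain ⟨H, hH, hlt⟩ := mem_hshape_truncT.1 ((le_rowLen_iff hps le_rfl).1 h1)
    have := le_hentriesAt hT (hk_mem_hentriesAt hH)
    omega

theorem truncT_mem {T : HVTab} (hT : T ∈ HV fl (n + 1) lam) :
    truncT (n + 1) T ∈ HV fl n (rowLen (hshape (truncT (n + 1) T))) := by
  obtain ⟨hT, hsh, hb, hfl⟩ := hT
  have hps := isPartitionShape_truncT (N := n + 1) hT
  refine ⟨⟨hps, ?_, ?_, ?_⟩, (cellsOf_rowLen hps).symm, ?_, fun h => ⟨fun c => ?_, fun c => ?_⟩⟩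
  · intro c H' hc
    obtain ⟨H, hH, h1⟩ := Option.bind_eq_some_iff.1 hc
    exact valid_trunc (hT.2.1 c H hH) h1
  · intro c x hx y hy
    rw [mem_truncT hT] at hx hy
    exact hT.2.2.1 c x hx.1 y hy.1
  · intro c x hx y hy
    rw [mem_truncT hT] at hx hy
    exact hT.2.2.2 c x hx.1 y hy.1
  · intro c x hx
    rw [mem_truncT hT] at hx
    omega
  · have h1 := (hfl h).1 c
    unfold armsAt truncT trunc at *
    cases hc : T c with
    | none => simp
    | some H =>
      simp only [hc] at h1
      simp only [Option.bind_some]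
      split_ifs <;> simp [h1]
  · have h1 := (hfl h).2 c
    unfold legsAt truncT trunc at *
    cases hc : T c with
    | none => simp
    | some H =>
      simp only [hc] at h1
      simp only [Option.bind_some]
      split_ifs <;> simp [h1]

theorem cntT_mem (h0 : ∀ i, n + 1 ≤ i → lam i = 0) {T : HVTab} (hT : T ∈ HV fl (n + 1) lam) :
    cntT (n + 1) T ∈ addFam fl n lam (rowLen (hshape (truncT (n + 1) T))) := by
  obtain ⟨hT, hsh, hb, hfl⟩ := hT
  refine ⟨fun c hc => ?_, fun c hc => ?_⟩
  · rw [mem_cellsFin h0, ← hsh] at hc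
    obtain ⟨H, hH⟩ := mem_hshape.1 hc
    rw [cntT, hH, addSet, cellsOf_rowLen (isPartitionShape_truncT hT), ← hsh]
    refine ⟨fun hne => ⟨fun h => ?_, fun h => ?_, fun h => hne ?_⟩, count_legs_le (hT.2.1 c H hH),
      fun h => count_legs_eq_zero (hT.2.1 c H hH) ?_⟩
    · obtain ⟨H', hH', hlt⟩ := mem_hshape_truncT.1 h
      have := hT.2.2.1 c (n + 1) (by rw [hentriesAt_eq, hH]; exact cnt_ne_zero hne) _
        (hk_mem_hentriesAt hH')
      omega
    · obtain ⟨H', hH'⟩ := mem_hshape.1 h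
      have h1 := hT.2.2.2 c (n + 1) (by rw [hentriesAt_eq, hH]; exact cnt_ne_zero hne) _
        (hk_mem_hentriesAt hH')
      have h2 := hb _ _ (hk_mem_hentriesAt hH')
      omega
    · have h1 := (hfl h).1 c
      have h2 := (hfl h).2 c
      simp only [armsAt, legsAt, hH] at h1 h2
      rw [cnt, h1, h2]
      rfl
    · by_contra! h1
      exact h (mem_hshape_truncT.2 ⟨H, hH, h1⟩)
  · rw [mem_cellsFin h0, ← hsh] at hc
    have : T c = none := by simpa [hshape] using hc
    rw [cntT, this]
    rfl

theorem growT_truncT {T : HVTab} (hT : T ∈ HV fl (n + 1) lam) :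
    growT (n + 1) lam (truncT (n + 1) T, cntT (n + 1) T) = T := by
  obtain ⟨hT, hsh, hb, _⟩ := hT
  funext c
  rw [growT, ← hsh]
  split_ifs with hc
  · obtain ⟨H, hH⟩ := mem_hshape.1 hc
    simp only [cntT, truncT, hH, Option.bind_some]
    rw [grow_trunc (hT.2.1 c H hH)]
    intro x hx
    exact hb c x (by rwa [hentriesAt_eq, hH])
  · have : T c = none := by simpa [hshape] using hc
    rw [this]

variable {T : HVTab} {f : Cell → ℕ × ℕ}

theorem lt_of_mem_HV (hT : T ∈ HV fl n ν) (c : Cell) : ∀ x ∈ oent (T c), x < n + 1 :=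
  fun x hx => Nat.lt_succ_of_le (hT.2.2.1 c x hx)

theorem eq_zero_of_mem_addFam (h0 : ∀ i, n + 1 ≤ i → lam i = 0) (hf : f ∈ addFam fl n lam ν)
    {c : Cell} (h : rtCell c ∈ cellsOf ν ∨ upCell c ∈ cellsOf lam ∨ fl) : f c = 0 := by
  by_cases hc : c ∈ cellsOf lam
  · have := (hf.1 c ((mem_cellsFin h0).2 hc)).1
    by_contra hne
    have := this hne
    tauto
  · exact hf.2 c (by rwa [mem_cellsFin h0])

theorem subset_of_mem_box (hν : ν ∈ boxF n (fun i => lam (i + 1)) lam) :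
    cellsOf ν ⊆ cellsOf lam := by
  rw [mem_boxF] at hν
  refine cellsOf_subset.2 fun i => ?_
  by_cases hi : i < n
  · exact (hν.1 i hi).2
  · rw [hν.2 i (by omega)]; omega

theorem mem_of_up_mem (h0 : ∀ i, n + 1 ≤ i → lam i = 0)
    (hν : ν ∈ boxF n (fun i => lam (i + 1)) lam) {c : Cell} (h1 : 1 ≤ c.1)
    (h : upCell c ∈ cellsOf lam) : c ∈ cellsOf ν := by
  rw [mem_boxF] at hν
  obtain ⟨_, h2, h3⟩ := h
  simp only [upCell] at h2 h3
  refine ⟨h1, h2, h3.trans ?_⟩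
  by_cases hi : c.1 - 1 < n
  · refine le_trans (le_of_eq ?_) (hν.1 (c.1 - 1) hi).1
    congr 1
    omega
  · rw [h0 _ (by omega)]; omega

theorem hshape_growT : hshape (growT (n + 1) lam (T, f)) = cellsOf lam := by
  ext c
  rw [mem_hshape, growT]
  split_ifs with h <;> simp [h]

theorem mem_hentriesAt_growT {c : Cell} {x : ℕ} : x ∈ hentriesAt (growT (n + 1) lam (T, f)) c ↔
    c ∈ cellsOf lam ∧ (x ∈ hentriesAt T c ∨ x = n + 1 ∧ (T c = none ∨ f c ≠ 0)) := by
  rw [hentriesAt_eq, growT]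
  split_ifs with h
  · rw [oent, mem_entries_grow]
    simp only [h, true_and]
    rfl
  · simp [oent, h]

theorem growT_mem (hl : Antitone lam) (h0 : ∀ i, n + 1 ≤ i → lam i = 0)
    (hν : ν ∈ boxF n (fun i => lam (i + 1)) lam)
    (hT : T ∈ HV fl n ν) (hf : f ∈ addFam fl n lam ν) :
    growT (n + 1) lam (T, f) ∈ HV fl (n + 1) lam := by
  have hT' := hT
  obtain ⟨hT, hsh, hb, hfl⟩ := hT
  have hsub := subset_of_mem_box hν
  refine ⟨⟨?_, ?_, ?_, ?_⟩, hshape_growT, ?_, fun h => ?_⟩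
  · rw [hshape_growT]
    exact isPartitionShape_cellsOf hl h0
  · intro c H hc
    unfold growT at hc
    split_ifs at hc with h
    obtain rfl := Option.some.inj hc
    have hfc := hf.1 c ((mem_cellsFin h0).2 h)
    refine valid_grow (by omega) (hT.2.1 c) (lt_of_mem_HV hT' c) hfc.2.1 fun h1 => hfc.2.2 ?_
    rw [← hsh]
    simpa [hshape] using h1
  · intro c x hx y hy
    rw [mem_hentriesAt_growT] at hx hy
    rcases hy.2 with h | ⟨rfl, _⟩
    · have hc : rtCell c ∈ cellsOf ν := hsh ▸ mem_hshape_of_mem h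
      have hc' : c ∈ hshape T := by
        have h1 := hx.1.2.1
        rw [hsh]
        exact IsPartitionShape.of_rt (hsh ▸ hT.1) h1 hc
      rcases hx.2 with h' | ⟨rfl, h' | h'⟩
      · exact hT.2.2.1 c x h' y h
      · exact absurd h' hc'
      · exact absurd (eq_zero_of_mem_addFam h0 hf (Or.inl hc)) h'
    · rcases hx.2 with h' | ⟨rfl, _⟩
      · exact (hb _ _ h').trans (by omega)
      · exact le_rfl
  · intro c x hx y hy
    rw [mem_hentriesAt_growT] at hx hy
    have hc : c ∈ hshape T := hsh ▸ mem_of_up_mem h0 hν hx.1.1 hy.1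
    rcases hx.2 with h | ⟨rfl, h | h⟩
    · rcases hy.2 with h' | ⟨rfl, _⟩
      · exact hT.2.2.2 c x h y h'
      · exact Nat.lt_succ_of_le (hb _ _ h)
    · exact absurd h hc
    · exact absurd (eq_zero_of_mem_addFam h0 hf (Or.inr (Or.inl hy.1))) h
  · intro c x hx
    rw [mem_hentriesAt_growT] at hx
    rcases hx.2 with h | ⟨rfl, _⟩
    · exact (hb _ _ h).trans (by omega)
    · exact le_rfl
  · have h1 : ∀ c, f c = 0 := fun c => eq_zero_of_mem_addFam h0 hf (Or.inr (Or.inr h))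
    refine ⟨fun c => ?_, fun c => ?_⟩
    · have h2 := (hfl h).1 c
      unfold armsAt growT at *
      split_ifs
      · cases hc : T c with
        | none => simp [grow, h1, hc]
        | some H =>
          simp only [hc] at h2
          simp [grow, h1, h2, hc]
      · rfl
    · have h2 := (hfl h).2 c
      unfold legsAt growT at *
      split_ifs
      · cases hc : T c with
        | none => simp [grow, h1, hc]
        | some H =>
          simp only [hc] at h2
          simp [grow, h1, h2, hc]
      · rfl

theorem truncT_growT (hν : ν ∈ boxF n (fun i => lam (i + 1)) lam) (hT : T ∈ HV fl n ν) :
    truncT (n + 1) (growT (n + 1) lam (T, f)) = T := by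
  funext c
  rw [truncT, growT]
  split_ifs with h
  · exact trunc_grow (lt_of_mem_HV hT c)
  · have h1 : c ∉ hshape T := fun hc => h (subset_of_mem_box hν (hT.2.1 ▸ hc))
    have : T c = none := by simpa [hshape] using h1
    rw [this]
    rfl

theorem cntT_growT (h0 : ∀ i, n + 1 ≤ i → lam i = 0)
    (hT : T ∈ HV fl n ν) (hf : f ∈ addFam fl n lam ν) :
    cntT (n + 1) (growT (n + 1) lam (T, f)) = f := by
  funext c
  rw [cntT, growT]
  split_ifs with h
  · exact cnt_grow (lt_of_mem_HV hT c)
  · exact (hf.2 c (by rwa [mem_cellsFin h0])).symm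

theorem bijOn_truncT (hl : Antitone lam) (h0 : ∀ i, n + 1 ≤ i → lam i = 0)
    (hν : ν ∈ boxF n (fun i => lam (i + 1)) lam) :
    Set.BijOn (fun T => (truncT (n + 1) T, cntT (n + 1) T))
      {T | T ∈ HV fl (n + 1) lam ∧ rowLen (hshape (truncT (n + 1) T)) = ν}
      (HV fl n ν ×ˢ addFam fl n lam ν) := by
  refine Set.InvOn.bijOn (f' := growT (n + 1) lam) ⟨?_, ?_⟩ ?_ ?_
  · rintro T ⟨hT, _⟩
    exact growT_truncT hT
  · rintro ⟨T, f⟩ ⟨hT, hf⟩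
    exact Prod.ext (truncT_growT hν hT) (cntT_growT h0 hT hf)
  · rintro T ⟨hT, rfl⟩
    exact ⟨truncT_mem hT, cntT_mem h0 hT⟩
  · rintro ⟨T, f⟩ ⟨hT, hf⟩
    refine ⟨growT_mem hl h0 hν hT hf, ?_⟩
    have h1 : hshape T = cellsOf ν := hT.2.1
    rw [truncT_growT hν hT, h1, rowLen_cellsOf (h1 ▸ hT.1.1)]

end

end Groth

namespace Groth
open Var

/-- The weight of the entries `n + 1` of a cell. -/
noncomputable def addWt (n : ℕ) (ν : ℕ → ℕ) (c : Cell) (p : ℕ × ℕ) : Var →₀ ℕ :=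
  (if c ∈ cellsOf ν then 0 else sx (n + 1)) +
    (p.1 • (sal c.2 + sx (n + 1)) + p.2 • (sbe c.1 + sx (n + 1)))

theorem wtT_eq_truncT {fl : Prop} {n : ℕ} {lam : ℕ → ℕ} (h0 : ∀ i, n + 1 ≤ i → lam i = 0)
    {T : HVTab} (hT : T ∈ HV fl (n + 1) lam) :
    wtT (truncT (n + 1) T) + ∑ c ∈ cellsFin (n + 1) lam,
      addWt n (rowLen (hshape (truncT (n + 1) T))) c (cntT (n + 1) T c) = wtT T := by
  have hsh : hshape T ⊆ cellsFin (n + 1) lam := fun c hc => by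
    rw [Finset.mem_coe, mem_cellsFin h0, ← hT.2.1]
    exact hc
  have hsub : hshape (truncT (n + 1) T) ⊆ hshape T := fun c hc => by
    obtain ⟨H, hH, _⟩ := mem_hshape_truncT.1 hc
    exact mem_hshape.2 ⟨H, hH⟩
  rw [wtT_eq_sum hsh, wtT_eq_sum (hsub.trans hsh), ← Finset.sum_add_distrib]
  refine Finset.sum_congr rfl fun c hc => ?_
  have h1 : T c = some (grow (n + 1) (cntT (n + 1) T c) (truncT (n + 1) T c)) := by
    have := congrFun (growT_truncT hT) c
    rw [growT, if_pos ((mem_cellsFin h0).1 hc)] at this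
    exact this.symm
  conv_rhs => rw [h1, cellWt_grow]
  rw [addWt, cellsOf_rowLen (isPartitionShape_truncT hT.1)]
  congr 2
  by_cases h : truncT (n + 1) T c = none <;> simp [hshape, h]

/-- The generating function of the entries `n + 1` of a cell. -/
noncomputable def addGF (fl : Prop) (n : ℕ) (lam ν : ℕ → ℕ) (c : Cell) : MvPowerSeries Var ℤ :=
  (if c ∈ cellsOf ν then 1 else (prm fl).x (n + 1)) *
    if rtCell c ∉ cellsOf ν ∧ upCell c ∉ cellsOf lam then
      (if c ∈ cellsOf ν then 1 + (prm fl).B c.1 * (prm fl).x (n + 1) else 1) *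
        (prm fl).I c.2 (n + 1)
    else 1

theorem hasGF_addSet {fl : Prop} {n : ℕ} {lam ν : ℕ → ℕ} {c : Cell} (hc : c ∈ cellsOf lam) :
    HasGF (addSet fl lam ν c) (addWt n ν c) (addGF fl n lam ν c) := by
  have hfac : (MvPowerSeries.monomial (if c ∈ cellsOf ν then 0 else sx (n + 1)) 1 :
      MvPowerSeries Var ℤ) = if c ∈ cellsOf ν then 1 else (prm fl).x (n + 1) := by
    split_ifs <;> rfl
  have hc1 : c.1 ≠ 0 := by have := hc.1; omega
  have hc2 : c.2 ≠ 0 := by have := hc.2.1; omega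
  rw [addGF, ← hfac]
  change HasGF _ (fun p : ℕ × ℕ => (if c ∈ cellsOf ν then 0 else sx (n + 1)) +
    (p.1 • (sal c.2 + sx (n + 1)) + p.2 • (sbe c.1 + sx (n + 1)))) _
  refine HasGF.shift ?_ _
  by_cases h : rtCell c ∉ cellsOf ν ∧ upCell c ∉ cellsOf lam ∧ ¬ fl
  · obtain ⟨h1, h2, h3⟩ := h
    rw [if_pos ⟨h1, h2⟩]
    have hE : HasGF (((if c ∈ cellsOf ν then {0, 1} else {0} : Finset ℕ)) : Set ℕ)
        (fun k => k • (sbe c.1 + sx (n + 1)))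
        (if c ∈ cellsOf ν then 1 + (prm fl).B c.1 * (prm fl).x (n + 1) else 1) := by
      have := HasGF.finset (if c ∈ cellsOf ν then {0, 1} else {0} : Finset ℕ)
        (fun k => k • (sbe c.1 + sx (n + 1)))
      convert this using 1
      split_ifs
      · rw [Finset.sum_pair (by simp), zero_smul, one_smul]
        simp only [prm, h3, hc1, or_self, if_false, MvPowerSeries.monomial_mul_monomial, mul_one]
        rfl
      · rw [Finset.sum_singleton, zero_smul]
        rfl
    have hI : HasGF (Set.univ : Set ℕ) (fun k => k • (sal c.2 + sx (n + 1)))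
        ((prm fl).I c.2 (n + 1)) := by
      simp only [prm, h3, hc2, or_self, if_false]
      exact hasGF_geo (sal_add_sx_ne_zero _ _)
    rw [mul_comm]
    convert hI.prod hE using 1
    ext p
    simp only [addSet, Set.mem_prod, Set.mem_univ, true_and, Finset.mem_coe, h1, h2, h3,
      not_false_eq_true, and_self, implies_true, Set.mem_ofPred_eq]
    split_ifs with h4
    · simp only [h4, not_true_eq_false, false_implies, and_true, Finset.mem_insert,
        Finset.mem_singleton]
      omega
    · simp only [h4, not_false_eq_true, true_implies, Finset.mem_singleton]
      omega
  · have hset : addSet fl lam ν c = {0} := by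
      ext p
      simp only [addSet, Set.mem_ofPred_eq, Set.mem_singleton_iff, h, imp_false, not_not]
      constructor
      · exact fun h => h.1
      · rintro rfl
        simp
    have hone : (if rtCell c ∉ cellsOf ν ∧ upCell c ∉ cellsOf lam then
        (if c ∈ cellsOf ν then 1 + (prm fl).B c.1 * (prm fl).x (n + 1) else 1) *
          (prm fl).I c.2 (n + 1) else 1) = 1 := by
      split_ifs with h1
      · have h3 : fl := by tauto
        simp [prm, h3]
      · have h3 : fl := by tauto
        simp [prm, h3]
      · rfl
    rw [hone, hset]
    convert HasGF.singleton (0 : ℕ × ℕ) _ using 1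
    simp

theorem prod_addGF {fl : Prop} {n : ℕ} {lam ν : ℕ → ℕ}
    (hν : ν ∈ boxF n (fun i => lam (i + 1)) lam) (h0 : ∀ i, n + 1 ≤ i → lam i = 0) :
    ∏ c ∈ cellsFin (n + 1) lam, addGF fl n lam ν c =
      ∏ i ∈ Finset.range (n + 1), (prm fl).W (n + 1) i (lam (i + 1)) (lam i) (ν i) := by
  rw [prod_cellsFin]
  refine Finset.prod_congr rfl fun i _ => ?_
  have hle : ν i ≤ lam i := cellsOf_subset.1 (subset_of_mem_box hν) i
  have hge : lam (i + 1) ≤ ν i := by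
    by_cases hi : i < n
    · exact ((mem_boxF.1 hν).1 i hi).1
    · rw [h0 (i + 1) (by omega)]; omega
  have hrt : ∀ j, rtCell (i + 1, j + 1) ∈ cellsOf ν ↔ j + 1 < ν i :=
    fun j => mk_mem_cellsOf (i := i) (j := j + 1)
  have hup : ∀ j, upCell (i + 1, j + 1) ∈ cellsOf lam ↔ j < lam (i + 1) :=
    fun j => mk_mem_cellsOf (i := i + 1)
  simp only [addGF, mk_mem_cellsOf, hrt, hup]
  rw [← Finset.prod_range_mul_prod_Ico _ hle, Params.W, mul_comm]
  congr 1
  · rw [show (prm fl).x (n + 1) ^ (lam i - ν i) =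
      ∏ l ∈ Finset.Ico (ν i) (lam i), (prm fl).x (n + 1) by simp, ← Finset.prod_mul_distrib]
    refine Finset.prod_congr rfl fun j hj => ?_
    rw [Finset.mem_Ico] at hj
    rw [if_neg (by omega), if_pos (by omega), if_neg (by omega), one_mul]
  · rcases Nat.eq_zero_or_pos (ν i) with h | h
    · rw [h, if_neg (by omega)]; simp
    · obtain ⟨m, hm⟩ := Nat.exists_eq_add_of_le' h
      rw [hm, Finset.prod_range_succ, Finset.prod_eq_one]
      · simp only [one_mul, Nat.lt_succ_self, if_true, lt_irrefl, not_false_eq_true, true_and]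
        by_cases h2 : lam (i + 1) ≤ m
        · rw [if_pos (by omega), if_pos (by omega)]
        · rw [if_neg (by omega), if_neg (by omega)]
      · intro j hj
        rw [Finset.mem_range] at hj
        rw [if_pos (by omega), if_neg (by omega), one_mul]

theorem HV_zero (fl : Prop) {lam : ℕ → ℕ} (h0 : ∀ i, 0 ≤ i → lam i = 0) :
    HV fl 0 lam = {fun _ => none} := by
  have he : cellsOf lam = ∅ := by
    ext c
    simp only [cellsOf, h0 _ (Nat.zero_le _)]
    simp
    omega
  ext T
  simp only [Set.mem_singleton_iff]
  constructor
  · intro hT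
    funext c
    by_contra h
    have : c ∈ hshape T := h
    rw [hT.2.1, he] at this
    exact this
  · rintro rfl
    refine ⟨⟨?_, ?_, ?_, ?_⟩, ?_, ?_, fun _ => ⟨fun c => rfl, fun c => rfl⟩⟩
    · refine ⟨?_, ?_, ?_⟩ <;> simp [hshape]
    · simp
    · simp [hentriesAt]
    · simp [hentriesAt]
    · rw [he]
      simp [hshape]
    · simp [hentriesAt]

theorem hasGF_HV (fl : Prop) (n : ℕ) (lam : ℕ → ℕ) (hl : Antitone lam)
    (h0 : ∀ i, n ≤ i → lam i = 0) : HasGF (HV fl n lam) wtT ((prm fl).G n lam) := by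
  induction n generalizing lam with
  | zero =>
    rw [HV_zero fl h0]
    convert HasGF.singleton _ _ using 1
    have : wtT (fun _ => none) = 0 := by simp [wtT, cellWt]
    rw [this]
    rfl
  | succ n ih =>
    refine HasGF.fiberwise (fun T => rowLen (hshape (truncT (n + 1) T))) _ _
      (fun T hT => rowLen_truncT_mem hT) fun ν hν => ?_
    by_cases ha : Antitone ν
    · have h1 := ih ν ha (mem_boxF.1 hν).2
      have h2 := HasGF.pi (cellsFin (n + 1) lam) (addSet fl lam ν) (addWt n ν) (addGF fl n lam ν)
        fun c hc => hasGF_addSet ((mem_cellsFin h0).1 hc)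
      rw [prod_addGF hν h0] at h2
      rw [mul_comm]
      refine (h1.prod h2).of_bijOn (bijOn_truncT hl h0 hν) ?_
      rintro T ⟨hT, rfl⟩
      exact wtT_eq_truncT h0 hT
    · exfalso
      refine ha (antitone_nat_of_succ_le fun i => ?_)
      rw [mem_boxF] at hν
      by_cases hi : i + 1 < n
      · exact (hν.1 (i + 1) hi).2.trans (hν.1 i (by omega)).1
      · rw [hν.2 (i + 1) (by omega)]; omega

end Groth

namespace Groth
open Var

/-! ### Layers of exquisite tableaux -/

/-- The shifted index of an entry in the cell `c`. -/
def ev (c : Cell) : MEntry → ℤ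
  | .al k => k
  | .be r => r + ((c.2 : ℤ) - (c.1 : ℤ))

theorem cBetaPlus_eq_some {E : MixedTableau} {c : Cell} {e : MEntry} (h : cBetaPlus E c = some e) :
    ∃ e', E c = some e' ∧ ev c e' = e.idx := by
  unfold cBetaPlus at h
  split at h
  · rename_i r hr
    obtain rfl := Option.some.inj h
    exact ⟨_, hr, rfl⟩
  · rename_i hne
    refine ⟨e, h, ?_⟩
    cases e with
    | al k => rfl
    | be k => exact absurd h (hne k)

theorem exists_cBetaPlus {E : MixedTableau} {c : Cell} {e : MEntry} (h : E c = some e) :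
    ∃ e', cBetaPlus E c = some e' ∧ e'.idx = ev c e := by
  cases e with
  | al k => exact ⟨.al k, by simp [cBetaPlus, h], rfl⟩
  | be k => exact ⟨.be (k + ((c.2 : ℤ) - (c.1 : ℤ))), by simp [cBetaPlus, h], rfl⟩

theorem totallyColumnStrict_cBetaPlus {E : MixedTableau} : TotallyColumnStrict (cBetaPlus E) ↔
    (∀ c e e', E c = some e → E (upCell c) = some e' → ev (upCell c) e' < ev c e) ∧
    (∀ c e e', E c = some e → E (rtCell c) = some e' → ev (rtCell c) e' ≤ ev c e) := by
  constructor
  · rintro ⟨h1, h2⟩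
    refine ⟨fun c e e' h h' => ?_, fun c e e' h h' => ?_⟩
    · obtain ⟨d, hd, hi⟩ := exists_cBetaPlus h
      obtain ⟨d', hd', hi'⟩ := exists_cBetaPlus h'
      rw [← hi, ← hi']
      exact h1 c d d' hd hd'
    · obtain ⟨d, hd, hi⟩ := exists_cBetaPlus h
      obtain ⟨d', hd', hi'⟩ := exists_cBetaPlus h'
      rw [← hi, ← hi']
      exact h2 c d d' hd hd'
  · rintro ⟨h1, h2⟩
    refine ⟨fun c e e' h h' => ?_, fun c e e' h h' => ?_⟩
    · obtain ⟨d, hd, hi⟩ := cBetaPlus_eq_some h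
      obtain ⟨d', hd', hi'⟩ := cBetaPlus_eq_some h'
      rw [← hi, ← hi']
      exact h1 c d d' hd hd'
    · obtain ⟨d, hd, hi⟩ := cBetaPlus_eq_some h
      obtain ⟨d', hd', hi'⟩ := cBetaPlus_eq_some h'
      rw [← hi, ← hi']
      exact h2 c d d' hd hd'

/-- The flag condition for an entry in the cell `c`. -/
def Flag (c : Cell) : MEntry → Prop
  | .al k => 0 < k ∧ k < (c.2 : ℤ)
  | .be k => 0 < k ∧ k < (c.1 : ℤ)

/-- A reformulation of `IsEXQ`. -/
structure Exq (lam mu : Set Cell) (E : MixedTableau) : Prop where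
  shape : mshape E = mu \ lam
  flag : ∀ c e, E c = some e → Flag c e
  col : ∀ c e e', E c = some e → E (upCell c) = some e' → ev (upCell c) e' < ev c e
  row : ∀ c e e', E c = some e → E (rtCell c) = some e' → ev (rtCell c) e' ≤ ev c e

theorem isEXQ_iff {lam mu : Set Cell} (hl : IsPartitionShape lam) (hm : IsPartitionShape mu)
    {E : MixedTableau} : IsEXQ lam mu E ↔ lam ⊆ mu ∧ Exq lam mu E := by
  rw [IsEXQ, totallyColumnStrict_cBetaPlus]
  constructor
  · rintro ⟨h1, h2, h3, h4, h5⟩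
    refine ⟨h2.2.2.1, h2.2.2.2, fun c e h => ?_, h4, h5⟩
    cases e with
    | al k => exact h3.1 c k h
    | be k => exact h3.2 c k h
  · rintro ⟨hsub, h1, h2, h3, h4⟩
    have h5 : mshape E ⊆ mu := h1 ▸ Set.sdiff_subset
    exact ⟨⟨hm.1.subset h5, fun c hc => hm.2.1 c (h5 hc), fun c k h => (h2 c _ h).1⟩,
      ⟨hl, hm, hsub, h1⟩, ⟨fun c k h => h2 c _ h, fun c k h => h2 c _ h⟩, h3, h4⟩

theorem mem_mshape {E : MixedTableau} {c : Cell} : c ∈ mshape E ↔ ∃ e, E c = some e :=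
  Option.ne_none_iff_exists'

/-- Pairs of a semistandard tableau with entries at most `n` in a box with `L` columns and an
exquisite tableau with shifted entries at most `t - n`. -/
def EX (n L t : ℕ) (lam : ℕ → ℕ) : Set (HVTab × MixedTableau) :=
  {q | IsSSYT q.1 ∧ (∀ c, ∀ x ∈ hentriesAt q.1 c, x ≤ n) ∧ (∀ c ∈ hshape q.1, c.2 ≤ L) ∧
    cellsOf lam ⊆ hshape q.1 ∧ Exq (cellsOf lam) (hshape q.1) q.2 ∧
    ∀ c e, q.2 c = some e → ev c e ≤ (t : ℤ) - n}

/-- The union of `lam` and the cells with the shifted entry `m`. -/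
def topShape (m : ℤ) (lam : ℕ → ℕ) (E : MixedTableau) : Set Cell :=
  cellsOf lam ∪ {c | ∃ e, E c = some e ∧ ev c e = m}

/-- The cells outside of `s`. -/
noncomputable def outer (s : Set Cell) (E : MixedTableau) : MixedTableau :=
  fun c => if c ∈ s then none else E c

/-- The cells inside of `s`. -/
noncomputable def inner (s : Set Cell) (E : MixedTableau) : MixedTableau :=
  fun c => if c ∈ s then E c else none

/-- Glue two tableaux along the boundary of `s`. -/
noncomputable def glue (s : Set Cell) (f E : MixedTableau) : MixedTableau :=
  fun c => if c ∈ s then f c else E c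

/-- The admissible entries of the layer `t + 1 - n`. -/
def layerSet (n t : ℕ) (lam : ℕ → ℕ) (c : Cell) : Set (Option MEntry) :=
  {o | (c ∈ cellsOf lam ∧ o = none) ∨
    (c ∉ cellsOf lam ∧ ∃ e, o = some e ∧ Flag c e ∧ ev c e = (t : ℤ) + 1 - n)}

/-- The admissible layers. -/
def layerFam (n t : ℕ) (lam ν : ℕ → ℕ) : Set MixedTableau :=
  {f | (∀ c ∈ cellsFin n ν, f c ∈ layerSet n t lam c) ∧ ∀ c, c ∉ cellsFin n ν → f c = none}

theorem fst_le_of_mem_hshape {n : ℕ} {P : HVTab} (hP : IsHVT P)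
    (hb : ∀ c, ∀ x ∈ hentriesAt P c, x ≤ n) {c : Cell} (hc : c ∈ hshape P) : c.1 ≤ n := by
  obtain ⟨H, hH⟩ := mem_hshape.1 hc
  exact (le_hentriesAt hP (i := c.1) (j := c.2) (hk_mem_hentriesAt hH)).trans
    (hb c _ (hk_mem_hentriesAt hH))

section
variable {n L t : ℕ} {lam ν : ℕ → ℕ} {q : HVTab × MixedTableau}

theorem topShape_subset (hq : q ∈ EX n L (t + 1) lam) :
    topShape ((t : ℤ) + 1 - n) lam q.2 ⊆ hshape q.1 := by
  obtain ⟨_, _, _, h4, h5, _⟩ := hq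
  rintro c (hc | ⟨e, he, _⟩)
  · exact h4 hc
  · have : c ∈ mshape q.2 := mem_mshape.2 ⟨e, he⟩
    rw [h5.shape] at this
    exact this.1

theorem le_of_mem_EX (hq : q ∈ EX n L (t + 1) lam) {c : Cell} {e : MEntry}
    (h : q.2 c = some e) : ev c e ≤ (t : ℤ) + 1 - n := by
  have := hq.2.2.2.2.2 c e h
  push_cast at this
  exact this

theorem mem_of_up_mem_topShape (hlam : IsPartitionShape (cellsOf lam))
    (hq : q ∈ EX n L (t + 1) lam) {c : Cell} (h1 : 1 ≤ c.1)
    (h : upCell c ∈ topShape ((t : ℤ) + 1 - n) lam q.2) : c ∈ cellsOf lam := by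
  rcases h with h | ⟨e, he, hv⟩
  · exact IsPartitionShape.of_up hlam h1 h
  · by_contra hc
    have h2 : upCell c ∈ hshape q.1 := topShape_subset hq (Or.inr ⟨e, he, hv⟩)
    have h3 : c ∈ mshape q.2 := by
      rw [hq.2.2.2.2.1.shape]
      exact ⟨IsPartitionShape.of_up hq.1.1.1 h1 h2, hc⟩
    obtain ⟨e', he'⟩ := mem_mshape.1 h3
    have h4 := hq.2.2.2.2.1.col c _ _ he' he
    have h5 := le_of_mem_EX hq he'
    omega

theorem isPartitionShape_topShape (hlam : IsPartitionShape (cellsOf lam))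
    (hq : q ∈ EX n L (t + 1) lam) :
    IsPartitionShape (topShape ((t : ℤ) + 1 - n) lam q.2) := by
  have hps : IsPartitionShape (hshape q.1) := hq.1.1.1
  refine isPartitionShape_of_step (hps.1.subset (topShape_subset hq))
    (fun c hc => hps.2.1 c (topShape_subset hq hc))
    (fun c h1 h => Or.inl (mem_of_up_mem_topShape hlam hq h1 h)) fun c h1 h => ?_
  rcases h with h | ⟨e, he, hv⟩
  · exact Or.inl (IsPartitionShape.of_rt hlam h1 h)
  · by_cases hc : c ∈ cellsOf lam
    · exact Or.inl hc
    · have h2 : rtCell c ∈ hshape q.1 := topShape_subset hq (Or.inr ⟨e, he, hv⟩)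
      have h3 : c ∈ mshape q.2 := by
        rw [hq.2.2.2.2.1.shape]
        exact ⟨IsPartitionShape.of_rt hps h1 h2, hc⟩
      obtain ⟨e', he'⟩ := mem_mshape.1 h3
      have h4 := hq.2.2.2.2.1.row c _ _ he' he
      have h5 := le_of_mem_EX hq he'
      exact Or.inr ⟨e', he', by omega⟩

theorem ev_lt_of_flag {c : Cell} {e : MEntry} (h : Flag c e) : ev c e < c.2 := by
  cases e with
  | al k => exact h.2
  | be k =>
    have := h.2
    simp only [ev]
    omega

theorem rowLen_topShape_mem (hlam : IsPartitionShape (cellsOf lam))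
    (hq : q ∈ EX n L (t + 1) lam) :
    rowLen (topShape ((t : ℤ) + 1 - n) lam q.2) ∈ boxF n lam (hiF L n t lam) := by
  have hps := isPartitionShape_topShape hlam hq
  have hge : ∀ i, lam i ≤ rowLen (topShape ((t : ℤ) + 1 - n) lam q.2) i := by
    rw [← cellsOf_subset, cellsOf_rowLen hps]
    exact Set.subset_union_left
  rw [mem_boxF]
  refine ⟨fun i _ => ⟨hge i, ?_⟩, fun i hi => ?_⟩
  · unfold hiF
    by_contra! hlt
    split_ifs at hlt with h1 h2
    · have := hq.2.2.1 _ (topShape_subset hq ((le_rowLen_iff hps (by omega)).1 hlt))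
      simp only at this
      omega
    · have h3 := (le_rowLen_iff hps (by omega)).1 hlt
      have h4 : upCell (i, lam (i - 1) + 1) ∈ topShape ((t : ℤ) + 1 - n) lam q.2 := h3
      have := (mem_of_up_mem_topShape hlam hq (by simp only; omega) h4).2.2
      simp only at this
      omega
    · rcases (le_rowLen_iff hps (by omega)).1 hlt with h3 | ⟨e, he, hv⟩
      · rw [Nat.succ_eq_add_one, mk_mem_cellsOf] at h3
        omega
      · have := ev_lt_of_flag (hq.2.2.2.2.1.flag _ _ he)
        rw [hv] at this
        push_cast at this
        omega
  · by_contra hne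
    have h1 : 1 ≤ rowLen (topShape ((t : ℤ) + 1 - n) lam q.2) i := by omega
    have := fst_le_of_mem_hshape hq.1.1 hq.2.1
      (topShape_subset hq ((le_rowLen_iff hps le_rfl).1 h1))
    simp only at this
    omega

theorem outer_mem (hlam : IsPartitionShape (cellsOf lam)) (hq : q ∈ EX n L (t + 1) lam) :
    (q.1, outer (topShape ((t : ℤ) + 1 - n) lam q.2) q.2) ∈
      EX n L t (rowLen (topShape ((t : ℤ) + 1 - n) lam q.2)) := by
  have hps := isPartitionShape_topShape hlam hq
  have hsub := topShape_subset hq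
  have hle := fun c e => le_of_mem_EX hq (c := c) (e := e)
  obtain ⟨h1, h2, h3, h4, h5, h6⟩ := hq
  have hE : ∀ c e, outer (topShape ((t : ℤ) + 1 - n) lam q.2) q.2 c = some e ↔
      c ∉ topShape ((t : ℤ) + 1 - n) lam q.2 ∧ q.2 c = some e := by
    intro c e
    unfold outer
    split_ifs with h <;> simp [h]
  refine ⟨h1, h2, h3, ?_, ⟨?_, ?_, ?_, ?_⟩, ?_⟩
  · rw [cellsOf_rowLen hps]
    exact hsub
  · rw [cellsOf_rowLen hps]
    ext c
    rw [mem_mshape]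
    simp only [hE, exists_and_left]
    rw [← mem_mshape, h5.shape]
    constructor
    · exact fun h => ⟨h.2.1, h.1⟩
    · exact fun h => ⟨h.2, h.1, fun hc => h.2 (Or.inl hc)⟩
  · intro c e h
    exact h5.flag c e ((hE c e).1 h).2
  · intro c e e' h h'
    exact h5.col c e e' ((hE _ _).1 h).2 ((hE _ _).1 h').2
  · intro c e e' h h'
    exact h5.row c e e' ((hE _ _).1 h).2 ((hE _ _).1 h').2
  · intro c e h
    obtain ⟨h7, h8⟩ := (hE c e).1 h
    have h9 := hle c e h8
    have h10 : ev c e ≠ (t : ℤ) + 1 - n := fun h => h7 (Or.inr ⟨e, h8, h⟩)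
    omega

theorem inner_mem (hlam : IsPartitionShape (cellsOf lam)) (hq : q ∈ EX n L (t + 1) lam) :
    inner (topShape ((t : ℤ) + 1 - n) lam q.2) q.2 ∈
      layerFam n t lam (rowLen (topShape ((t : ℤ) + 1 - n) lam q.2)) := by
  have hps := isPartitionShape_topShape hlam hq
  have h0 := (mem_boxF.1 (rowLen_topShape_mem hlam hq)).2
  refine ⟨fun c hc => ?_, fun c hc => ?_⟩
  · rw [mem_cellsFin h0, cellsOf_rowLen hps] at hc
    rw [inner, if_pos hc]
    by_cases h : c ∈ cellsOf lam
    · refine Or.inl ⟨h, ?_⟩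
      by_contra hne
      have : c ∈ mshape q.2 := hne
      rw [hq.2.2.2.2.1.shape] at this
      exact this.2 h
    · refine Or.inr ⟨h, ?_⟩
      rcases hc with hc | ⟨e, he, hv⟩
      · exact absurd hc h
      · exact ⟨e, he, hq.2.2.2.2.1.flag c e he, hv⟩
  · rw [mem_cellsFin h0, cellsOf_rowLen hps] at hc
    rw [inner, if_neg hc]

theorem glue_inner_outer (s : Set Cell) (E : MixedTableau) :
    glue s (inner s E) (outer s E) = E := by
  funext c
  unfold glue inner outer
  split_ifs <;> rfl

variable {f E : MixedTableau} {P : HVTab}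

theorem layer_mem (h0 : ∀ i, n ≤ i → ν i = 0) (hf : f ∈ layerFam n t lam ν) {c : Cell}
    {e : MEntry} (h : f c = some e) :
    c ∈ cellsOf ν ∧ c ∉ cellsOf lam ∧ Flag c e ∧ ev c e = (t : ℤ) + 1 - n := by
  by_cases hc : c ∈ cellsOf ν
  · refine ⟨hc, ?_⟩
    rcases hf.1 c ((mem_cellsFin h0).2 hc) with h1 | ⟨h1, e', h2, h3⟩
    · rw [h1.2] at h
      exact absurd h (by simp)
    · rw [h2] at h
      obtain rfl := Option.some.inj h
      exact ⟨h1, h3⟩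
  · rw [hf.2 c (by rwa [mem_cellsFin h0])] at h
    exact absurd h (by simp)

theorem exists_layer (h0 : ∀ i, n ≤ i → ν i = 0) (hf : f ∈ layerFam n t lam ν) {c : Cell}
    (hc : c ∈ cellsOf ν) (h : c ∉ cellsOf lam) : ∃ e, f c = some e := by
  rcases hf.1 c ((mem_cellsFin h0).2 hc) with h1 | ⟨_, e', h2, _⟩
  · exact absurd h1.1 h
  · exact ⟨e', h2⟩

theorem glue_eq_some {s : Set Cell} {c : Cell} {e : MEntry} :
    glue s f E c = some e ↔ c ∈ s ∧ f c = some e ∨ c ∉ s ∧ E c = some e := by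
  unfold glue
  split_ifs with h <;> simp [h]

theorem mem_of_up_mem_strip (hl : Antitone lam) (hν : ν ∈ boxF n lam (hiF L n t lam))
    {c : Cell} (h1 : 1 ≤ c.1) (h : upCell c ∈ cellsOf ν) : c ∈ cellsOf lam := by
  obtain ⟨_, h2, h3⟩ := h
  simp only [upCell, Nat.add_sub_cancel] at h2 h3
  refine ⟨h1, h2, h3.trans ?_⟩
  by_cases hc : c.1 < n
  · have h4 := ((mem_boxF.1 hν).1 c.1 hc).2
    unfold hiF at h4
    split_ifs at h4
    · omega
    · exact h4
    · exact h4.trans (hl (Nat.sub_le _ _))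
  · rw [(mem_boxF.1 hν).2 c.1 (by omega)]; omega

theorem subset_of_mem_strip (hl0 : ∀ i, n ≤ i → lam i = 0)
    (hν : ν ∈ boxF n lam (hiF L n t lam)) : cellsOf lam ⊆ cellsOf ν := by
  refine cellsOf_subset.2 fun i => ?_
  by_cases hi : i < n
  · exact ((mem_boxF.1 hν).1 i hi).1
  · rw [hl0 i (by omega)]; omega

theorem glue_mem (hl : Antitone lam) (hl0 : ∀ i, n ≤ i → lam i = 0)
    (hν : ν ∈ boxF n lam (hiF L n t lam))
    (hf : f ∈ layerFam n t lam ν) (hE : (P, E) ∈ EX n L t ν) :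
    (P, glue (cellsOf ν) f E) ∈ EX n L (t + 1) lam := by
  have h0 := (mem_boxF.1 hν).2
  have hpn := isPartitionShape_cellsOf (Params.antitone_of_mem_strip hl hν) h0
  have hsub := subset_of_mem_strip hl0 hν
  obtain ⟨h1, h2, h3, h4, h5, h6⟩ := hE
  refine ⟨h1, h2, h3, hsub.trans h4, ⟨?_, ?_, ?_, ?_⟩, ?_⟩
  · ext c
    rw [mem_mshape]
    simp only [glue_eq_some]
    constructor
    · rintro ⟨e, ⟨h7, h8⟩ | ⟨h7, h8⟩⟩
      · exact ⟨h4 h7, (layer_mem h0 hf h8).2.1⟩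
      · have : c ∈ mshape E := mem_mshape.2 ⟨e, h8⟩
        rw [h5.shape] at this
        exact ⟨this.1, fun h => h7 (hsub h)⟩
    · rintro ⟨h7, h8⟩
      by_cases hc : c ∈ cellsOf ν
      · obtain ⟨e, he⟩ := exists_layer h0 hf hc h8
        exact ⟨e, Or.inl ⟨hc, he⟩⟩
      · have : c ∈ mshape E := by
          rw [h5.shape]
          exact ⟨h7, hc⟩
        obtain ⟨e, he⟩ := mem_mshape.1 this
        exact ⟨e, Or.inr ⟨hc, he⟩⟩
  · intro c e h
    rcases glue_eq_some.1 h with ⟨_, h7⟩ | ⟨_, h7⟩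
    · exact (layer_mem h0 hf h7).2.2.1
    · exact h5.flag c e h7
  · intro c e e' h h'
    rcases glue_eq_some.1 h' with ⟨h7, h8⟩ | ⟨h7, h8⟩
    · exfalso
      rcases glue_eq_some.1 h with ⟨h9, h10⟩ | ⟨h9, h10⟩
      · exact (layer_mem h0 hf h10).2.1 (mem_of_up_mem_strip hl hν h9.1 h7)
      · have h11 : c ∈ mshape E := mem_mshape.2 ⟨e, h10⟩
        rw [h5.shape] at h11
        exact h9 (IsPartitionShape.of_up hpn (h1.1.1.2.1 c h11.1).1 h7)
    · have h11 := h6 _ _ h8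
      rcases glue_eq_some.1 h with ⟨_, h10⟩ | ⟨_, h10⟩
      · rw [(layer_mem h0 hf h10).2.2.2]
        omega
      · exact h5.col c e e' h10 h8
  · intro c e e' h h'
    rcases glue_eq_some.1 h' with ⟨h7, h8⟩ | ⟨h7, h8⟩
    · rw [(layer_mem h0 hf h8).2.2.2]
      rcases glue_eq_some.1 h with ⟨h9, h10⟩ | ⟨h9, h10⟩
      · rw [(layer_mem h0 hf h10).2.2.2]
      · have h11 : c ∈ mshape E := mem_mshape.2 ⟨e, h10⟩
        rw [h5.shape] at h11
        exact absurd (IsPartitionShape.of_rt hpn (h1.1.1.2.1 c h11.1).2 h7) h9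
    · have h11 := h6 _ _ h8
      rcases glue_eq_some.1 h with ⟨_, h10⟩ | ⟨_, h10⟩
      · rw [(layer_mem h0 hf h10).2.2.2]
        omega
      · exact h5.row c e e' h10 h8
  · intro c e h
    push_cast
    rcases glue_eq_some.1 h with ⟨_, h7⟩ | ⟨_, h7⟩
    · exact (layer_mem h0 hf h7).2.2.2.le
    · have := h6 _ _ h7
      omega

theorem topShape_glue (hl0 : ∀ i, n ≤ i → lam i = 0)
    (hν : ν ∈ boxF n lam (hiF L n t lam))
    (hf : f ∈ layerFam n t lam ν) (hE : (P, E) ∈ EX n L t ν) :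
    topShape ((t : ℤ) + 1 - n) lam (glue (cellsOf ν) f E) = cellsOf ν := by
  have h0 := (mem_boxF.1 hν).2
  ext c
  constructor
  · rintro (h | ⟨e, h, hv⟩)
    · exact subset_of_mem_strip hl0 hν h
    · rcases glue_eq_some.1 h with ⟨h1, _⟩ | ⟨_, h1⟩
      · exact h1
      · have := hE.2.2.2.2.2 _ _ h1
        omega
  · intro hc
    by_cases h : c ∈ cellsOf lam
    · exact Or.inl h
    · obtain ⟨e, he⟩ := exists_layer h0 hf hc h
      exact Or.inr ⟨e, glue_eq_some.2 (Or.inl ⟨hc, he⟩), (layer_mem h0 hf he).2.2.2⟩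

theorem bijOn_layer (hl : Antitone lam) (hl0 : ∀ i, n ≤ i → lam i = 0)
    (hν : ν ∈ boxF n lam (hiF L n t lam)) :
    Set.BijOn (fun q : HVTab × MixedTableau => (inner (topShape ((t : ℤ) + 1 - n) lam q.2) q.2,
        (q.1, outer (topShape ((t : ℤ) + 1 - n) lam q.2) q.2)))
      {q | q ∈ EX n L (t + 1) lam ∧ rowLen (topShape ((t : ℤ) + 1 - n) lam q.2) = ν}
      (layerFam n t lam ν ×ˢ EX n L t ν) := by
  have hlam := isPartitionShape_cellsOf hl hl0
  have h0 := (mem_boxF.1 hν).2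
  have hpn := isPartitionShape_cellsOf (Params.antitone_of_mem_strip hl hν) h0
  refine Set.InvOn.bijOn (f' := fun p => (p.2.1, glue (cellsOf ν) p.1 p.2.2)) ⟨?_, ?_⟩ ?_ ?_
  · rintro q ⟨hq, rfl⟩
    simp only [cellsOf_rowLen (isPartitionShape_topShape hlam hq), glue_inner_outer]
  · rintro ⟨f, P, E⟩ ⟨hf, hE⟩
    simp only at hf hE
    simp only [topShape_glue hl0 hν hf hE]
    refine Prod.ext ?_ (Prod.ext rfl ?_)
    · funext c
      simp only [inner, glue]
      split_ifs with h
      · rfl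
      · exact (hf.2 c (by rwa [mem_cellsFin h0])).symm
    · funext c
      simp only [outer, glue]
      split_ifs with h
      · by_contra hne
        have : c ∈ mshape E := fun h => hne h.symm
        rw [hE.2.2.2.2.1.shape] at this
        exact this.2 h
      · rfl
  · rintro q ⟨hq, rfl⟩
    exact ⟨inner_mem hlam hq, outer_mem hlam hq⟩
  · rintro ⟨f, P, E⟩ ⟨hf, hE⟩
    refine ⟨glue_mem hl hl0 hν hf hE, ?_⟩
    simp only at hf hE
    rw [topShape_glue hl0 hν hf hE, rowLen_cellsOf hpn]

end

end Groth

namespace Groth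
open Var

/-! ### The generating function of exquisite tableaux -/

/-- The weight of a possibly empty entry of a mixed tableau. -/
noncomputable def mwt : Option MEntry → Var →₀ ℕ
  | some (.al k) => sal k.toNat
  | some (.be k) => sbe k.toNat
  | none => 0

/-- The weight of a mixed tableau. -/
noncomputable def wtM (E : MixedTableau) : Var →₀ ℕ := ∑ᶠ c, mwt (E c)

theorem wtM_eq_sum {E : MixedTableau} {F : Finset Cell} (h : mshape E ⊆ F) :
    wtM E = ∑ c ∈ F, mwt (E c) := by
  refine finsum_eq_sum_of_support_subset _ fun c hc => h ?_
  intro h0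
  simp only [Function.mem_support, h0] at hc
  exact hc rfl

theorem wtM_inner_add_outer {E : MixedTableau} (hE : (mshape E).Finite) {s : Set Cell}
    {F : Finset Cell} (hF : ∀ c, c ∈ F ↔ c ∈ s) :
    ∑ c ∈ F, mwt (inner s E c) + wtM (outer s E) = wtM E := by
  have h1 : mshape E ⊆ (F ∪ hE.toFinset : Finset Cell) := fun c hc => by simp [hc]
  have h2 : mshape (outer s E) ⊆ (F ∪ hE.toFinset : Finset Cell) := by
    intro c hc
    refine h1 (?_ : E c ≠ none)
    intro h
    refine hc ?_
    unfold outer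
    split_ifs <;> simp [h]
  rw [wtM_eq_sum h1, wtM_eq_sum h2,
    Finset.sum_subset (Finset.subset_union_left (s₂ := hE.toFinset)), ← Finset.sum_add_distrib]
  · refine Finset.sum_congr rfl fun c _ => ?_
    unfold inner outer
    split_ifs <;> simp [mwt]
  · intro c _ hc
    rw [hF] at hc
    simp [inner, hc, mwt]

theorem layerSet_eq {n t i j : ℕ} {lam : ℕ → ℕ} (hi : i < n) (hj : lam i ≤ j)
    (ht : t + 1 ≤ lam i + n) : layerSet n t lam (i + 1, j + 1) =
      (((if t + 1 - n = 0 then ∅ else {some (.al ((t + 1 - n : ℕ) : ℤ))}) ∪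
        (if t - (j + (n - 1 - i)) = 0 then ∅ else
          {some (.be ((t - (j + (n - 1 - i)) : ℕ) : ℤ))}) : Finset (Option MEntry)) :
        Set (Option MEntry)) := by
  have hc : (i + 1, j + 1) ∉ cellsOf lam := by rw [mk_mem_cellsOf]; omega
  ext o
  simp only [layerSet, hc, false_and, false_or, not_false_eq_true, true_and,
    Set.mem_ofPred_eq, Finset.coe_union, Set.mem_union]
  constructor
  · rintro ⟨e, rfl, h1, h2⟩
    cases e with
    | al k =>
      simp only [Flag, ev] at h1 h2
      left
      rw [if_neg (by omega), show k = ((t + 1 - n : ℕ) : ℤ) by omega]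
      simp
    | be k =>
      simp only [Flag, ev] at h1 h2
      right
      rw [if_neg (by omega), show k = ((t - (j + (n - 1 - i)) : ℕ) : ℤ) by omega]
      simp
  · rintro (h | h)
    · split_ifs at h with h0
      · simp at h
      · refine ⟨_, by simpa using h, ?_, ?_⟩ <;> simp only [Flag, ev] <;> omega
    · split_ifs at h with h0
      · simp at h
      · refine ⟨_, by simpa using h, ?_, ?_⟩ <;> simp only [Flag, ev] <;> omega

theorem hasGF_layerSet {n t i j : ℕ} {lam : ℕ → ℕ} (hi : i < n) (hj : lam i ≤ j)
    (ht : t + 1 ≤ lam i + n) :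
    HasGF (layerSet n t lam (i + 1, j + 1)) mwt ((prm False).cw n t i j) := by
  rw [layerSet_eq hi hj ht]
  convert HasGF.finset _ mwt using 1
  rw [Finset.sum_union]
  · simp only [Params.cw, prm, false_or]
    congr 1 <;> split_ifs <;> simp [mwt]
  · split_ifs <;> simp

theorem layerSet_of_mem {n t : ℕ} {lam : ℕ → ℕ} {c : Cell} (hc : c ∈ cellsOf lam) :
    layerSet n t lam c = {none} := by
  ext o
  simp [layerSet, hc]

theorem hasGF_layerFam {n L t : ℕ} {lam ν : ℕ → ℕ} (hν : ν ∈ boxF n lam (hiF L n t lam)) :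
    HasGF (layerFam n t lam ν) (fun f => ∑ c ∈ cellsFin n ν, mwt (f c))
      (∏ i ∈ Finset.range n, ∏ j ∈ Finset.Ico (lam i) (ν i), (prm False).cw n t i j) := by
  let _ : Zero (Option MEntry) := ⟨none⟩
  have h := HasGF.pi (cellsFin n ν) (layerSet n t lam) (fun _ => mwt)
    (fun c => if c ∈ cellsOf lam then 1 else (prm False).cw n t (c.1 - 1) (c.2 - 1)) ?_
  · have hp : (∏ i ∈ Finset.range n, ∏ j ∈ Finset.Ico (lam i) (ν i), (prm False).cw n t i j) =
        ∏ c ∈ cellsFin n ν, if c ∈ cellsOf lam then 1 else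
          (prm False).cw n t (c.1 - 1) (c.2 - 1) := by
      rw [prod_cellsFin]
      refine Finset.prod_congr rfl fun i hi => ?_
      have hle := ((mem_boxF.1 hν).1 i (Finset.mem_range.1 hi)).1
      symm
      rw [Finset.range_eq_Ico, ← Finset.prod_Ico_consecutive _ (Nat.zero_le _) hle,
        Finset.prod_eq_one, one_mul]
      · refine Finset.prod_congr rfl fun j hj => ?_
        rw [if_neg]
        · rfl
        · rw [mk_mem_cellsOf, not_lt]; exact (Finset.mem_Ico.1 hj).1
      · intro j hj
        rw [if_pos (mk_mem_cellsOf.2 (Finset.mem_Ico.1 hj).2)]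
    rw [hp]
    exact h
  · rintro ⟨i, j⟩ hc
    split_ifs with h1
    · rw [layerSet_of_mem h1]
      have := HasGF.singleton (none : Option MEntry) mwt
      exact this
    · obtain ⟨h2, h3, h4⟩ := (mem_cellsFin (mem_boxF.1 hν).2).1 hc
      obtain ⟨i, rfl⟩ := Nat.exists_eq_add_of_le' h2
      obtain ⟨j, rfl⟩ := Nat.exists_eq_add_of_le' h3
      simp only [Nat.add_sub_cancel] at h4 ⊢
      rw [mk_mem_cellsOf, not_lt] at h1
      have hi : i < n := by
        by_contra hi
        have := (mem_boxF.1 hν).2 i (by omega)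
        omega
      have h5 := ((mem_boxF.1 hν).1 i hi).2
      refine hasGF_layerSet hi h1 ?_
      unfold hiF at h5
      split_ifs at h5 with h6
      · exact h6
      · exact h6
      · omega

theorem hasGF_EX_zero (n L : ℕ) (lam : ℕ → ℕ) (hl : Antitone lam) (h0 : ∀ i, n ≤ i → lam i = 0)
    (hL : lam 0 ≤ L) :
    HasGF (EX n L 0 lam) (fun q => wtT q.1 + wtM q.2) ((prm True).G n lam) := by
  have hE : ∀ q ∈ EX n L 0 lam, (∀ c, q.2 c = none) ∧ hshape q.1 = cellsOf lam := by
    rintro ⟨P, E⟩ ⟨h1, h2, h3, h4, h5, h6⟩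
    have hnone : ∀ c, E c = none := by
      intro c
      by_contra hne
      obtain ⟨e, he⟩ := Option.ne_none_iff_exists'.1 hne
      have h7 := h6 c e he
      have h8 := h5.flag c e he
      have h9 : c ∈ mshape E := hne
      rw [h5.shape] at h9
      have h10 := fst_le_of_mem_hshape h1.1 h2 h9.1
      have h11 := (h1.1.1.2.1 c h9.1)
      cases e <;> simp only [Flag, ev] at h7 h8 <;> omega
    refine ⟨hnone, h4.antisymm' fun c hc => ?_⟩
    by_contra hc'
    have : c ∈ mshape E := by rw [h5.shape]; exact ⟨hc, hc'⟩
    exact this (hnone c)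
  refine (hasGF_HV True n lam hl h0).of_bijOn (f := Prod.fst) ⟨?_, ?_, ?_⟩ ?_
  · intro q hq
    exact ⟨hq.1.1, (hE q hq).2, hq.2.1, fun _ => hq.1.2⟩
  · intro q hq q' hq' h
    exact Prod.ext h (funext fun c => ((hE q hq).1 c).trans ((hE q' hq').1 c).symm)
  · rintro P ⟨h1, h2, h3, h4⟩
    refine ⟨(P, fun _ => none), ⟨⟨h1, h4 trivial⟩, h3, ?_, h2.symm.subset, ?_, by simp⟩, rfl⟩
    · intro c hc
      simp only [h2] at hc
      exact hc.2.2.trans ((hl (Nat.zero_le _)).trans hL)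
    · refine ⟨?_, by simp, by simp, by simp⟩
      simp only [h2]
      simp [mshape]
  · intro q hq
    have : wtM q.2 = 0 := by
      unfold wtM
      rw [finsum_eq_zero_of_forall_eq_zero]
      intro c
      rw [(hE q hq).1 c]
      rfl
    simp [this]

theorem hasGF_EX (n L t : ℕ) (lam : ℕ → ℕ) (hl : Antitone lam) (h0 : ∀ i, n ≤ i → lam i = 0)
    (hL : lam 0 ≤ L) :
    HasGF (EX n L t lam) (fun q => wtT q.1 + wtM q.2) ((prm False).F n L t lam) := by
  induction t generalizing lam with
  | zero =>
    rw [Params.F, ss_prm]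
    exact hasGF_EX_zero n L lam hl h0 hL
  | succ t ih =>
    rw [Params.F]
    have hlam := isPartitionShape_cellsOf hl h0
    refine HasGF.fiberwise
      (fun q : HVTab × MixedTableau => rowLen (topShape ((t : ℤ) + 1 - n) lam q.2)) _ _
      (fun q hq => rowLen_topShape_mem hlam hq) fun ν hν => ?_
    have hν0 := (mem_boxF.1 hν).2
    refine ((hasGF_layerFam hν).prod (ih ν (Params.antitone_of_mem_strip hl hν) hν0
      (Params.zero_le_of_mem_strip hL hν))).of_bijOn (bijOn_layer hl h0 hν) ?_
    rintro ⟨P, E⟩ ⟨hq, rfl⟩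
    have hfin : (mshape E).Finite := by
      have := hq.2.2.2.2.1.shape
      simp only at this
      rw [this]
      exact hq.1.1.1.1.subset Set.sdiff_subset
    have := wtM_inner_add_outer hfin (s := topShape ((t : ℤ) + 1 - n) lam E)
      (F := cellsFin n (rowLen (topShape ((t : ℤ) + 1 - n) lam E))) fun c => by
        rw [mem_cellsFin hν0, cellsOf_rowLen (isPartitionShape_topShape hlam hq)]
    simp only
    rw [← this]
    abel

end Groth

namespace Groth
open Var

/-! ### Comparison of the generating functions up to a given degree -/

/-- The grading by the degree in the variables `x_v`. -/
def xdeg : Var → ℕ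
  | .x _ => 1
  | _ => 0

theorem weight_sx (v : ℕ) : Finsupp.weight xdeg (sx v) = 1 := by
  simp [sx, Finsupp.weight_apply, xdeg]

theorem delta_prm_ne_zero (n : ℕ) : (prm False).delta n ≠ 0 := by
  induction n with
  | zero => simp [Params.delta]
  | succ n ih =>
    rw [Params.delta]
    refine mul_ne_zero (Finset.prod_ne_zero_iff.2 fun j _ h => ?_) ih
    have := congrArg (MvPowerSeries.coeff (sx (n + 1))) h
    have hne : sx (n + 1) ≠ sx (n - j) := by
      intro h
      have := DFunLike.congr_fun h (Var.x (n + 1))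
      rw [sx, sx, Finsupp.single_eq_same, Finsupp.single_apply, if_neg] at this
      · omega
      · intro h
        have := Var.x.inj h
        omega
    simp only [prm, map_sub, MvPowerSeries.coeff_monomial, if_neg hne, if_true, map_zero] at this
    omega

/-- The power series of degree at least `k` in the variables `x_v`. -/
noncomputable def highIdeal (k : ℕ) : Ideal (MvPowerSeries Var ℤ) where
  carrier := {f | (k : ℕ∞) ≤ f.weightedOrder xdeg}
  zero_mem' := by simp
  add_mem' {f g} hf hg := (le_min hf hg).trans (MvPowerSeries.min_weightedOrder_le_add xdeg)
  smul_mem' f g hg := (le_add_left hg).trans (MvPowerSeries.le_weightedOrder_mul xdeg)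

theorem mem_highIdeal {k : ℕ} {f : MvPowerSeries Var ℤ} :
    f ∈ highIdeal k ↔ (k : ℕ∞) ≤ f.weightedOrder xdeg := Iff.rfl

theorem delta_mul_sub_mem (n L t : ℕ) (lam : ℕ → ℕ) (hl : Antitone lam)
    (h0 : ∀ i, n ≤ i → lam i = 0) (hL : lam 0 ≤ L) (ht : lam 0 + n ≤ t) :
    (prm False).delta n * ((prm False).G n lam - (prm False).F n L t lam) ∈ highIdeal (L + n) := by
  rw [← Ideal.Quotient.eq_zero_iff_mem, map_mul, map_sub, ← Params.map_delta, ← Params.map_G,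
    ← Params.map_F, mul_sub, sub_eq_zero]
  refine Params.delta_mul_G_eq _ n L t lam hl h0 hL ht fun v => ?_
  rw [Params.map, ← map_pow, Ideal.Quotient.eq_zero_iff_mem, mem_highIdeal, prm,
    MvPowerSeries.monomial_pow, one_pow, MvPowerSeries.weightedOrder_monomial_of_ne_zero _ one_ne_zero,
    map_nsmul, weight_sx]
  simp

theorem exists_coeff_G_eq_coeff_F (n k : ℕ) (lam : ℕ → ℕ) (hl : Antitone lam)
    (h0 : ∀ i, n ≤ i → lam i = 0) : ∃ L, k ≤ L ∧ lam 0 ≤ L ∧ ∀ m, Finsupp.weight xdeg m ≤ k →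
      MvPowerSeries.coeff m ((prm False).G n lam) =
        MvPowerSeries.coeff m ((prm False).F n L (L + n) lam) := by
  obtain ⟨d, hd⟩ := ENat.ne_top_iff_exists.1
    (mt (MvPowerSeries.weightedOrder_eq_top_iff xdeg).1 (delta_prm_ne_zero n))
  refine ⟨d + k + lam 0 + 1, by omega, by omega, fun m hm => ?_⟩
  have h := delta_mul_sub_mem n (d + k + lam 0 + 1) (d + k + lam 0 + 1 + n) lam hl h0
    (by omega) (by omega)
  rw [mem_highIdeal, MvPowerSeries.weightedOrder_mul, ← hd] at h
  rw [← sub_eq_zero, ← map_sub]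
  refine MvPowerSeries.coeff_eq_zero_of_lt_weightedOrder xdeg ?_
  by_contra! hlt
  have h1 := h.trans (add_le_add_right (hlt.trans (Nat.cast_le.2 hm)) (d : ℕ∞))
  rw [← Nat.cast_add, Nat.cast_le] at h1
  omega

/-! ### Weights and exponents -/

theorem sum_map_sx_x (s : Multiset ℕ) (v : ℕ) : (s.map sx).sum (Var.x v) = s.count v := by
  induction s using Multiset.induction_on with
  | empty => simp
  | cons a s ih =>
    rw [Multiset.map_cons, Multiset.sum_cons, Finsupp.add_apply, ih, Multiset.count_cons, add_comm,
      sx, Finsupp.single_apply]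
    simp [eq_comm]

theorem sum_map_sx_al (s : Multiset ℕ) (k : ℕ) : (s.map sx).sum (Var.al k) = 0 := by
  induction s using Multiset.induction_on with
  | empty => simp
  | cons a s ih => simp [ih, sx]

theorem sum_map_sx_be (s : Multiset ℕ) (k : ℕ) : (s.map sx).sum (Var.be k) = 0 := by
  induction s using Multiset.induction_on with
  | empty => simp
  | cons a s ih => simp [ih, sx]

theorem weight_sum_map_sx (s : Multiset ℕ) :
    Finsupp.weight xdeg (s.map sx).sum = s.card := by
  rw [map_multiset_sum, Multiset.map_map]
  simp [weight_sx]

theorem cellWt_x (T : HVTab) (c : Cell) (v : ℕ) :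
    cellWt c (T c) (Var.x v) = (hentriesAt T c).count v := by
  rw [hentriesAt_eq]
  cases T c with
  | none => simp [cellWt, oent]
  | some H => simp [cellWt, oent, sum_map_sx_x, sal, sbe]

theorem cellWt_al (T : HVTab) (c : Cell) (k : ℕ) :
    cellWt c (T c) (Var.al k) = if c.2 = k then (armsAt T c).length else 0 := by
  unfold armsAt
  cases T c with
  | none => simp [cellWt]
  | some H => simp [cellWt, sum_map_sx_al, sal, sbe, Finsupp.single_apply]

theorem cellWt_be (T : HVTab) (c : Cell) (k : ℕ) :
    cellWt c (T c) (Var.be k) = if c.1 = k then (legsAt T c).length else 0 := by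
  unfold legsAt
  cases T c with
  | none => simp [cellWt]
  | some H => simp [cellWt, sum_map_sx_be, sal, sbe, Finsupp.single_apply]

theorem exists_subset_range_product {s : Set Cell} (hs : s.Finite) :
    ∃ M, s ⊆ (Finset.range M ×ˢ Finset.range M : Finset Cell) := by
  obtain ⟨M, hM⟩ := (hs.image fun c => max c.1 c.2).bddAbove
  refine ⟨M + 1, fun c hc => ?_⟩
  have := hM ⟨c, hc, rfl⟩
  simp only [Finset.coe_product, Finset.coe_range, Set.mem_prod, Set.mem_Iio]
  simp only at this
  omega

section
variable {T : HVTab}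

theorem wtT_x (hT : (hshape T).Finite) (v : ℕ) : wtT T (Var.x v) = entryCount T v := by
  have h : hshape T ⊆ (hT.toFinset : Finset Cell) := by simp
  rw [wtT_eq_sum h, Finsupp.finsetSum_apply, entryCount, finsum_eq_sum_of_support_subset]
  · exact Finset.sum_congr rfl fun c _ => cellWt_x T c v
  · intro c hc
    refine h fun h0 => hc ?_
    simp [hentriesAt, h0]

theorem wtT_al (hT : (hshape T).Finite) (k : ℕ) : wtT T (Var.al k) = armCountCol T k := by
  obtain ⟨M, hM⟩ := exists_subset_range_product hT
  have h : ∀ c, armsAt T c ≠ [] → c ∈ Finset.range M ×ˢ Finset.range M := by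
    intro c hc
    refine hM fun h0 => hc ?_
    simp [armsAt, h0]
  rw [wtT_eq_sum hM, Finsupp.finsetSum_apply, armCountCol,
    finsum_eq_sum_of_support_subset (s := Finset.range M), Finset.sum_product]
  · refine Finset.sum_congr rfl fun i _ => ?_
    simp only [cellWt_al]
    rw [Finset.sum_ite_eq' (Finset.range M) k fun j => (armsAt T (i, j)).length, ite_eq_left_iff]
    intro hk
    by_contra hne
    exact hk (Finset.mem_product.1 (h (i, k) fun h0 => hne (by simp [h0]))).2
  · intro i hi
    exact (Finset.mem_product.1 (h (i, k) fun h0 => hi (by simp [h0]))).1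

theorem wtT_be (hT : (hshape T).Finite) (k : ℕ) : wtT T (Var.be k) = legCountRow T k := by
  obtain ⟨M, hM⟩ := exists_subset_range_product hT
  have h : ∀ c, legsAt T c ≠ [] → c ∈ Finset.range M ×ˢ Finset.range M := by
    intro c hc
    refine hM fun h0 => hc ?_
    simp [legsAt, h0]
  rw [wtT_eq_sum hM, Finsupp.finsetSum_apply, legCountRow,
    finsum_eq_sum_of_support_subset (s := Finset.range M), Finset.sum_product_right]
  · refine Finset.sum_congr rfl fun j _ => ?_
    simp only [cellWt_be]
    rw [Finset.sum_ite_eq' (Finset.range M) k fun i => (legsAt T (i, j)).length, ite_eq_left_iff]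
    intro hk
    by_contra hne
    exact hk (Finset.mem_product.1 (h (k, j) fun h0 => hne (by simp [h0]))).1
  · intro j hj
    exact (Finset.mem_product.1 (h (k, j) fun h0 => hj (by simp [h0]))).2

theorem le_weight_wtT (hT : IsHVT T) {c : Cell} (hc : c ∈ hshape T) :
    c.2 ≤ Finsupp.weight xdeg (wtT T) := by
  have hfin := hT.1.1
  have hsub : (Finset.Icc 1 c.2).image (fun j => (c.1, j)) ⊆ hfin.toFinset := by
    intro d hd
    obtain ⟨j, hj, rfl⟩ := Finset.mem_image.1 hd
    rw [Finset.mem_Icc] at hj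
    rw [Set.Finite.mem_toFinset]
    exact hT.1.2.2 c.1 c.2 c.1 j hc (hT.1.2.1 c hc).1 le_rfl hj.1 hj.2
  have h := Finset.card_le_card hsub
  rw [Finset.card_image_of_injective _ fun a b h => (Prod.mk.inj h).2, Nat.card_Icc,
    Nat.add_sub_cancel, Finset.card_eq_sum_ones] at h
  refine h.trans ?_
  rw [wtT_eq_sum (F := hfin.toFinset) (by simp), map_sum]
  refine Finset.sum_le_sum fun d hd => ?_
  obtain ⟨H, hH⟩ := mem_hshape.1 (hfin.mem_toFinset.1 hd)
  rw [hH, cellWt, map_add, weight_sum_map_sx, Hook.entries, Multiset.card_cons]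
  omega

end

section
variable {lam mu : Set Cell} {E : MixedTableau}

theorem wtM_al (hE : Exq lam mu E) (hm : mu.Finite) (k : ℕ) :
    wtM E (Var.al k) = mcount E (.al k) := by
  have hfin : (mshape E).Finite := by rw [hE.shape]; exact hm.subset Set.sdiff_subset
  have h : {c | E c = some (.al (k : ℤ))} =
      (hfin.toFinset.filter fun c => E c = some (.al (k : ℤ)) : Finset Cell) := by
    ext c
    simp only [Set.mem_ofPred_eq, Finset.coe_filter, Set.Finite.mem_toFinset]
    exact ⟨fun h => ⟨mem_mshape.2 ⟨_, h⟩, h⟩, fun h => h.2⟩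
  rw [mcount, h, Set.ncard_coe_finset, Finset.card_filter,
    wtM_eq_sum (F := hfin.toFinset) (by simp), Finsupp.finsetSum_apply]
  refine Finset.sum_congr rfl fun c hc => ?_
  obtain ⟨e, he⟩ := mem_mshape.1 (hfin.mem_toFinset.1 hc)
  have hf := hE.flag c e he
  rw [he]
  cases e with
  | be l => simp [mwt, sbe]
  | al l =>
    have : (l.toNat = k) ↔ l = k := by have := hf.1; omega
    simp [mwt, sal, Finsupp.single_apply, this]

theorem wtM_be (hE : Exq lam mu E) (hm : mu.Finite) (k : ℕ) :
    wtM E (Var.be k) = mcount E (.be k) := by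
  have hfin : (mshape E).Finite := by rw [hE.shape]; exact hm.subset Set.sdiff_subset
  have h : {c | E c = some (.be (k : ℤ))} =
      (hfin.toFinset.filter fun c => E c = some (.be (k : ℤ)) : Finset Cell) := by
    ext c
    simp only [Set.mem_ofPred_eq, Finset.coe_filter, Set.Finite.mem_toFinset]
    exact ⟨fun h => ⟨mem_mshape.2 ⟨_, h⟩, h⟩, fun h => h.2⟩
  rw [mcount, h, Set.ncard_coe_finset, Finset.card_filter,
    wtM_eq_sum (F := hfin.toFinset) (by simp), Finsupp.finsetSum_apply]
  refine Finset.sum_congr rfl fun c hc => ?_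
  obtain ⟨e, he⟩ := mem_mshape.1 (hfin.mem_toFinset.1 hc)
  have hf := hE.flag c e he
  rw [he]
  cases e with
  | al l => simp [mwt, sal]
  | be l =>
    have : (l.toNat = k) ↔ l = k := by have := hf.1; omega
    simp [mwt, sbe, Finsupp.single_apply, this]

theorem wtM_x (hE : Exq lam mu E) (hm : mu.Finite) (v : ℕ) : wtM E (Var.x v) = 0 := by
  have hfin : (mshape E).Finite := by rw [hE.shape]; exact hm.subset Set.sdiff_subset
  rw [wtM_eq_sum (F := hfin.toFinset) (by simp), Finsupp.finsetSum_apply]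
  refine Finset.sum_eq_zero fun c hc => ?_
  obtain ⟨e, he⟩ := mem_mshape.1 (hfin.mem_toFinset.1 hc)
  rw [he]
  cases e <;> simp [mwt, sal, sbe]

theorem mcount_eq_zero (hE : Exq lam mu E) {k : ℤ} (hk : k < 0) :
    mcount E (.al k) = 0 ∧ mcount E (.be k) = 0 := by
  have h : ∀ e : MEntry, (∀ c, E c ≠ some e) → mcount E e = 0 := by
    intro e he
    simp [mcount, he]
  refine ⟨h _ fun c hc => ?_, h _ fun c hc => ?_⟩
  · have := (hE.flag c _ hc).1; omega
  · have := (hE.flag c _ hc).1; omega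

end

end Groth

namespace Groth
open Var

/-! ### The three models -/

/-- The monomial `m` has the exponents `a`, `b` and `xv`. -/
def IsExponent (a b : ℤ → ℕ) (xv : ℕ → ℕ) (m : Var →₀ ℕ) : Prop :=
  (∀ k : ℤ, (if 0 ≤ k then m (.al k.toNat) else 0) = a k) ∧
  (∀ k : ℤ, (if 0 ≤ k then m (.be k.toNat) else 0) = b k) ∧ ∀ v, m (.x v) = xv v

theorem IsExponent.unique {a b : ℤ → ℕ} {xv : ℕ → ℕ} {m m' : Var →₀ ℕ}
    (h : IsExponent a b xv m) : IsExponent a b xv m' ↔ m' = m := by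
  refine ⟨fun h' => ?_, fun h' => h' ▸ h⟩
  ext v
  cases v with
  | al k => simpa using (h'.1 k).trans (h.1 k).symm
  | be k => simpa using (h'.2.1 k).trans (h.2.1 k).symm
  | x v => exact (h'.2.2 v).trans (h.2.2 v).symm

section
variable {lam : Set Cell} {a b : ℤ → ℕ} {xv : ℕ → ℕ}

theorem mem_grothHVT {H : HVTab} : H ∈ GrothHVT lam a b xv ↔
    IsHVT H ∧ hshape H = lam ∧ IsExponent a b xv (wtT H) := by
  refine and_congr_right fun h1 => and_congr_right fun _ => ?_
  simp only [IsExponent, wtT_al h1.1.1, wtT_be h1.1.1, wtT_x h1.1.1]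
  rfl

theorem wtT_al_be_eq_zero {P : HVTab} (hP : IsSSYT P) (k : ℕ) :
    wtT P (.al k) = 0 ∧ wtT P (.be k) = 0 := by
  rw [wtT_al hP.1.1.1, wtT_be hP.1.1.1]
  have h1 : ∀ c, armsAt P c = [] := hP.2.1
  have h2 : ∀ c, legsAt P c = [] := hP.2.2
  simp [armCountCol, legCountRow, h1, h2]

theorem mem_grothEXQ (hl : IsPartitionShape lam) {p : Set Cell × HVTab × MixedTableau} :
    p ∈ GrothEXQ lam a b xv ↔ hshape p.2.1 = p.1 ∧ IsSSYT p.2.1 ∧ lam ⊆ hshape p.2.1 ∧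
      Exq lam (hshape p.2.1) p.2.2 ∧ IsExponent a b xv (wtT p.2.1 + wtM p.2.2) := by
  obtain ⟨mu, P, E⟩ := p
  have key : IsSSYT P → Exq lam (hshape P) E → (IsExponent a b xv (wtT P + wtM E) ↔
      (∀ v : ℕ, entryCount P v = xv v) ∧ (∀ k : ℤ, mcount E (MEntry.al k) = a k) ∧
        ∀ k : ℤ, mcount E (MEntry.be k) = b k) := by
    intro hP hE
    have hfin := hP.1.1.1
    have h1 : ∀ k : ℤ, (if 0 ≤ k then (wtT P + wtM E) (.al k.toNat) else 0) =
        mcount E (.al k) := by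
      intro k
      split_ifs with hk
      · rw [Finsupp.add_apply, (wtT_al_be_eq_zero hP _).1, zero_add, wtM_al hE hfin,
          Int.toNat_of_nonneg hk]
      · exact (mcount_eq_zero hE (not_le.1 hk)).1.symm
    have h2 : ∀ k : ℤ, (if 0 ≤ k then (wtT P + wtM E) (.be k.toNat) else 0) =
        mcount E (.be k) := by
      intro k
      split_ifs with hk
      · rw [Finsupp.add_apply, (wtT_al_be_eq_zero hP _).2, zero_add, wtM_be hE hfin,
          Int.toNat_of_nonneg hk]
      · exact (mcount_eq_zero hE (not_le.1 hk)).2.symm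
    have h3 : ∀ v, (wtT P + wtM E) (.x v) = entryCount P v := fun v => by
      rw [Finsupp.add_apply, wtM_x hE hfin, add_zero, wtT_x hfin]
    simp only [IsExponent, h1, h2, h3]
    tauto
  constructor
  · rintro ⟨h1, h2, h3, he, h4, h5⟩
    obtain rfl : hshape P = mu := he
    have hE := ((isEXQ_iff hl h1).1 h4).2
    exact ⟨rfl, h3, h2, hE, (key h3 hE).2 h5⟩
  · rintro ⟨he, h3, h2, hE, h5⟩
    obtain rfl : hshape P = mu := he
    exact ⟨h3.1.1, h2, h3, rfl, (isEXQ_iff hl h3.1.1).2 ⟨h2, hE⟩, (key h3 hE).1 h5⟩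

end

theorem mem_HV_of_wtT {n : ℕ} {T : HVTab} (hT : (hshape T).Finite)
    (hn : ∀ v, n < v → wtT T (.x v) = 0) : ∀ c, ∀ x ∈ hentriesAt T c, x ≤ n := by
  intro c x hx
  by_contra! hlt
  have h := hn x hlt
  have hc : c ∈ hT.toFinset := hT.mem_toFinset.2 (mem_hshape_of_mem hx)
  rw [wtT_eq_sum (F := hT.toFinset) (by simp), Finsupp.finsetSum_apply,
    Finset.sum_eq_zero_iff] at h
  have h1 := h c hc
  rw [cellWt_x, Multiset.count_eq_zero] at h1
  exact h1 hx

theorem hvt_finite_and_ncard_eq_exq {lam : Set Cell} (hl : IsPartitionShape lam)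
    (a b : ℤ → ℕ) (xv : ℕ → ℕ) :
    (GrothHVT lam a b xv).Finite ∧ (GrothEXQ lam a b xv).Finite ∧
      (GrothHVT lam a b xv).ncard = (GrothEXQ lam a b xv).ncard := by
  by_cases hm : ∃ m, IsExponent a b xv m
  swap
  · have h1 : GrothHVT lam a b xv = ∅ :=
      Set.eq_empty_of_forall_notMem fun H hH => hm ⟨_, (mem_grothHVT.1 hH).2.2⟩
    have h2 : GrothEXQ lam a b xv = ∅ :=
      Set.eq_empty_of_forall_notMem fun p hp => hm ⟨_, ((mem_grothEXQ hl).1 hp).2.2.2.2⟩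
    simp [h1, h2]
  obtain ⟨m, hm⟩ := hm
  obtain ⟨n₁, hn₁⟩ := exists_rowLen_eq_zero hl
  obtain ⟨n₂, hn₂⟩ : ∃ n, ∀ v, n < v → m (.x v) = 0 := by
    obtain ⟨n, hn⟩ := (m.support.finite_toSet.preimage (fun _ _ _ _ h => Var.x.inj h) :
      (Var.x ⁻¹' (m.support : Set Var)).Finite).bddAbove
    refine ⟨n, fun v hv => ?_⟩
    by_contra hne
    exact absurd (hn (show v ∈ Var.x ⁻¹' (m.support : Set Var) by simpa using hne)) (by omega)
  obtain ⟨n, hn⟩ : ∃ n, n = max n₁ n₂ := ⟨_, rfl⟩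
  have hr := cellsOf_rowLen hl
  have hanti : Antitone (rowLen lam) := antitone_of_isPartitionShape (hr.symm ▸ hl)
  have h0 : ∀ i, n ≤ i → rowLen lam i = 0 := fun i hi => hn₁ i (by omega)
  have hx : ∀ v, n < v → m (.x v) = 0 := fun v hv => hn₂ v (by omega)
  obtain ⟨L, hk, hL, hcoeff⟩ :=
    exists_coeff_G_eq_coeff_F n (Finsupp.weight xdeg m) (rowLen lam) hanti h0
  have hG := hasGF_HV False n (rowLen lam) hanti h0
  have hF := hasGF_EX n L (L + n) (rowLen lam) hanti h0 hL
  have h1 : GrothHVT lam a b xv = {T | T ∈ HV False n (rowLen lam) ∧ wtT T = m} := by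
    ext T
    rw [mem_grothHVT, hm.unique]
    constructor
    · rintro ⟨h1, h2, rfl⟩
      exact ⟨⟨h1, h2.trans hr.symm, mem_HV_of_wtT h1.1.1 hx, False.elim⟩, rfl⟩
    · rintro ⟨⟨h1, h2, _⟩, h3⟩
      exact ⟨h1, h2.trans hr, h3⟩
  have h2 : GrothEXQ lam a b xv = (fun q : HVTab × MixedTableau => (hshape q.1, q.1, q.2)) ''
      {q | q ∈ EX n L (L + n) (rowLen lam) ∧ wtT q.1 + wtM q.2 = m} := by
    ext ⟨mu, P, E⟩
    rw [mem_grothEXQ hl, hm.unique]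
    constructor
    · rintro ⟨he, h1, h2, h3, h4⟩
      obtain rfl : hshape P = mu := he
      simp only at h1 h2 h3 h4
      have hle : ∀ c ∈ hshape P, c.2 ≤ L := by
        intro c hc
        refine (le_weight_wtT h1.1 hc).trans (le_trans ?_ hk)
        rw [← h4, map_add]
        exact Nat.le_add_right _ _
      refine ⟨(P, E), ⟨⟨h1, mem_HV_of_wtT h1.1.1.1 fun v hv => ?_, hle, hr.symm ▸ h2,
        hr.symm ▸ h3, fun c e he => ?_⟩, h4⟩, rfl⟩
      · have := hx v hv
        rw [← h4, Finsupp.add_apply] at this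
        exact (Nat.add_eq_zero_iff.1 this).1
      · have h5 := ev_lt_of_flag (h3.flag c e he)
        have h6 : c ∈ mshape E := mem_mshape.2 ⟨e, he⟩
        rw [h3.shape] at h6
        have h7 := hle c h6.1
        push_cast
        omega
    · rintro ⟨⟨P', E'⟩, ⟨⟨h1, h2, h3, h4, h5, h6⟩, h7⟩, h8⟩
      obtain ⟨rfl, h9⟩ := Prod.mk.inj h8
      obtain ⟨rfl, rfl⟩ := Prod.mk.inj h9
      rw [hr] at h4 h5
      exact ⟨rfl, h1, h4, h5, h7⟩
  have hinj : Function.Injective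
      fun q : HVTab × MixedTableau => (hshape q.1, q.1, q.2) :=
    fun q q' h => (Prod.mk.inj h).2
  rw [h1, h2]
  refine ⟨hG.fin m, (hF.fin m).image _, ?_⟩
  rw [Set.ncard_image_of_injective _ hinj]
  have := hcoeff m le_rfl
  rw [hG.coeff, hF.coeff] at this
  exact_mod_cast this

end Groth

/-- Corollary 4.25: coefficientwise equality of the three combinatorial models
for the refined canonical stable Grothendieck polynomial `G_lam(x; α, β)`. -/
theorem grothendieck_three_models (lam : Set Cell) (hl : IsPartitionShape lam)
    (a b : ℤ → ℕ) (xv : ℕ → ℕ) :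
    (GrothHVT lam a b xv).Finite ∧ (GrothEXQ lam a b xv).Finite ∧
    (GrothBFT lam a b xv).Finite ∧
    (GrothHVT lam a b xv).ncard = (GrothEXQ lam a b xv).ncard ∧
    (GrothEXQ lam a b xv).ncard = (GrothBFT lam a b xv).ncard := by
  obtain ⟨h1, h2, h3⟩ := Groth.hvt_finite_and_ncard_eq_exq hl a b xv
  exact ⟨h1, h2, (Groth.bft_finite_iff lam a b xv).2 h2, h3, Groth.exq_ncard_eq_bft lam a b xv⟩
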